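/- For every finite planar graph G, semiweak_4(G) ≤ 43. Moreover, letting g denote the girth of G: if g ≥ 10 then semiweak_4(G) ≤ 33; if g ≥ 11 then semiweak_4(G) ≤ 23; if g ≥ 13 then semiweak_4(G) ≤ 18; and if g ≥ 17 then semiweak_4(G) ≤ 9. -/

import Mathlib

/-- A plane embedding of a graph `G`: an injective placement `f` of the vertices in the
plane together with, for each edge, a continuous injective arc joining the images of its
endpoints, such that arcs meet vertex points only at their own endpoints and two distinct
arcs meet only at images of common endpoints. -/
def IsPlaneEmbedding {V : Type} (G : SimpleGraph V) (f : V → ℝ × ℝ)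
    (γ : G.edgeSet → Set.Icc (0:ℝ) 1 → ℝ × ℝ) : Prop :=
  Function.Injective f ∧
  (∀ e : G.edgeSet, Continuous (γ e) ∧ Function.Injective (γ e)) ∧
  (∀ e : G.edgeSet, ∃ u v : V, (e : Sym2 V) = s(u, v) ∧
    γ e ⟨0, by norm_num⟩ = f u ∧ γ e ⟨1, by norm_num⟩ = f v) ∧
  (∀ e : G.edgeSet, ∀ x : V, ∀ t, γ e t = f x → x ∈ (e : Sym2 V)) ∧
  (∀ e e' : G.edgeSet, e ≠ e' → ∀ t t', γ e t = γ e' t' →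
    ∃ x : V, x ∈ (e : Sym2 V) ∧ x ∈ (e' : Sym2 V) ∧ γ e t = f x)

/-- A graph is planar if it admits a plane embedding. -/
def IsPlanar {V : Type} (G : SimpleGraph V) : Prop :=
  ∃ f γ, IsPlaneEmbedding G f γ

/-- `x ∈ SubReach_k(G,σ,y)`: there is a path `z_0 z_1 ⋯ z_s` with `z_0 = x`, `z_s = y`,
`s ≤ k`, `x` the `σ`-minimum vertex of the path, and `y ≤_σ z_i` for `⌈k/2⌉ ≤ i ≤ s`. -/
def SubReach {V : Type} (G : SimpleGraph V) (σ : V → ℕ) (k : ℕ) (y : V) : Set V :=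
  {x | ∃ p : G.Walk x y, p.IsPath ∧ p.length ≤ k ∧
    (∀ i ≤ p.length, σ x ≤ σ (p.getVert i)) ∧
    (∀ i, (k + 1) / 2 ≤ i → i ≤ p.length → σ y ≤ σ (p.getVert i))}

/-- The semi-weak `k`-colouring number of the ordering `σ`. -/
noncomputable def semiweakOrd {V : Type} [Fintype V] (G : SimpleGraph V) (σ : V → ℕ)
    (k : ℕ) : ℕ :=
  Finset.univ.sup fun y => (SubReach G σ k y).ncard

/-- The semi-weak `k`-colouring number of `G`: minimum over all linear orderings. -/
noncomputable def semiweak {V : Type} [Fintype V] (G : SimpleGraph V) (k : ℕ) : ℕ :=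
  sInf {n : ℕ | ∃ σ : V → ℕ, Function.Injective σ ∧ semiweakOrd G σ k = n}

namespace PlanarOrder

variable {V : Type}

/-- `Trek G K p y a`: there is a walk of length `a` from `p` to `y` all of whose vertices
after the first one lie in `K`. -/
inductive Trek (G : SimpleGraph V) (K : Set V) (p : V) : V → ℕ → Prop
  | refl : Trek G K p p 0
  | step {y z : V} {a : ℕ} : Trek G K p y a → G.Adj y z → z ∈ K → Trek G K p z (a + 1)

variable {G : SimpleGraph V} {K K' : Set V} {p q y z : V} {a b : ℕ}

theorem Trek.mono (h : Trek G K p y a) (hK : K ⊆ K') : Trek G K' p y a := by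
  induction h with
  | refl => exact .refl
  | step _ hadj hz ih => exact .step ih hadj (hK hz)

theorem Trek.mem_of_mem (h : Trek G K p y a) (hp : p ∈ K) : y ∈ K := by
  cases h with
  | refl => exact hp
  | step _ _ hz => exact hz

theorem Trek.trans (h : Trek G K p y a) (h' : Trek G K y z b) : Trek G K p z (a + b) := by
  induction h' with
  | refl => exact h
  | step _ hadj hz ih => exact .step ih hadj hz

theorem Trek.cons (hpq : G.Adj q p) (hp : p ∈ K) (h : Trek G K p y a) :
    Trek G K q y (a + 1) := by
  rw [add_comm]
  exact (Trek.step .refl hpq hp).trans h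

theorem Trek.symm (h : Trek G K p y a) (hp : p ∈ K) : Trek G K y p a := by
  induction h with
  | refl => exact .refl
  | step h' hadj hz ih => exact Trek.cons hadj.symm (h'.mem_of_mem hp) ih

theorem Trek.exists_fun (h : Trek G K p y a) : ∃ f : ℕ → V, f 0 = p ∧ f a = y ∧
    (∀ k < a, G.Adj (f k) (f (k + 1))) ∧ ∀ k, 0 < k → k ≤ a → f k ∈ K := by
  induction h with
  | refl => exact ⟨fun _ => p, rfl, rfl, by simp, by omega⟩
  | @step y z a h' hadj hz ih =>
    obtain ⟨f, h0, ha, hf, hK⟩ := ih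
    refine ⟨fun k => if k ≤ a then f k else z, by simp [h0], by simp, ?_, ?_⟩
    · intro k hk
      rcases Nat.lt_succ_iff_lt_or_eq.1 hk with h1 | h1
      · simpa [h1.le, Nat.succ_le_of_lt h1] using hf k h1
      · subst h1
        simpa [ha] using hadj
    · intro k hk hka
      by_cases h1 : k ≤ a
      · simpa [h1] using hK k hk h1
      · simpa [h1] using hz

theorem Trek.of_fun (f : ℕ → V) {i j : ℕ} (hij : i ≤ j)
    (hf : ∀ k, i ≤ k → k < j → G.Adj (f k) (f (k + 1)))
    (hK : ∀ k, i < k → k ≤ j → f k ∈ K) : Trek G K (f i) (f j) (j - i) := by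
  induction j, hij using Nat.le_induction with
  | base => simpa using Trek.refl
  | succ j hij ih =>
    have := ih (fun k h1 h2 => hf k h1 (by omega)) (fun k h1 h2 => hK k h1 (by omega))
    rw [Nat.succ_sub hij]
    exact .step this (hf j hij (by omega)) (hK _ (by omega) le_rfl)

theorem Trek.of_fun_rev (f : ℕ → V) {i j : ℕ} (hij : i ≤ j)
    (hf : ∀ k, i ≤ k → k < j → G.Adj (f k) (f (k + 1)))
    (hK : ∀ k, i ≤ k → k < j → f k ∈ K) : Trek G K (f j) (f i) (j - i) := by
  induction j, hij using Nat.le_induction with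
  | base => simpa using Trek.refl
  | succ j hij ih =>
    have := ih (fun k h1 h2 => hf k h1 (by omega)) (fun k h1 h2 => hK k h1 (by omega))
    rw [Nat.succ_sub hij]
    exact Trek.cons (hf j hij (by omega)).symm (hK _ hij (by omega)) this

/-- Any two vertices of `S` are joined by a walk inside `S`. -/
def Linked (G : SimpleGraph V) (S : Set V) : Prop :=
  ∀ x ∈ S, ∀ y ∈ S, ∃ a, Trek G S x y a

theorem linked_singleton (v : V) : Linked G {v} := by
  rintro x rfl y rfl
  exact ⟨0, .refl⟩

theorem linked_of_hub {S : Set V} (c : V) (hc : c ∈ S) (h : ∀ x ∈ S, ∃ a, Trek G S c x a) :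
    Linked G S := by
  intro x hx y hy
  obtain ⟨a, ha⟩ := h x hx
  obtain ⟨b, hb⟩ := h y hy
  exact ⟨_, (ha.symm hc).trans hb⟩

theorem Linked.union {S T : Set V} (hS : Linked G S) (hT : Linked G T) {s t : V}
    (hs : s ∈ S) (ht : t ∈ T) (hst : G.Adj s t) : Linked G (S ∪ T) := by
  refine linked_of_hub s (.inl hs) ?_
  rintro x (hx | hx)
  · obtain ⟨a, ha⟩ := hS s hs x hx
    exact ⟨a, ha.mono Set.subset_union_left⟩
  · obtain ⟨a, ha⟩ := hT t ht x hx
    exact ⟨_, Trek.cons hst (.inr ht) (ha.mono Set.subset_union_right)⟩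

theorem linked_image_interval (f : ℕ → V) (I : Set ℕ) (hI : I.OrdConnected)
    (hf : ∀ k ∈ I, k + 1 ∈ I → G.Adj (f k) (f (k + 1))) : Linked G (f '' I) := by
  have key : ∀ i ∈ I, ∀ j ∈ I, i ≤ j → Trek G (f '' I) (f i) (f j) (j - i) := by
    intro i hi j hj hij
    refine Trek.of_fun f hij (fun k h1 h2 => ?_) (fun k h1 h2 => ?_)
    · exact hf k (hI.out hi hj ⟨h1, h2.le⟩) (hI.out hi hj ⟨by omega, h2⟩)
    · exact ⟨k, hI.out hi hj ⟨h1.le, h2⟩, rfl⟩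
  rintro _ ⟨i, hi, rfl⟩ _ ⟨j, hj, rfl⟩
  rcases le_total i j with h | h
  · exact ⟨_, key i hi j hj h⟩
  · exact ⟨_, (key j hj i hi h).symm ⟨j, hj, rfl⟩⟩

/-- The two vertex sets `S` and `T` are joined by an edge. -/
def Touch (G : SimpleGraph V) (S T : Set V) : Prop :=
  ∃ x ∈ S, ∃ y ∈ T, G.Adj x y

/-- `G` has no minor isomorphic to the complete bipartite graph `K₃,₃`. -/
def NoK33 (G : SimpleGraph V) : Prop :=
  ¬ ∃ S : Fin 3 ⊕ Fin 3 → Set V, (∀ i, Linked G (S i)) ∧ Pairwise (fun i j => Disjoint (S i) (S j)) ∧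
    ∀ i j : Fin 3, Touch G (S (.inl i)) (S (.inr j))

theorem NoK33.elim (hG : NoK33 G) {A₀ A₁ A₂ B₀ B₁ B₂ : Set V}
    (hA₀ : Linked G A₀) (hA₁ : Linked G A₁) (hA₂ : Linked G A₂)
    (hB₀ : Linked G B₀) (hB₁ : Linked G B₁) (hB₂ : Linked G B₂)
    (dA₀₁ : Disjoint A₀ A₁) (dA₀₂ : Disjoint A₀ A₂) (dA₁₂ : Disjoint A₁ A₂)
    (dB₀₁ : Disjoint B₀ B₁) (dB₀₂ : Disjoint B₀ B₂) (dB₁₂ : Disjoint B₁ B₂)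
    (d₀₀ : Disjoint A₀ B₀) (d₀₁ : Disjoint A₀ B₁) (d₀₂ : Disjoint A₀ B₂)
    (d₁₀ : Disjoint A₁ B₀) (d₁₁ : Disjoint A₁ B₁) (d₁₂ : Disjoint A₁ B₂)
    (d₂₀ : Disjoint A₂ B₀) (d₂₁ : Disjoint A₂ B₁) (d₂₂ : Disjoint A₂ B₂)
    (t₀₀ : Touch G A₀ B₀) (t₀₁ : Touch G A₀ B₁) (t₀₂ : Touch G A₀ B₂)
    (t₁₀ : Touch G A₁ B₀) (t₁₁ : Touch G A₁ B₁) (t₁₂ : Touch G A₁ B₂)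
    (t₂₀ : Touch G A₂ B₀) (t₂₁ : Touch G A₂ B₁) (t₂₂ : Touch G A₂ B₂) : False := by
  apply hG
  refine ⟨Sum.elim ![A₀, A₁, A₂] ![B₀, B₁, B₂], ?_, ?_, ?_⟩
  · rintro (i | i) <;> fin_cases i <;> simpa
  · rintro (i | i) (j | j) hij <;> fin_cases i <;> fin_cases j <;>
      first
        | exact absurd rfl hij
        | assumption
        | exact Disjoint.symm (by assumption)
  · intro i j
    fin_cases i <;> fin_cases j <;> simpa

/-- A shortest connection through `K` between two vertices is isometric. -/
theorem exists_isometric_path {u t : V} (hK : Linked G K) (hu : u ∉ K)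
    (huK : ∃ w ∈ K, G.Adj u w) (htu : t ≠ u) (ht : t ∈ K ∨ ∃ w ∈ K, G.Adj t w) :
    ∃ (len : ℕ) (cl : ℕ → V), cl 0 = u ∧ cl len = t ∧ 0 < len ∧
      (∀ k, 0 < k → k < len → cl k ∈ K) ∧
      (∀ k < len, G.Adj (cl k) (cl (k + 1))) ∧
      (∀ i ≤ len, ∀ j ≤ len, cl i = cl j → i = j) ∧
      (∀ i ≤ len, ∀ j ≤ len, ∀ y ∈ K, ∀ a b, Trek G K (cl i) y a → Trek G K (cl j) y b →
        j ≤ i + a + b) ∧ (t ∉ K → 2 ≤ len) := by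
  classical
  have hex : ∃ l : ℕ, ∃ y ∈ K, ∃ a b, Trek G K u y a ∧ Trek G K t y b ∧ a + b = l := by
    obtain ⟨w, hw, huw⟩ := huK
    rcases ht with ht | ⟨w', hw', htw⟩
    · obtain ⟨a, ha⟩ := hK w hw t ht
      exact ⟨_, t, ht, _, _, Trek.cons huw hw ha, .refl, rfl⟩
    · obtain ⟨a, ha⟩ := hK w hw w' hw'
      exact ⟨_, w', hw', _, _, Trek.cons huw hw ha, Trek.step .refl htw hw', rfl⟩
  obtain ⟨y, hy, a, b, ha, hb, hab⟩ := Nat.find_spec hex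
  have hmin : ∀ y' ∈ K, ∀ a' b', Trek G K u y' a' → Trek G K t y' b' → a + b ≤ a' + b' := by
    intro y' hy' a' b' h1 h2
    rw [hab]
    exact Nat.find_min' hex ⟨y', hy', a', b', h1, h2, rfl⟩
  obtain ⟨f, f0, fa, fadj, fK⟩ := ha.exists_fun
  obtain ⟨g, g0, gb, gadj, gK⟩ := hb.exists_fun
  have hapos : 0 < a := by
    rcases Nat.eq_zero_or_pos a with h | h
    · subst h
      exact absurd (f0 ▸ fa ▸ hy) hu
    · exact h
  set cl : ℕ → V := fun k => if k ≤ a then f k else g (a + b - k) with hcl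
  have c0 : cl 0 = u := by simp [hcl, f0]
  have clen : cl (a + b) = t := by
    rcases Nat.eq_zero_or_pos b with h | h
    · subst h
      simp [hcl, fa, ← g0, gb]
    · have : ¬ a + b ≤ a := by omega
      simp [hcl, this, g0]
  have cK : ∀ k, 0 < k → k < a + b → cl k ∈ K := by
    intro k h1 h2
    by_cases h : k ≤ a
    · simpa [hcl, h] using fK k h1 h
    · simpa [hcl, h] using gK (a + b - k) (by omega) (by omega)
  have cadj : ∀ k < a + b, G.Adj (cl k) (cl (k + 1)) := by
    intro k hk
    rcases lt_trichotomy k a with h | h | h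
    · simpa [hcl, h.le, Nat.succ_le_of_lt h] using fadj k h
    · subst h
      have h1 := gadj (b - 1) (by omega)
      rw [show b - 1 + 1 = b by omega, gb, ← fa] at h1
      have h2 : ¬ k + 1 ≤ k := by omega
      simp only [hcl, le_refl, if_true, h2, if_false]
      rw [show k + b - (k + 1) = b - 1 by omega]
      exact h1.symm
    · have h1 := gadj (a + b - (k + 1)) (by omega)
      rw [show a + b - (k + 1) + 1 = a + b - k by omega] at h1
      have h2 : ¬ k ≤ a := by omega
      have h3 : ¬ k + 1 ≤ a := by omega
      simp only [hcl, h2, h3, if_false]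
      exact h1.symm
  have iso : ∀ i ≤ a + b, ∀ j ≤ a + b, ∀ y ∈ K, ∀ c d, Trek G K (cl i) y c →
      Trek G K (cl j) y d → j ≤ i + c + d := by
    intro i hi j hj y hy c d hc hd
    by_contra hlt
    have t1 : Trek G K (cl 0) y (i + c) := by
      rcases Nat.lt_or_ge i (a + b) with h | h
      · exact (Trek.of_fun cl (Nat.zero_le i) (fun k _ h2 => cadj k (by omega))
          (fun k h1 h2 => cK k h1 (by omega))).trans hc
      · omega
    have t2 : Trek G K (cl (a + b)) y (a + b - j + d) := by
      rcases Nat.eq_zero_or_pos j with h | h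
      · omega
      · exact (Trek.of_fun_rev cl hj (fun k _ h2 => cadj k (by omega))
          (fun k h1 h2 => cK k (by omega) (by omega))).trans hd
    rw [c0] at t1
    rw [clen] at t2
    have := hmin y hy _ _ t1 t2
    omega
  refine ⟨a + b, cl, c0, clen, by omega, cK, cadj, ?_, iso, ?_⟩
  · have key : ∀ i j, i ≤ a + b → j ≤ a + b → i < j → cl i ≠ cl j := by
      intro i j hi hj hij h
      by_cases hm : cl i ∈ K
      · have := iso i hi j hj (cl i) hm 0 0 .refl (by rw [← h]; exact .refl)
        omega
      · have h0 : i = 0 := by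
          by_contra h0
          exact hm (cK i (by omega) (by omega))
        have h1 : j = a + b := by
          by_contra h1
          exact hm (h ▸ cK j (by omega) (by omega))
        subst h0 h1
        rw [c0, clen] at h
        exact htu h.symm
    intro i hi j hj h
    rcases lt_trichotomy i j with h1 | h1 | h1
    · exact absurd h (key i j hi hj h1)
    · exact h1
    · exact absurd h.symm (key j i hj hi h1)
  · intro htK
    by_contra hlt
    have hb0 : b = 0 := by omega
    subst hb0
    exact htK (g0 ▸ gb ▸ hy)

end PlanarOrder

namespace PlanarOrder

variable {V : Type}

/-- A piece of the recursive decomposition: a region `K`, a path `cl 0, …, cl len` running through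
it (up to its ends), a set `X` of further boundary vertices, a flag telling whether the last two
inner vertices of the path are swapped in the ordering, and the two earlier pieces `L`, `O` whose
paths carry the boundary of the region. -/
inductive PNode (V : Type) : Type
  | root : PNode V
  | mk (K X : Set V) (len : ℕ) (cl : ℕ → V) (sw : Prop) (L O : PNode V) : PNode V

namespace PNode

def region : PNode V → Set V
  | root => Set.univ
  | mk K _ _ _ _ _ _ => K

def X : PNode V → Set V
  | root => ∅
  | mk _ X _ _ _ _ _ => X

def len : PNode V → ℕ
  | root => 0
  | mk _ _ len _ _ _ _ => len

def sw : PNode V → Prop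
  | root => False
  | mk _ _ _ _ sw _ _ => sw

def L : PNode V → PNode V
  | root => root
  | mk _ _ _ _ _ L _ => L

def O : PNode V → PNode V
  | root => root
  | mk _ _ _ _ _ _ O => O

/-- The vertex `v` is the `k`-th vertex of the path of the node. -/
def At : PNode V → ℕ → V → Prop
  | root, _, _ => False
  | mk _ _ len cl _ _ _, k, v => k ≤ len ∧ cl k = v

def clSet (n : PNode V) : Set V := {v | ∃ k, n.At k v}

def body (n : PNode V) : Set V := n.clSet ∩ n.region

/-- The inner part of the segment of the path of `n.L` cut off by the ends of the path of `n`. -/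
def mid (n : PNode V) : Set V :=
  {w | ∃ u v i k j, n.At 0 u ∧ n.At n.len v ∧ n.L.At i u ∧ n.L.At k w ∧ n.L.At j v ∧
    i < k ∧ k < j}

def All (P : PNode V → Prop) : PNode V → Prop
  | root => True
  | mk K X len cl sw L O => P (mk K X len cl sw L O) ∧ L.All P ∧ O.All P

open Classical in
/-- The position of the `k`-th path vertex in the ordering of the path. -/
noncomputable def rk (n : PNode V) (k : ℕ) : ℕ :=
  if n.sw ∧ k + 1 = n.len then k - 1 else if n.sw ∧ k + 2 = n.len then k + 1 else k

variable {n : PNode V} {P Q : PNode V → Prop} {i j k : ℕ} {u v w : V}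

theorem All.left (h : n.All P) : n.L.All P := by
  cases n with
  | root => trivial
  | mk => exact h.2.1

theorem All.right (h : n.All P) : n.O.All P := by
  cases n with
  | root => trivial
  | mk => exact h.2.2

theorem All.mono (hPQ : ∀ m, P m → Q m) (h : n.All P) : n.All Q := by
  induction n with
  | root => trivial
  | mk K X len cl sw L O ihL ihO => exact ⟨hPQ _ h.1, ihL h.2.1, ihO h.2.2⟩

theorem All.and (h : n.All P) (h' : n.All Q) : n.All (fun m => P m ∧ Q m) := by
  induction n with
  | root => trivial
  | mk K X len cl sw L O ihL ihO => exact ⟨⟨h.1, h'.1⟩, ihL h.2.1 h'.2.1, ihO h.2.2 h'.2.2⟩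

theorem All.self_of_at (h : n.All P) (hv : n.At k v) : P n := by
  cases n with
  | root => exact hv.elim
  | mk => exact h.1

theorem All.self_of_mem (h : n.All P) (hv : v ∈ n.clSet) : P n := by
  obtain ⟨k, hk⟩ := hv
  exact h.self_of_at hk

theorem at_le (h : n.At k v) : k ≤ n.len := by
  cases n with
  | root => exact h.elim
  | mk => exact h.1

theorem at_fun (h : n.At k v) (h' : n.At k w) : v = w := by
  cases n with
  | root => exact h.elim
  | mk => exact h.2.symm.trans h'.2

theorem at_total (h : n.At k v) (hi : i ≤ n.len) : ∃ w, n.At i w := by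
  cases n with
  | root => exact h.elim
  | mk => exact ⟨_, hi, rfl⟩

theorem exists_fun (h : n.At k v) : ∃ cl : ℕ → V, ∀ i w, n.At i w ↔ i ≤ n.len ∧ cl i = w := by
  cases n with
  | root => exact h.elim
  | mk K X len cl => exact ⟨cl, fun i w => Iff.rfl⟩

end PNode

open PNode

variable {G : SimpleGraph V} {n m : PNode V} {P Q : PNode V → Prop} {i j k : ℕ} {u v w x y z : V}

/-- The structural conditions a node of the decomposition satisfies. -/
structure Good (G : SimpleGraph V) (f : Prop) (n : PNode V) : Prop where
  linked : Linked G n.region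
  nonempty : n.body.Nonempty
  inj : ∀ i j v, n.At i v → n.At j v → i = j
  adj : ∀ k v w, n.At k v → n.At (k + 1) w → G.Adj v w
  inner : ∀ k v, n.At k v → 0 < k → k < n.len → v ∈ n.region
  pole : ∀ k v, n.At k v → v ∉ n.region → v ∈ n.L.clSet
  start : ∀ u v, n.At 0 u → n.At n.len v → v ∉ n.region → u ∉ n.region ∧ u ≠ v
  iso : ∀ i j p q y a b, y ∈ n.region → n.At i p → n.At j q → Trek G n.region p y a →
    Trek G n.region q y b → j ≤ i + a + b
  bdry : ∀ w z, w ∈ n.region → z ∉ n.region → G.Adj w z →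
    n.At 0 z ∨ n.At n.len z ∨ z ∈ n.mid ∨ z ∈ n.X
  X_sub : n.X ⊆ n.O.body
  region_sub : n.region ⊆ n.L.region
  disj_body : ∀ v ∈ n.L.body, v ∉ n.region
  disj_X : ∀ v ∈ n.X, v ∉ n.L.clSet
  kind : (n.O = n.L.O ∧ n.X ⊆ n.L.X) ∨ (n.O = n.L.L ∧ n.X ⊆ n.L.mid)
  cross : n.X.Nonempty → ∃ Z, Linked G Z ∧ n.X ⊆ Z ∧
    (∀ v ∈ Z, v ∉ n.region ∧ v ∉ n.mid ∧ ¬ n.At 0 v ∧ ¬ n.At n.len v) ∧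
    (∀ v, n.At 0 v → ∃ z ∈ Z, G.Adj v z) ∧ (∀ v, n.At n.len v → ∃ z ∈ Z, G.Adj v z)
  oneSided : (∀ x ∈ n.X, ∀ z ∈ n.O.mid, ¬ G.Adj x z) ∨ (∀ x ∈ n.X, ∀ z ∈ n.O.X, ¬ G.Adj x z)
  swap : n.sw ↔ f ∧ (∃ k v, k + 1 = n.len ∧ n.At k v ∧ ∃ x ∈ n.X, G.Adj v x) ∧
    ∃ v, n.At n.len v ∧ v ∉ n.region

/-- The conditions on the ordering at a node. -/
structure OrdAt (G : SimpleGraph V) (σ : V → ℕ) (n : PNode V) : Prop where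
  bdry_lt : ∀ z w w', z ∉ n.region → w ∈ n.region → w' ∈ n.region → G.Adj w z → σ z < σ w'
  body_lt : ∀ v w, v ∈ n.body → w ∈ n.region → w ∉ n.body → σ v < σ w
  rk_lt : ∀ i j v w, n.At i v → n.At j w → v ∈ n.region → w ∈ n.region → n.rk i < n.rk j →
    σ v < σ w

/-- All vertices of the path and of the outer boundary lie outside `U`. -/
def CleanAt (G : SimpleGraph V) (U : Set V) (n : PNode V) : Prop :=
  (∀ v ∈ n.body, v ∉ U) ∧ ∀ w z, w ∈ n.region → z ∉ n.region → G.Adj w z → z ∉ U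

section structural

variable {f : Prop}

theorem mem_body_or_pole (hv : v ∈ n.clSet) : v ∈ n.body ∨ v ∉ n.region := by
  by_cases h : v ∈ n.region
  · exact .inl ⟨hv, h⟩
  · exact .inr h

theorem Good.disj_L (h : Good G f n) (hv : v ∈ n.L.clSet) : v ∉ n.region := by
  rcases mem_body_or_pole hv with h1 | h1
  · exact h.disj_body v h1
  · exact fun h2 => h1 (h.region_sub h2)

theorem Good.pole_index (h : Good G f n) (hk : n.At k v) (hv : v ∉ n.region) :
    k = 0 ∨ k = n.len := by
  by_contra hc
  push Not at hc
  have := at_le hk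
  exact hv (h.inner k v hk (by omega) (by omega))

theorem disj_of_all (h : n.All (Good G f)) (hv : v ∈ n.region) : v ∉ n.L.clSet ∧ v ∉ n.O.clSet := by
  induction n with
  | root => exact ⟨fun ⟨_, h⟩ => h, fun ⟨_, h⟩ => h⟩
  | mk K X len cl sw L O ihL ihO =>
    have hg := h.1
    have hvL : v ∈ L.region := hg.region_sub hv
    refine ⟨fun h' => hg.disj_L h' hv, fun h' => ?_⟩
    rcases hg.kind with ⟨h1, -⟩ | ⟨h1, -⟩
    · exact (ihL h.2.1 hvL).2 (h1 ▸ h')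
    · exact (ihL h.2.1 hvL).1 (h1 ▸ h')

theorem region_subset_L (h : n.All (Good G f)) : n.region ⊆ n.L.region := by
  cases n with
  | root => exact fun _ h => h
  | mk => exact h.1.region_sub

theorem region_subset_O (h : n.All (Good G f)) : n.region ⊆ n.O.region := by
  induction n with
  | root => exact fun _ h => h
  | mk K X len cl sw L O ihL ihO =>
    have hg := h.1
    rcases hg.kind with ⟨h1, -⟩ | ⟨h1, -⟩
    · have h1 : O = L.O := h1
      exact fun v hv => h1 ▸ ihL h.2.1 (hg.region_sub hv)
    · have h1 : O = L.L := h1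
      exact fun v hv => h1 ▸ region_subset_L h.2.1 (hg.region_sub hv)

end structural

end PlanarOrder

namespace PlanarOrder
open PNode

variable {V : Type} {G : SimpleGraph V} {n m : PNode V} {P Q : PNode V → Prop} {i j k : ℕ}
  {u v w x y z : V} {f : Prop} {K : Set V}

theorem PNode.All.intro (h : P m) (hL : m.L.All P) (hO : m.O.All P) : m.All P := by
  cases m with
  | root => trivial
  | mk => exact ⟨h, hL, hO⟩

theorem mid_eq_image (hL : n.L.All (Good G f)) (hw : w ∈ n.mid) :
    ∃ u v i j, ∃ cl : ℕ → V, n.At 0 u ∧ n.At n.len v ∧ n.L.At i u ∧ n.L.At j v ∧ i + 1 < j ∧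
      (∀ k z, n.L.At k z ↔ k ≤ n.L.len ∧ cl k = z) ∧ n.mid = cl '' Set.Ioo i j := by
  obtain ⟨u, v, i, k, j, hu, hv, hi, hk, hj, hik, hkj⟩ := hw
  have hg := hL.self_of_at hi
  obtain ⟨cl, hcl⟩ := exists_fun hi
  refine ⟨u, v, i, j, cl, hu, hv, hi, hj, by omega, hcl, ?_⟩
  ext z
  constructor
  · rintro ⟨u', v', i', k', j', hu', hv', hi', hk', hj', h1, h2⟩
    obtain rfl := at_fun hu hu'
    obtain rfl := at_fun hv hv'
    obtain rfl := hg.inj _ _ _ hi hi'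
    obtain rfl := hg.inj _ _ _ hj hj'
    exact ⟨k', ⟨h1, h2⟩, ((hcl _ _).1 hk').2⟩
  · rintro ⟨k', ⟨h1, h2⟩, rfl⟩
    have := at_le hj
    exact ⟨u, v, i, k', j, hu, hv, hi, (hcl _ _).2 ⟨by omega, rfl⟩, hj, h1, h2⟩

theorem mid_subset_body (hL : n.L.All (Good G f)) : n.mid ⊆ n.L.body := by
  rintro w ⟨u, v, i, k, j, hu, hv, hi, hk, hj, hik, hkj⟩
  have := at_le hj
  exact ⟨⟨k, hk⟩, (hL.self_of_at hi).inner k w hk (by omega) (by omega)⟩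

theorem mid_not_ends (hL : n.L.All (Good G f)) (hw : w ∈ n.mid) :
    ¬ n.At 0 w ∧ ¬ n.At n.len w := by
  obtain ⟨u, v, i, k, j, hu, hv, hi, hk, hj, hik, hkj⟩ := hw
  have hg := hL.self_of_at hi
  refine ⟨fun h => ?_, fun h => ?_⟩
  · obtain rfl := at_fun hu h
    have := hg.inj _ _ _ hi hk
    omega
  · obtain rfl := at_fun hv h
    have := hg.inj _ _ _ hj hk
    omega

theorem mid_disj_clSet (h : n.All (Good G f)) (hw : w ∈ n.mid) : w ∉ n.clSet := by
  rintro ⟨k, hk⟩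
  have hg := h.self_of_at hk
  have h1 := mid_not_ends h.left hw
  have h2 : w ∉ n.region := hg.disj_body w (mid_subset_body h.left hw)
  rcases hg.pole_index hk h2 with rfl | rfl
  · exact h1.1 hk
  · exact h1.2 hk

theorem mid_linked (hL : n.L.All (Good G f)) : Linked G n.mid := by
  intro x hx
  obtain ⟨u, v, i, j, cl, hu, hv, hi, hj, hij, hcl, hmid⟩ := mid_eq_image hL hx
  have hg := hL.self_of_at hi
  rw [hmid] at hx ⊢
  have := at_le hj
  refine linked_image_interval cl _ Set.ordConnected_Ioo (fun k hk hk' => ?_) x hx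
  exact hg.adj k _ _ ((hcl _ _).2 ⟨by have := hk.2; omega, rfl⟩)
    ((hcl _ _).2 ⟨by have := hk'.2; omega, rfl⟩)

theorem mid_touch_start (hL : n.L.All (Good G f)) (hw : w ∈ n.mid) (hu : n.At 0 u) :
    ∃ z ∈ n.mid, G.Adj u z := by
  obtain ⟨u', v, i, j, cl, hu', hv, hi, hj, hij, hcl, hmid⟩ := mid_eq_image hL hw
  obtain rfl := at_fun hu hu'
  have hg := hL.self_of_at hi
  have := at_le hj
  refine ⟨cl (i + 1), hmid ▸ ⟨i + 1, ⟨by omega, by omega⟩, rfl⟩, ?_⟩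
  exact hg.adj i _ _ hi ((hcl _ _).2 ⟨by omega, rfl⟩)

theorem mid_touch_end (hL : n.L.All (Good G f)) (hw : w ∈ n.mid) (hv : n.At n.len v) :
    ∃ z ∈ n.mid, G.Adj v z := by
  obtain ⟨u', v', i, j, cl, hu', hv', hi, hj, hij, hcl, hmid⟩ := mid_eq_image hL hw
  obtain rfl := at_fun hv hv'
  have hg := hL.self_of_at hi
  have := at_le hj
  refine ⟨cl (j - 1), hmid ▸ ⟨j - 1, ⟨by omega, by omega⟩, rfl⟩, ?_⟩
  refine (hg.adj (j - 1) _ _ ((hcl _ _).2 ⟨by omega, rfl⟩) ?_).symm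
  rwa [Nat.sub_add_cancel (by omega)]

/-- If the middle segment is nonempty, both ends of the path lie outside the region. -/
theorem ends_of_mid (h : n.All (Good G f)) (hw : w ∈ n.mid) :
    ∃ u v, n.At 0 u ∧ n.At n.len v ∧ u ∉ n.region ∧ v ∉ n.region ∧ u ≠ v ∧ 2 ≤ n.len := by
  obtain ⟨u, v, i, j, cl, hu, hv, hi, hj, hij, hcl, hmid⟩ := mid_eq_image h.left hw
  have hg := h.self_of_at hu
  have h1 := hg.disj_L ⟨i, hi⟩
  have h2 := hg.disj_L ⟨j, hj⟩
  have h3 := (hg.start u v hu hv h2).2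
  refine ⟨u, v, hu, hv, h1, h2, h3, ?_⟩
  obtain ⟨b, ⟨k, hk⟩, hb⟩ := hg.nonempty
  have := at_le hk
  by_contra hlt
  have : k = 0 ∨ k = n.len := by omega
  rcases this with rfl | rfl
  · exact h1 (at_fun hk hu ▸ hb)
  · exact h2 (at_fun hk hv ▸ hb)

theorem body_linked (h : n.All (Good G f)) (hu : n.At 0 u) (hv : n.At n.len v)
    (hu' : u ∉ n.region) (hv' : v ∉ n.region) : Linked G n.body := by
  have hg := h.self_of_at hu
  obtain ⟨cl, hcl⟩ := exists_fun hu
  have : n.body = cl '' Set.Ioo 0 n.len := by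
    ext z
    constructor
    · rintro ⟨⟨k, hk⟩, hz⟩
      have h1 := at_le hk
      refine ⟨k, ⟨Nat.pos_of_ne_zero ?_, lt_of_le_of_ne h1 ?_⟩, ((hcl _ _).1 hk).2⟩
      · rintro rfl
        exact hu' (at_fun hk hu ▸ hz)
      · rintro rfl
        exact hv' (at_fun hk hv ▸ hz)
    · rintro ⟨k, ⟨h1, h2⟩, rfl⟩
      have h3 : n.At k (cl k) := (hcl _ _).2 ⟨h2.le, rfl⟩
      exact ⟨⟨k, h3⟩, hg.inner k _ h3 h1 h2⟩
  rw [this]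
  refine linked_image_interval cl _ Set.ordConnected_Ioo (fun k hk hk' => ?_)
  exact hg.adj k _ _ ((hcl _ _).2 ⟨hk.2.le, rfl⟩) ((hcl _ _).2 ⟨hk'.2.le, rfl⟩)

/-- A connected part of the region off the path meets at most one side of the outer boundary. -/
theorem not_mid_and_X (hG : NoK33 G) (hn : n.All (Good G f)) (hK : Linked G K)
    (hsub : ∀ v ∈ K, v ∈ n.region ∧ v ∉ n.body) (hbody : Touch G K n.body)
    (hmid : Touch G K n.mid) (hX : Touch G K n.X) : False := by
  obtain ⟨k₁, hk₁, a, ha, hka⟩ := hmid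
  obtain ⟨k₂, hk₂, c, hc, hkc⟩ := hX
  obtain ⟨u, v, hu, hv, hu', hv', huv, hlen⟩ := ends_of_mid hn ha
  have hg := hn.self_of_at hu
  obtain ⟨Z, hZ, hXZ, hZd, hZu, hZv⟩ := hg.cross ⟨c, hc⟩
  obtain ⟨cl, hcl⟩ := exists_fun hu
  have hKr : ∀ v ∉ n.region, v ∉ K := fun v hv h => hv (hsub v h).1
  have h1 : n.At 1 (cl 1) := (hcl _ _).2 ⟨by omega, rfl⟩
  have h2 : n.At (n.len - 1) (cl (n.len - 1)) := (hcl _ _).2 ⟨by omega, rfl⟩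
  have b1 : cl 1 ∈ n.body := ⟨⟨1, h1⟩, hg.inner _ _ h1 (by omega) (by omega)⟩
  have b2 : cl (n.len - 1) ∈ n.body := ⟨⟨_, h2⟩, hg.inner _ _ h2 (by omega) (by omega)⟩
  have hmr : ∀ z ∈ n.mid, z ∉ n.region := fun z hz =>
    hg.disj_body z (mid_subset_body hn.left hz)
  have hum : u ∉ n.mid := fun h => (mid_not_ends hn.left h).1 hu
  have hvm : v ∉ n.mid := fun h => (mid_not_ends hn.left h).2 hv
  refine hG.elim (linked_singleton u) (linked_singleton v) hK hZ (mid_linked hn.left)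
    (body_linked hn hu hv hu' hv') ?_ ?_ ?_ ?_ ?_ ?_ ?_ ?_ ?_ ?_ ?_ ?_ ?_ ?_ ?_ ?_ ?_ ?_ ?_ ?_ ?_
    ?_ ?_ ?_
  · simpa using huv
  · simpa using hKr u hu'
  · simpa using hKr v hv'
  · exact Set.disjoint_left.2 fun z hz => (hZd z hz).2.1
  · exact Set.disjoint_left.2 fun z hz h => (hZd z hz).1 h.2
  · exact Set.disjoint_left.2 fun z hz h => hmr z hz h.2
  · simpa using fun h => (hZd u h).2.2.1 hu
  · simpa using hum
  · simpa using fun h : u ∈ n.body => hu' h.2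
  · simpa using fun h => (hZd v h).2.2.2 hv
  · simpa using hvm
  · simpa using fun h : v ∈ n.body => hv' h.2
  · exact Set.disjoint_left.2 fun z hz h => (hZd z h).1 (hsub z hz).1
  · exact Set.disjoint_left.2 fun z hz h => hmr z h (hsub z hz).1
  · exact Set.disjoint_left.2 fun z hz h => (hsub z hz).2 h
  · exact ⟨u, rfl, hZu u hu⟩
  · exact ⟨u, rfl, mid_touch_start hn.left ha hu⟩
  · exact ⟨u, rfl, _, b1, hg.adj 0 _ _ hu h1⟩
  · exact ⟨v, rfl, hZv v hv⟩
  · exact ⟨v, rfl, mid_touch_end hn.left ha hv⟩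
  · refine ⟨v, rfl, _, b2, (hg.adj _ _ _ h2 ?_).symm⟩
    rwa [Nat.sub_add_cancel (by omega)]
  · exact ⟨k₂, hk₂, c, hXZ hc, hkc⟩
  · exact ⟨k₁, hk₁, a, ha, hka⟩
  · exact hbody

/-- The middle segment of a node whose region is adjacent to it does not meet both sides of the
outer boundary of the node carrying the segment. -/
theorem mid_oneSided (hG : NoK33 G) (hn : n.All (Good G f)) (hr : Touch G n.mid n.region)
    (hmid : Touch G n.mid n.L.mid) (hX : Touch G n.mid n.L.X) : False := by
  obtain ⟨a, ha, r, hr, har⟩ := hr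
  obtain ⟨s₁, hs₁, t₁, ht₁, hst₁⟩ := hmid
  obtain ⟨s₂, hs₂, t₂, ht₂, hst₂⟩ := hX
  obtain ⟨u, v, hu, hv, hu', hv', huv, hlen⟩ := ends_of_mid hn ha
  obtain ⟨p, q, i, j, cl, hp, hq, hi, hj, hij, hcl, hmid⟩ := mid_eq_image hn.left ha
  obtain rfl := at_fun hu hp
  obtain rfl := at_fun hv hq
  have hjl := at_le hj
  have hA := hn.left
  set A := n.L with hAdef
  have hg := hn.self_of_at hu
  have hgA := hA.self_of_at hi
  obtain ⟨Z, hZ, hXZ, hZd, hZu, hZv⟩ := hgA.cross ⟨t₂, ht₂⟩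
  have hat : ∀ k ≤ A.len, A.At k (cl k) := fun k hk => (hcl _ _).2 ⟨hk, rfl⟩
  have inj : ∀ k ≤ A.len, ∀ l ≤ A.len, cl k = cl l → k = l := fun k hk l hl h =>
    hgA.inj k l _ (hat k hk) (h ▸ hat l hl)
  have hadj : ∀ k, k + 1 ≤ A.len → G.Adj (cl k) (cl (k + 1)) := fun k hk =>
    hgA.adj k _ _ (hat k (by omega)) (hat _ hk)
  have clmem : ∀ k ≤ A.len, cl k ∈ A.clSet := fun k hk => ⟨k, hat k hk⟩
  have dmid : ∀ k ≤ A.len, cl k ∉ A.mid := fun k hk h => mid_disj_clSet hA h (clmem k hk)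
  have dZ : ∀ k ≤ A.len, cl k ∉ Z := by
    intro k hk h
    have h1 := hZd _ h
    rcases hgA.pole_index (hat k hk) h1.1 with rfl | rfl
    · exact h1.2.2.1 (hat _ hk)
    · exact h1.2.2.2 (hat _ hk)
  have dr : ∀ k ≤ A.len, cl k ∉ n.region := fun k hk => hg.disj_L (clmem k hk)
  have hci : cl i = u := ((hcl _ _).1 hi).2
  have hcj : cl j = v := ((hcl _ _).1 hj).2
  obtain ⟨dl, hdl⟩ := exists_fun hu
  have h1 : n.At 1 (dl 1) := (hdl _ _).2 ⟨by omega, rfl⟩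
  have h2 : n.At (n.len - 1) (dl (n.len - 1)) := (hdl _ _).2 ⟨by omega, rfl⟩
  have b1 : dl 1 ∈ n.region := hg.inner _ _ h1 (by omega) (by omega)
  have b2 : dl (n.len - 1) ∈ n.region := hg.inner _ _ h2 (by omega) (by omega)
  have img : ∀ I J : Set ℕ, (∀ k ∈ I, k ≤ A.len) → (∀ k ∈ J, k ≤ A.len) →
      (∀ k ∈ I, k ∉ J) → Disjoint (cl '' I) (cl '' J) := by
    intro I J hI hJ hIJ
    rw [Set.disjoint_left]
    rintro _ ⟨k, hk, rfl⟩ ⟨l, hl, h⟩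
    exact hIJ k hk (inj l (hJ l hl) k (hI k hk) h ▸ hl)
  have dis : ∀ (I : Set ℕ) (T : Set V), (∀ k ∈ I, k ≤ A.len) → (∀ k ≤ A.len, cl k ∉ T) →
      Disjoint (cl '' I) T := by
    intro I T hI hT
    rw [Set.disjoint_left]
    rintro _ ⟨k, hk, rfl⟩
    exact hT k (hI k hk)
  have lk : ∀ I : Set ℕ, I.OrdConnected → (∀ k ∈ I, k ≤ A.len) → Linked G (cl '' I) :=
    fun I hI hI' => linked_image_interval cl I hI fun k _ hk => hadj k (hI' _ hk)
  have l1 : ∀ k ∈ Set.Icc 0 i, k ≤ A.len := fun k hk => by have := hk.2; omega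
  have l2 : ∀ k ∈ Set.Icc j A.len, k ≤ A.len := fun k hk => hk.2
  have l3 : ∀ k ∈ Set.Ioo i j, k ≤ A.len := fun k hk => by have := hk.2; omega
  have rn : Linked G n.region := hg.linked
  refine hG.elim (lk (Set.Icc 0 i) Set.ordConnected_Icc l1)
    (lk (Set.Icc j A.len) Set.ordConnected_Icc l2) (lk (Set.Ioo i j) Set.ordConnected_Ioo l3)
    (mid_linked hA.left) hZ rn (img _ _ l1 l2 ?_) (img _ _ l1 l3 ?_) (img _ _ l2 l3 ?_)
    ?_ ?_ ?_ (dis _ _ l1 dmid) (dis _ _ l1 dZ) (dis _ _ l1 dr) (dis _ _ l2 dmid) (dis _ _ l2 dZ)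
    (dis _ _ l2 dr) (dis _ _ l3 dmid) (dis _ _ l3 dZ) (dis _ _ l3 dr) ?_ ?_ ?_ ?_ ?_ ?_ ?_ ?_ ?_
  · intro k h1 h2
    have := h1.2
    have := h2.1
    omega
  · intro k h1 h2
    have := h1.2
    have := h2.1
    omega
  · intro k h1 h2
    have := h1.1
    have := h2.2
    omega
  · exact Set.disjoint_left.2 fun z hz h => (hZd z h).2.1 hz
  · exact Set.disjoint_left.2 fun z hz h =>
      hgA.disj_L (mid_subset_body hA.left hz).1 (hg.region_sub h)
  · exact Set.disjoint_left.2 fun z hz h => (hZd z hz).1 (hg.region_sub h)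
  · exact ⟨cl 0, ⟨0, ⟨le_rfl, by omega⟩, rfl⟩, mid_touch_start hA.left ht₁ (hat 0 (by omega))⟩
  · exact ⟨cl 0, ⟨0, ⟨le_rfl, by omega⟩, rfl⟩, hZu _ (hat 0 (by omega))⟩
  · exact ⟨cl i, ⟨i, ⟨by omega, le_rfl⟩, rfl⟩, dl 1, b1, hci ▸ hg.adj 0 _ _ hu h1⟩
  · exact ⟨cl A.len, ⟨_, ⟨hjl, le_rfl⟩, rfl⟩, mid_touch_end hA.left ht₁ (hat _ le_rfl)⟩
  · exact ⟨cl A.len, ⟨_, ⟨hjl, le_rfl⟩, rfl⟩, hZv _ (hat _ le_rfl)⟩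
  · refine ⟨cl j, ⟨j, ⟨le_rfl, hjl⟩, rfl⟩, _, b2, hcj ▸ (hg.adj _ _ _ h2 ?_).symm⟩
    rwa [Nat.sub_add_cancel (by omega)]
  · exact ⟨s₁, hmid ▸ hs₁, t₁, ht₁, hst₁⟩
  · exact ⟨s₂, hmid ▸ hs₂, t₂, hXZ ht₂, hst₂⟩
  · exact ⟨a, hmid ▸ ha, r, hr, har⟩

/-- The outer boundary of a connected part of the region off the path. -/
theorem exists_outer (hG : NoK33 G) (hn : n.All (Good G f)) (hv : v ∈ n.clSet) (hK : Linked G K)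
    (hsub : ∀ v ∈ K, v ∈ n.region ∧ v ∉ n.body) (hbody : Touch G K n.body) :
    ∃ X' O', ((O' = n.O ∧ X' ⊆ n.X) ∨ (O' = n.L ∧ X' ⊆ n.mid)) ∧ X' ⊆ O'.body ∧
      ((∀ x ∈ X', ∀ z ∈ O'.mid, ¬ G.Adj x z) ∨ (∀ x ∈ X', ∀ z ∈ O'.X, ¬ G.Adj x z)) ∧
      (∀ x ∈ X', ∃ w ∈ K, G.Adj w x) ∧
      (∀ w ∈ K, ∀ z ∉ n.region, G.Adj w z → z ∈ n.clSet ∨ z ∈ X') ∧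
      (X'.Nonempty → ∃ W, Linked G W ∧ X' ⊆ W ∧ (∀ v ∈ W, v ∉ n.region ∧ v ∉ n.clSet) ∧
        (∀ v, n.At 0 v → ∃ z ∈ W, G.Adj v z) ∧ (∀ v, n.At n.len v → ∃ z ∈ W, G.Adj v z)) := by
  have hg := hn.self_of_mem hv
  by_cases hmid : Touch G K n.mid
  · refine ⟨{x | x ∈ n.mid ∧ ∃ w ∈ K, G.Adj w x}, n.L, .inr ⟨rfl, fun _ h => h.1⟩,
      fun _ h => mid_subset_body hn.left h.1, ?_, fun _ h => h.2, ?_, ?_⟩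
    · by_contra hc
      push Not at hc
      obtain ⟨⟨x₁, hx₁, z₁, hz₁, h₁⟩, ⟨x₂, hx₂, z₂, hz₂, h₂⟩⟩ := hc
      obtain ⟨w, hw, hwx⟩ := hx₁.2
      exact mid_oneSided hG hn ⟨x₁, hx₁.1, w, (hsub w hw).1, hwx.symm⟩
        ⟨x₁, hx₁.1, z₁, hz₁, h₁⟩ ⟨x₂, hx₂.1, z₂, hz₂, h₂⟩
    · intro w hw z hz hwz
      rcases hg.bdry w z (hsub w hw).1 hz hwz with h | h | h | h
      · exact .inl ⟨_, h⟩
      · exact .inl ⟨_, h⟩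
      · exact .inr ⟨h, w, hw, hwz⟩
      · exact (not_mid_and_X hG hn hK hsub hbody hmid ⟨w, hw, z, h, hwz⟩).elim
    · rintro ⟨x, hx, -⟩
      exact ⟨n.mid, mid_linked hn.left, fun _ h => h.1,
        fun z hz => ⟨hg.disj_body z (mid_subset_body hn.left hz), mid_disj_clSet hn hz⟩,
        fun _ => mid_touch_start hn.left hx, fun _ => mid_touch_end hn.left hx⟩
  · refine ⟨{x | x ∈ n.X ∧ ∃ w ∈ K, G.Adj w x}, n.O, .inl ⟨rfl, fun _ h => h.1⟩,
      fun _ h => hg.X_sub h.1, ?_, fun _ h => h.2, ?_, ?_⟩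
    · rcases hg.oneSided with h | h
      · exact .inl fun x hx => h x hx.1
      · exact .inr fun x hx => h x hx.1
    · intro w hw z hz hwz
      rcases hg.bdry w z (hsub w hw).1 hz hwz with h | h | h | h
      · exact .inl ⟨_, h⟩
      · exact .inl ⟨_, h⟩
      · exact (hmid ⟨w, hw, z, h, hwz⟩).elim
      · exact .inr ⟨h, w, hw, hwz⟩
    · rintro ⟨x, hx, -⟩
      obtain ⟨Z, hZ, hXZ, hZd, hZu, hZv⟩ := hg.cross ⟨x, hx⟩
      refine ⟨Z, hZ, fun _ h => hXZ h.1, fun z hz => ⟨(hZd z hz).1, ?_⟩, hZu, hZv⟩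
      rintro ⟨k, hk⟩
      rcases hg.pole_index hk (hZd z hz).1 with rfl | rfl
      · exact (hZd z hz).2.2.1 hk
      · exact (hZd z hz).2.2.2 hk

end PlanarOrder

namespace PlanarOrder
open PNode

variable {V : Type} {G : SimpleGraph V} {n m : PNode V} {P Q : PNode V → Prop} {i j k : ℕ}
  {u v w x y z : V} {f : Prop} {K : Set V}

theorem exists_crossing (cl : ℕ → V) {len : ℕ} (hadj : ∀ k < len, G.Adj (cl k) (cl (k + 1)))
    (inj : ∀ k ≤ len, ∀ l ≤ len, cl k = cl l → k = l) {W : Set V} (hW : Linked G W)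
    (hWcl : ∀ k ≤ len, cl k ∉ W) (h0 : ∃ z ∈ W, G.Adj (cl 0) z)
    (h1 : ∃ z ∈ W, G.Adj (cl len) z) (hij : i ≤ j) (hj : j ≤ len) :
    ∃ Z, Linked G Z ∧ W ⊆ Z ∧ (∀ v ∈ Z, v ∈ W ∨ ∃ k ≤ len, v = cl k) ∧
      (∀ k, i ≤ k → k ≤ j → cl k ∉ Z) ∧ (∃ z ∈ Z, G.Adj (cl i) z) ∧
      ∃ z ∈ Z, G.Adj (cl j) z := by
  obtain ⟨z₀, hz₀, a₀⟩ := h0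
  obtain ⟨z₁, hz₁, a₁⟩ := h1
  have hlow : Linked G (W ∪ cl '' Set.Iio i) := by
    rcases Nat.eq_zero_or_pos i with h | h
    · subst h
      simpa using hW
    · refine hW.union (linked_image_interval cl _ Set.ordConnected_Iio fun k hk _ => ?_) hz₀
        ⟨0, h, rfl⟩ a₀.symm
      exact hadj k (by have := Set.mem_Iio.1 hk; omega)
  have hall : Linked G ((W ∪ cl '' Set.Iio i) ∪ cl '' Set.Ioc j len) := by
    rcases hj.eq_or_lt with h | h
    · subst h
      simpa using hlow
    · refine hlow.union (linked_image_interval cl _ Set.ordConnected_Ioc fun k _ hk => ?_)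
        (.inl hz₁) ⟨len, ⟨h, le_rfl⟩, rfl⟩ a₁.symm
      exact hadj k (by have := hk.2; omega)
  refine ⟨_, hall, fun z hz => .inl (.inl hz), ?_, ?_, ?_, ?_⟩
  · rintro v ((h | ⟨k, hk, rfl⟩) | ⟨k, hk, rfl⟩)
    · exact .inl h
    · exact .inr ⟨k, by have := Set.mem_Iio.1 hk; omega, rfl⟩
    · exact .inr ⟨k, hk.2, rfl⟩
  · rintro k hk hk' ((h | ⟨l, hl, h⟩) | ⟨l, hl, h⟩)
    · exact hWcl k (by omega) h
    · have h1 := Set.mem_Iio.1 hl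
      have := inj l (by omega) k (by omega) h
      omega
    · have := inj l hl.2 k (by omega) h
      have := hl.1
      omega
  · rcases Nat.eq_zero_or_pos i with h | h
    · subst h
      exact ⟨z₀, .inl (.inl hz₀), a₀⟩
    · refine ⟨cl (i - 1), .inl (.inr ⟨i - 1, Nat.sub_lt h one_pos, rfl⟩), ?_⟩
      have := hadj (i - 1) (by omega)
      rw [Nat.sub_add_cancel h] at this
      exact this.symm
  · rcases hj.eq_or_lt with h | h
    · subst h
      exact ⟨z₁, .inl (.inl hz₁), a₁⟩
    · exact ⟨cl (j + 1), .inr ⟨j + 1, ⟨by omega, by omega⟩, rfl⟩, hadj j h⟩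

theorem exists_child_root (hK : Linked G K) (hne : K.Nonempty)
    (hcl : ∀ w ∈ K, ∀ z, G.Adj w z → z ∈ K) :
    ∃ m : PNode V, m.region = K ∧ m.L = root ∧ Good G f m := by
  obtain ⟨c, hc⟩ := hne
  have h0 : ∀ k v, (PNode.mk K ∅ 0 (fun _ => c) False root root).At k v ↔ k = 0 ∧ c = v := by
    intro k v
    simp [At]
  refine ⟨.mk K ∅ 0 (fun _ => c) False root root, rfl, rfl, ?_⟩
  constructor
  · exact hK
  · exact ⟨c, ⟨0, (h0 _ _).2 ⟨rfl, rfl⟩⟩, hc⟩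
  · intro i j v hi hj
    rw [h0] at hi hj
    omega
  · intro k v w _ hw
    rw [h0] at hw
    omega
  · intro k v hk h1
    rw [h0] at hk
    omega
  · intro k v hk hv
    rw [h0] at hk
    exact absurd (hk.2 ▸ hc) hv
  · intro u v _ hv hv'
    rw [h0] at hv
    exact absurd (hv.2 ▸ hc) hv'
  · intro i j p q y a b _ _ hj
    rw [h0] at hj
    omega
  · intro w z hw hz hwz
    exact absurd (hcl w hw z hwz) hz
  · exact fun _ h => h.elim
  · exact fun _ _ => trivial
  · rintro v ⟨⟨k, hk⟩, -⟩
    exact hk.elim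
  · exact fun _ h => h.elim
  · exact .inl ⟨rfl, fun _ h => h.elim⟩
  · rintro ⟨x, hx⟩
    exact hx.elim
  · exact .inl fun _ h => h.elim
  · refine ⟨fun h => h.elim, ?_⟩
    rintro ⟨-, ⟨k, v, hk, -⟩, -⟩
    exact absurd hk (by simp [len])

theorem touch_body (hn : Good G f n) (hne : K.Nonempty)
    (hsub : ∀ v ∈ K, v ∈ n.region ∧ v ∉ n.body)
    (hclosed : ∀ w ∈ K, ∀ z ∈ n.region, G.Adj w z → z ∈ K ∨ z ∈ n.body) : Touch G K n.body := by
  obtain ⟨c, hc⟩ := hne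
  obtain ⟨b, hb⟩ := hn.nonempty
  obtain ⟨a, ha⟩ := hn.linked c (hsub c hc).1 b hb.2
  by_contra hno
  have : ∀ y a, Trek G n.region c y a → y ∈ K := by
    intro y a h
    induction h with
    | refl => exact hc
    | step _ hadj hz ih =>
      rcases hclosed _ ih _ hz hadj with h | h
      · exact h
      · exact absurd ⟨_, ih, _, h, hadj⟩ hno
  exact (hsub b (this b a ha)).2 hb

theorem exists_child (hG : NoK33 G) (hn : n.All (Good G f)) (hK : Linked G K) (hne : K.Nonempty)
    (hsub : ∀ v ∈ K, v ∈ n.region ∧ v ∉ n.body)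
    (hclosed : ∀ w ∈ K, ∀ z ∈ n.region, G.Adj w z → z ∈ K ∨ z ∈ n.body) :
    ∃ m : PNode V, m.region = K ∧ m.L = n ∧ Good G f m := by
  classical
  rcases Classical.em (n = root) with rfl | hroot
  · refine exists_child_root hK hne fun w hw z hwz => ?_
    rcases hclosed w hw z trivial hwz with h | ⟨⟨k, hk⟩, -⟩
    · exact h
    · exact hk.elim
  have hg : Good G f n := by
    cases n with
    | root => exact absurd rfl hroot
    | mk => exact hn.1
  have htb := touch_body hg hne hsub hclosed
  obtain ⟨w₀, hw₀, b₀, ⟨⟨k₀, hk₀⟩, hb₀⟩, hwb₀⟩ := id htb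
  obtain ⟨cl, hcl⟩ := exists_fun hk₀
  obtain ⟨X', O', hkind, hXbody, honeS, hXK, hout, hW⟩ :=
    exists_outer hG hn ⟨k₀, hk₀⟩ hK hsub htb
  have hat : ∀ k ≤ n.len, n.At k (cl k) := fun k hk => (hcl _ _).2 ⟨hk, rfl⟩
  have cinj : ∀ k ≤ n.len, ∀ l ≤ n.len, cl k = cl l → k = l := fun k hk l hl h =>
    hg.inj k l _ (hat k hk) (h ▸ hat l hl)
  have cadj : ∀ k < n.len, G.Adj (cl k) (cl (k + 1)) := fun k hk =>
    hg.adj k _ _ (hat k hk.le) (hat _ hk)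
  have clK : ∀ k ≤ n.len, cl k ∉ K := fun k hk h => (hsub _ h).2 ⟨⟨k, hat k hk⟩, (hsub _ h).1⟩
  let I : Finset ℕ := (Finset.range (n.len + 1)).filter fun k => ∃ w ∈ K, G.Adj w (cl k)
  have hI : ∀ k, k ∈ I ↔ k ≤ n.len ∧ ∃ w ∈ K, G.Adj w (cl k) := by
    intro k
    simp [I]
  have hIne : I.Nonempty := ⟨k₀, (hI _).2 ⟨at_le hk₀, w₀, hw₀, by
    rw [((hcl _ _).1 hk₀).2]; exact hwb₀⟩⟩
  obtain ⟨i, hi, hmin⟩ := I.exists_min_image id hIne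
  obtain ⟨j, hj, hmax⟩ := I.exists_max_image id hIne
  have hij : i ≤ j := hmin j hj
  obtain ⟨hil, wi, hwi, hadji⟩ := (hI i).1 hi
  obtain ⟨hjl, wj, hwj, hadjj⟩ := (hI j).1 hj
  have hnb : ∀ w ∈ K, ∀ z ∉ K, G.Adj w z → (∃ k, i ≤ k ∧ k ≤ j ∧ z = cl k) ∨ z ∈ X' := by
    intro w hw z hz hwz
    have key : z ∈ n.clSet → ∃ k, i ≤ k ∧ k ≤ j ∧ z = cl k := by
      rintro ⟨k, hk⟩
      have h1 := (hcl _ _).1 hk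
      have h2 : k ∈ I := (hI k).2 ⟨h1.1, w, hw, h1.2 ▸ hwz⟩
      exact ⟨k, hmin k h2, hmax k h2, h1.2.symm⟩
    by_cases hzr : z ∈ n.region
    · rcases hclosed w hw z hzr hwz with h | h
      · exact absurd h hz
      · exact .inl (key h.1)
    · rcases hout w hw z hzr hwz with h | h
      · exact .inl (key h)
      · exact .inr h
  obtain ⟨t, ht⟩ : ∃ t, (t = cl j ∧ i < j) ∨
      (t ∈ K ∧ i = j ∧ (X'.Nonempty → ∃ x ∈ X', G.Adj t x)) := by
    rcases hij.eq_or_lt with h | h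
    · by_cases hX : X'.Nonempty
      · obtain ⟨x, hx⟩ := hX
        obtain ⟨w, hw, hwx⟩ := hXK x hx
        exact ⟨w, .inr ⟨hw, h, fun _ => ⟨x, hx, hwx⟩⟩⟩
      · exact ⟨w₀, .inr ⟨hw₀, h, fun h => absurd h hX⟩⟩
    · exact ⟨cl j, .inl ⟨rfl, h⟩⟩
  have htne : t ≠ cl i := by
    rcases ht with ⟨rfl, h⟩ | ⟨h, -⟩
    · intro h'
      have := cinj _ hjl _ hil h'
      omega
    · rintro rfl
      exact clK i hil h
  obtain ⟨len, c, c0, ct, hlen, cK, cadj', cinj', ciso, c2⟩ := exists_isometric_path (t := t) hK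
    (clK i hil) ⟨wi, hwi, hadji.symm⟩ htne (by
      rcases ht with ⟨rfl, h⟩ | ⟨h, -⟩
      · exact .inr ⟨wj, hwj, hadjj.symm⟩
      · exact .inl h)
  have htK : t ∉ K → t = cl j ∧ i < j := by
    intro h
    rcases ht with h' | ⟨h', -⟩
    · exact h'
    · exact absurd h' h
  have htn : t ∈ n.clSet → t = cl j ∧ i < j := by
    rintro ⟨k, hk⟩
    exact htK fun h => (hsub _ h).2 ⟨⟨k, hk⟩, (hsub _ h).1⟩
  refine ⟨.mk K X' len c (f ∧ (∃ k v, k + 1 = len ∧ (k ≤ len ∧ c k = v) ∧ ∃ x ∈ X', G.Adj v x) ∧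
    ∃ v, (len ≤ len ∧ c len = v) ∧ v ∉ K) n O', rfl, rfl, ?_⟩
  set m : PNode V := .mk K X' len c (f ∧ (∃ k v, k + 1 = len ∧ (k ≤ len ∧ c k = v) ∧
    ∃ x ∈ X', G.Adj v x) ∧ ∃ v, (len ≤ len ∧ c len = v) ∧ v ∉ K) n O' with hm
  have mlen : m.len = len := rfl
  have mAt : ∀ k v, m.At k v ↔ k ≤ len ∧ c k = v := fun _ _ => Iff.rfl
  have mL : m.L = n := rfl
  have at0 : ∀ v, m.At 0 v ↔ v = cl i := by
    intro v
    rw [mAt, c0]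
    simp [eq_comm]
  have atl : ∀ v, m.At m.len v ↔ v = t := by
    intro v
    rw [mAt, mlen, ct]
    simp [eq_comm]
  have mmid : ∀ w ∈ m.mid, ∃ k, i < k ∧ k < j ∧ w = cl k := by
    rintro w ⟨u, v, i', k, j', hu, hv, hi', hk, hj', h1, h2⟩
    rw [at0] at hu
    rw [atl] at hv
    rw [mL] at hi' hk hj'
    subst hu hv
    obtain ⟨h3, h4⟩ := htn ⟨j', hj'⟩
    have e1 := hg.inj _ _ _ hi' (hat i hil)
    have e2 := hg.inj _ _ _ hj' (h3 ▸ hat j hjl)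
    exact ⟨k, by omega, by omega, ((hcl _ _).1 hk).2.symm⟩
  constructor
  · exact hK
  · by_cases h : t ∈ K
    · exact ⟨t, ⟨len, le_rfl, ct⟩, h⟩
    · have := c2 h
      exact ⟨c 1, ⟨1, by omega, rfl⟩, cK 1 one_pos (by omega)⟩
  · rintro i j v ⟨hi, rfl⟩ ⟨hj, h⟩
    exact cinj' i hi j hj h.symm
  · rintro k v w ⟨hk, rfl⟩ ⟨hk', rfl⟩
    exact cadj' k hk'
  · rintro k v ⟨hk, rfl⟩ h1 h2
    exact cK k h1 h2
  · rintro k v ⟨hk, rfl⟩ hv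
    have h1 : k = 0 ∨ k = len := by
      by_contra h
      exact hv (cK k (by omega) (by omega))
    rcases h1 with rfl | rfl
    · rw [c0]
      exact ⟨i, hat i hil⟩
    · rw [ct] at hv ⊢
      rw [(htK hv).1]
      exact ⟨j, hat j hjl⟩
  · intro u v hu hv hvK
    rw [at0] at hu
    rw [atl] at hv
    subst hu hv
    exact ⟨clK i hil, htne.symm⟩
  · rintro i j p q y a b hy ⟨hi, rfl⟩ ⟨hj, rfl⟩ h1 h2
    exact ciso i hi j hj y hy a b h1 h2
  · intro w z hw hz hwz
    rcases hnb w hw z hz hwz with ⟨k, h1, h2, rfl⟩ | h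
    · rcases h1.eq_or_lt with rfl | h1
      · exact .inl ((at0 _).2 rfl)
      · have hlt : t = cl j ∧ i < j := by
          rcases ht with h | ⟨-, h, -⟩
          · exact h
          · omega
        rcases h2.eq_or_lt with rfl | h2
        · exact .inr (.inl ((atl _).2 hlt.1.symm))
        · refine .inr (.inr (.inl ⟨cl i, cl j, i, k, j, (at0 _).2 rfl, (atl _).2 hlt.1.symm,
            hat i hil, hat k (by omega), hat j hjl, h1, h2⟩))
    · exact .inr (.inr (.inr h))
  · exact hXbody
  · exact fun v hv => (hsub v hv).1
  · exact fun v hv h => (hsub v h).2 hv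
  · intro v hv
    obtain ⟨W, -, h1, h2, -⟩ := hW ⟨v, hv⟩
    exact (h2 v (h1 hv)).2
  · exact hkind
  · intro hX
    obtain ⟨W, hWl, hXW, hWd, hW0, hW1⟩ := hW hX
    obtain ⟨Z, hZ, hWZ, hZd, hZc, hZ0, hZ1⟩ := exists_crossing cl cadj cinj hWl
      (fun k hk h => (hWd _ h).2 ⟨k, hat k hk⟩) (hW0 _ (hat 0 (Nat.zero_le _)))
      (hW1 _ (hat _ le_rfl)) hij hjl
    have hZK : ∀ v ∈ Z, v ∉ K := by
      intro v hv h
      rcases hZd v hv with h' | ⟨k, hk, rfl⟩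
      · exact (hWd v h').1 (hsub v h).1
      · exact clK k hk h
    refine ⟨Z, hZ, fun x hx => hWZ (hXW hx), fun v hv => ⟨hZK v hv, ?_, ?_, ?_⟩, ?_, ?_⟩
    · intro h
      obtain ⟨k, h1, h2, rfl⟩ := mmid v h
      exact hZc k h1.le h2.le hv
    · rw [at0]
      rintro rfl
      exact hZc i le_rfl hij hv
    · rw [atl]
      rintro rfl
      have := (htK (hZK _ hv)).1
      exact hZc j hij le_rfl (this ▸ hv)
    · intro v hv
      rw [at0] at hv
      subst hv
      exact hZ0
    · intro v hv
      rw [atl] at hv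
      subst hv
      rcases ht with ⟨rfl, -⟩ | ⟨-, -, h⟩
      · exact hZ1
      · obtain ⟨x, hx, hvx⟩ := h hX
        exact ⟨x, hWZ (hXW hx), hvx⟩
  · exact honeS
  · exact Iff.rfl

end PlanarOrder

namespace PlanarOrder
open PNode

variable {V : Type} {G : SimpleGraph V} {n m : PNode V} {i j k : ℕ}
  {u v w x y z : V} {f : Prop} {U U' : Set V} {r r' : V → ℕ}

/-- The connected component of `v` in the subgraph induced by `U`. -/
def comp (G : SimpleGraph V) (U : Set V) (v : V) : Set V := {w | ∃ a, Trek G U v w a}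

theorem comp_subset (hv : v ∈ U) : comp G U v ⊆ U := fun _ ⟨_, h⟩ => h.mem_of_mem hv

theorem mem_comp_self : v ∈ comp G U v := ⟨0, .refl⟩

theorem comp_step (h : w ∈ comp G U v) (hwz : G.Adj w z) (hz : z ∈ U) : z ∈ comp G U v := by
  obtain ⟨a, ha⟩ := h
  exact ⟨_, ha.step hwz hz⟩

theorem comp_linked : Linked G (comp G U v) := by
  refine linked_of_hub v mem_comp_self ?_
  rintro x ⟨a, ha⟩
  refine ⟨a, ?_⟩
  induction ha with
  | refl => exact .refl
  | step h hadj hz ih => exact .step ih hadj (comp_step ⟨_, h⟩ hadj hz)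

theorem CleanAt.mono (hU : U' ⊆ U) (h : CleanAt G U n) : CleanAt G U' n :=
  ⟨fun v hv h' => h.1 v hv (hU h'), fun w z hw hz hwz h' => h.2 w z hw hz hwz (hU h')⟩

theorem OrdAt.change (h : OrdAt G r n) (hc : CleanAt G U n) (heq : ∀ v ∉ U, r' v = r v)
    (hle : ∀ v, r v ≤ r' v) : OrdAt G r' n where
  bdry_lt z w w' hz hw hw' hwz := by
    have := h.bdry_lt z w w' hz hw hw' hwz
    have := heq z (hc.2 w z hw hz hwz)
    have := hle w'
    omega
  body_lt v w hv hw hw' := by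
    have := h.body_lt v w hv hw hw'
    have := heq v (hc.1 v hv)
    have := hle w
    omega
  rk_lt i j v w hi hj hv hw hr := by
    have := h.rk_lt i j v w hi hj hv hw hr
    have := heq v (hc.1 v ⟨⟨i, hi⟩, hv⟩)
    have := heq w (hc.1 w ⟨⟨j, hj⟩, hw⟩)
    omega

theorem rk_le (hk : k ≤ n.len) : n.rk k ≤ n.len := by
  unfold rk
  split_ifs with h1 h2 <;> omega

/-- The invariant of the construction: `U` is the set of vertices not yet ordered. -/
structure Stage (G : SimpleGraph V) (f : Prop) (U : Set V) (r : V → ℕ) (M : ℕ) : Prop where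
  eq_on : ∀ v ∈ U, r v = M
  lt_off : ∀ v ∉ U, r v < M
  placed : ∀ v ∉ U, ∃ n : PNode V,
    n.All (fun n => Good G f n ∧ OrdAt G r n ∧ CleanAt G U n) ∧ v ∈ n.body
  unplaced : ∀ v ∈ U, ∃ n : PNode V, n.All (fun n => Good G f n ∧ OrdAt G r n ∧ CleanAt G U n) ∧
    (∀ w ∈ comp G U v, w ∈ n.region ∧ w ∉ n.body) ∧
    ∀ w ∈ comp G U v, ∀ z ∈ n.region, G.Adj w z → z ∈ comp G U v ∨ z ∈ n.body

theorem Stage.next (hG : NoK33 G) {M : ℕ} (h : Stage G f U r M) (hv : v ∈ U) :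
    ∃ U' r' M', U' ⊂ U ∧ Stage G f U' r' M' := by
  classical
  obtain ⟨n, hn, hsub, hclosed⟩ := h.unplaced v hv
  have hnG : n.All (Good G f) := hn.mono fun _ h => h.1
  obtain ⟨m, hmr, hmL, hm⟩ := exists_child hG hnG comp_linked ⟨v, mem_comp_self⟩ hsub hclosed
  set C := comp G U v with hC
  have hCU : C ⊆ U := comp_subset hv
  have hbody : ∀ w ∈ m.body, w ∈ C := fun w hw => hmr ▸ hw.2
  obtain ⟨b, hb⟩ := hm.nonempty
  obtain ⟨kb, hkb⟩ := hb.1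
  have hex : ∀ w, ∃ k, w ∈ m.body → m.At k w := by
    intro w
    by_cases hw : w ∈ m.body
    · obtain ⟨k, hk⟩ := hw.1
      exact ⟨k, fun _ => hk⟩
    · exact ⟨0, fun h => absurd h hw⟩
  choose idx hidx using hex
  set r' : V → ℕ := fun w => if w ∈ m.body then M + m.rk (idx w)
    else if w ∈ U then M + m.len + 1 else r w with hr'
  have e1 : ∀ w ∈ m.body, r' w = M + m.rk (idx w) := fun w hw => by simp [hr', hw]
  have e2 : ∀ w, w ∉ m.body → w ∈ U → r' w = M + m.len + 1 := fun w hw hw' => by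
    simp [hr', hw, hw']
  have e3 : ∀ w ∉ U, r' w = r w := fun w hw => by
    have : w ∉ m.body := fun h => hw (hCU (hbody w h))
    simp [hr', hw, this]
  have e1' : ∀ w ∈ m.body, r' w ≤ M + m.len := fun w hw => by
    rw [e1 w hw]
    have := rk_le (n := m) (at_le (hidx w hw))
    omega
  have hle : ∀ w, r w ≤ r' w := by
    intro w
    by_cases hw : w ∈ U
    · rw [h.eq_on w hw]
      by_cases hwb : w ∈ m.body
      · rw [e1 w hwb]
        omega
      · rw [e2 w hwb hw]
        omega
    · rw [e3 w hw]
  set U' := U \ m.body with hU'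
  have hUU : U' ⊆ U := Set.sdiff_subset
  have old : ∀ n : PNode V, n.All (fun n => Good G f n ∧ OrdAt G r n ∧ CleanAt G U n) →
      n.All (fun n => Good G f n ∧ OrdAt G r' n ∧ CleanAt G U' n) := fun n hn =>
    hn.mono fun _ h => ⟨h.1, h.2.1.change h.2.2 e3 hle, h.2.2.mono hUU⟩
  have hout : ∀ w z, w ∈ m.region → z ∉ m.region → G.Adj w z → z ∉ U := by
    intro w z hw hz hwz hzU
    rw [hmr] at hw hz
    exact hz (comp_step hw hwz hzU)
  have hordm : OrdAt G r' m := by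
    refine ⟨fun z w w' hz hw hw' hwz => ?_, fun v w hv hw hw' => ?_,
      fun i j v w hi hj hv hw hr => ?_⟩
    · have h1 := hout w z hw hz hwz
      have h2 := h.lt_off z h1
      have h3 := h.eq_on w' (hCU (hmr ▸ hw'))
      have h4 := hle w'
      rw [e3 z h1]
      omega
    · have h1 := e1' v hv
      have h2 := e2 w hw' (hCU (hmr ▸ hw))
      omega
    · have h1 : v ∈ m.body := ⟨⟨i, hi⟩, hv⟩
      have h2 : w ∈ m.body := ⟨⟨j, hj⟩, hw⟩
      rw [e1 v h1, e1 w h2, hm.inj _ _ _ (hidx v h1) hi, hm.inj _ _ _ (hidx w h2) hj]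
      omega
  have hmall : m.All (fun n => Good G f n ∧ OrdAt G r' n ∧ CleanAt G U' n) := by
    refine PNode.All.intro ⟨hm, hordm, fun v hv h => h.2 hv,
      fun w z hw hz hwz h => hout w z hw hz hwz h.1⟩ ?_ ?_
    · rw [hmL]
      exact old n hn
    · rcases hm.kind with ⟨h1, -⟩ | ⟨h1, -⟩
      · rw [h1, hmL]
        exact (old n hn).right
      · rw [h1, hmL]
        exact (old n hn).left
  refine ⟨U', r', M + m.len + 1, ⟨hUU, fun hc => (hc (hCU (hbody b hb))).2 hb⟩, ?_⟩
  constructor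
  · exact fun w hw => e2 w hw.2 hw.1
  · intro w hw
    by_cases hwb : w ∈ m.body
    · have := e1' w hwb
      omega
    · have hwU : w ∉ U := fun h => hw ⟨h, hwb⟩
      have := h.lt_off w hwU
      rw [e3 w hwU]
      omega
  · intro w hw
    by_cases hwb : w ∈ m.body
    · exact ⟨m, hmall, hwb⟩
    · have hwU : w ∉ U := fun h => hw ⟨h, hwb⟩
      obtain ⟨n', hn', hwn⟩ := h.placed w hwU
      exact ⟨n', old n' hn', hwn⟩
  · intro w hw
    by_cases hwC : w ∈ C
    · have hsubC : comp G U' w ⊆ C := by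
        rintro z ⟨a, ha⟩
        obtain ⟨b, hb⟩ := hwC
        exact ⟨_, hb.trans (ha.mono hUU)⟩
      refine ⟨m, hmall, fun z hz => ⟨hmr ▸ hsubC hz, (comp_subset hw hz).2⟩, ?_⟩
      intro z hz x hx hzx
      by_cases hxb : x ∈ m.body
      · exact .inr hxb
      · exact .inl (comp_step hz hzx ⟨hCU (hmr ▸ hx), hxb⟩)
    · have heq : comp G U' w = comp G U w := by
        refine Set.Subset.antisymm (fun z ⟨a, ha⟩ => ⟨a, ha.mono hUU⟩) ?_
        rintro z ⟨a, ha⟩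
        refine ⟨a, ?_⟩
        induction ha with
        | refl => exact .refl
        | @step y z a h1 hadj hz ih =>
          refine .step ih hadj ⟨hz, fun hzb => hwC ?_⟩
          obtain ⟨b, hb⟩ := hbody z hzb
          exact ⟨_, hb.trans ((h1.step hadj hz).symm hw.1)⟩
      obtain ⟨n', hn', h1, h2⟩ := h.unplaced w hw.1
      rw [heq]
      exact ⟨n', old n' hn', h1, h2⟩

theorem exists_final_stage [Finite V] (hG : NoK33 G) (c : ℕ) :
    ∀ (U : Set V) (r : V → ℕ) (M : ℕ), U.ncard ≤ c → Stage G f U r M →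
      ∃ r' M', Stage G f ∅ r' M' := by
  induction c with
  | zero =>
    intro U r M hc h
    obtain rfl := (Set.ncard_eq_zero (Set.toFinite U)).1 (Nat.le_zero.1 hc)
    exact ⟨r, M, h⟩
  | succ c ih =>
    intro U r M hc h
    rcases U.eq_empty_or_nonempty with rfl | ⟨v, hv⟩
    · exact ⟨r, M, h⟩
    · obtain ⟨U', r', M', hU, h'⟩ := h.next hG hv
      have := Set.ncard_lt_ncard hU (Set.toFinite U)
      exact ih U' r' M' (by omega) h'

/-- The ordering obtained from the decomposition. -/
theorem exists_order [Fintype V] (hG : NoK33 G) (f : Prop) :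
    ∃ σ : V → ℕ, Function.Injective σ ∧
      ∀ y, ∃ n : PNode V, n.All (Good G f) ∧ n.All (OrdAt G σ) ∧ y ∈ n.body := by
  have h0 : Stage G f (Set.univ : Set V) (fun _ => 0) 0 := by
    refine ⟨fun _ _ => rfl, fun v hv => absurd trivial hv, fun v hv => absurd trivial hv, ?_⟩
    intro v _
    refine ⟨root, trivial, fun w _ => ⟨trivial, fun ⟨⟨_, h⟩, _⟩ => h⟩, fun w hw z _ hwz => ?_⟩
    exact .inl (comp_step hw hwz trivial)
  obtain ⟨r, M, h⟩ := exists_final_stage hG _ _ _ _ le_rfl h0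
  let e := Fintype.equivFin V
  have hlt : ∀ v w, r v < r w → r v * Fintype.card V + e v < r w * Fintype.card V + e w := by
    intro v w hvw
    have := (e v).isLt
    have : (r v + 1) * Fintype.card V ≤ r w * Fintype.card V := Nat.mul_le_mul_right _ hvw
    rw [add_mul, one_mul] at this
    omega
  refine ⟨fun v => r v * Fintype.card V + e v, fun v w hvw => ?_, fun y => ?_⟩
  · rcases lt_trichotomy (r v) (r w) with h1 | h1 | h1
    · exact absurd hvw (hlt v w h1).ne
    · simp only [h1] at hvw
      exact e.injective (Fin.ext (by omega))
    · exact absurd hvw.symm (hlt w v h1).ne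
  · obtain ⟨n, hn, hy⟩ := h.placed y (Set.notMem_empty y)
    refine ⟨n, hn.mono fun _ h => h.1, hn.mono fun m h => ?_, hy⟩
    exact ⟨fun z w w' hz hw hw' hwz => hlt _ _ (h.2.1.bdry_lt z w w' hz hw hw' hwz),
      fun v w hv hw hw' => hlt _ _ (h.2.1.body_lt v w hv hw hw'),
      fun i j v w hi hj hv hw hr => hlt _ _ (h.2.1.rk_lt i j v w hi hj hv hw hr)⟩

end PlanarOrder

namespace PlanarOrder
open PNode

variable {V : Type} {G : SimpleGraph V} {n m S : PNode V} {i j k a b g : ℕ}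
  {u v w x y z p q : V} {f : Prop} {K Y : Set V}

/-- Two distinct paths with the same ends contain a cycle. -/
theorem le_length_add_length_of_ne (hg : (g : ℕ∞) ≤ G.egirth) {P Q : G.Walk u v} (hP : P.IsPath)
    (hQ : Q.IsPath) (hPQ : P ≠ Q) : g ≤ P.length + Q.length := by
  classical
  set H : SimpleGraph V := SimpleGraph.fromEdgeSet {e | e ∈ P.edges ∨ e ∈ Q.edges} with hH
  have hadj : ∀ e ∈ G.edgeSet, (e ∈ P.edges ∨ e ∈ Q.edges) → e ∈ H.edgeSet := by
    intro e he h
    rw [hH, SimpleGraph.edgeSet_fromEdgeSet]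
    exact ⟨h, fun hd => G.not_isDiag_of_mem_edgeSet he hd⟩
  have hsub : ∀ e ∈ H.edgeSet, e ∈ P.edges ∨ e ∈ Q.edges := by
    intro e he
    rw [hH, SimpleGraph.edgeSet_fromEdgeSet] at he
    exact he.1
  have h1 : ∀ e ∈ P.edges, e ∈ H.edgeSet := fun e he =>
    hadj e (P.edges_subset_edgeSet he) (.inl he)
  have h2 : ∀ e ∈ Q.edges, e ∈ H.edgeSet := fun e he =>
    hadj e (Q.edges_subset_edgeSet he) (.inr he)
  have hcyc : ¬ H.IsAcyclic := by
    intro hac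
    have h := (hac.subsingleton_path u v).elim ⟨P.transfer H h1, hP.transfer h1⟩
      ⟨Q.transfer H h2, hQ.transfer h2⟩
    have h' : P.transfer H h1 = Q.transfer H h2 := congrArg Subtype.val h
    apply hPQ
    have hs : P.support = Q.support := by
      rw [← SimpleGraph.Walk.support_transfer P h1, h', SimpleGraph.Walk.support_transfer]
    exact SimpleGraph.Walk.ext_support hs
  unfold SimpleGraph.IsAcyclic at hcyc
  push Not at hcyc
  obtain ⟨c, C, hC⟩ := hcyc
  have hHG : H ≤ G := by
    intro s t hst
    rcases hsub _ ((SimpleGraph.mem_edgeSet H).2 hst) with h | h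
    · exact P.adj_of_mem_edges h
    · exact Q.adj_of_mem_edges h
  have h3 := SimpleGraph.egirth_le_length (hC.mapLe hHG)
  rw [SimpleGraph.Walk.length_mapLe] at h3
  have h4 : C.length ≤ P.length + Q.length := by
    rw [← SimpleGraph.Walk.length_edges C, ← SimpleGraph.Walk.length_edges P,
      ← SimpleGraph.Walk.length_edges Q, ← List.length_append]
    refine (hC.isTrail.edges_nodup.subperm fun e he => ?_).length_le
    exact List.mem_append.2 (hsub e (C.edges_subset_edgeSet he))
  have : (g : ℕ∞) ≤ (C.length : ℕ∞) := hg.trans h3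
  exact (Nat.cast_le.1 this).trans h4

theorem Trek.exists_walk (h : Trek G K p y a) : ∃ W : G.Walk p y, W.length = a ∧
    ∀ e ∈ W.edges, ∃ v ∈ K, v ∈ e := by
  induction h with
  | refl => exact ⟨.nil, rfl, by simp⟩
  | @step y z a _ hadj hz ih =>
    obtain ⟨W, hl, hW⟩ := ih
    refine ⟨W.concat hadj, by simp [hl], ?_⟩
    intro e he
    rw [SimpleGraph.Walk.edges_concat, List.concat_eq_append, List.mem_append] at he
    rcases he with he | he
    · exact hW e he
    · rw [List.mem_singleton] at he
      subst he
      exact ⟨z, hz, by simp⟩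

theorem exists_segment (cl : ℕ → V) {len : ℕ} (hadj : ∀ k < len, G.Adj (cl k) (cl (k + 1)))
    (inj : ∀ k ≤ len, ∀ l ≤ len, cl k = cl l → k = l) (d : ℕ) : ∀ i j, i + d = j → j ≤ len →
    ∃ W : G.Walk (cl i) (cl j), W.IsPath ∧ W.length = d ∧
      (∀ v ∈ W.support, ∃ k, i ≤ k ∧ k ≤ j ∧ v = cl k) ∧
      ∀ k ≤ d, W.getVert k = cl (i + k) := by
  induction d with
  | zero =>
    rintro i _ rfl hi
    refine ⟨.nil, by simp, rfl, ?_, ?_⟩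
    · intro v hv
      rw [SimpleGraph.Walk.support_nil, List.mem_singleton] at hv
      exact ⟨i, le_rfl, le_rfl, hv⟩
    · intro k hk
      obtain rfl := Nat.le_zero.1 hk
      simp
  | succ d ih =>
    intro i j hij hj
    obtain ⟨W, hW, hl, hs, hv⟩ := ih (i + 1) j (by omega) hj
    refine ⟨.cons (hadj i (by omega)) W, ?_, by simp [hl], ?_, ?_⟩
    · rw [SimpleGraph.Walk.cons_isPath_iff]
      refine ⟨hW, fun h => ?_⟩
      obtain ⟨k, h1, h2, h3⟩ := hs _ h
      have := inj i (by omega) k (by omega) h3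
      omega
    · intro v hv
      rw [SimpleGraph.Walk.support_cons, List.mem_cons] at hv
      rcases hv with rfl | hv
      · exact ⟨i, le_rfl, by omega, rfl⟩
      · obtain ⟨k, h1, h2, h3⟩ := hs v hv
        exact ⟨k, by omega, by omega, h3⟩
    · intro k hk
      rcases k with _ | k
      · simp
      · rw [SimpleGraph.Walk.getVert_cons_succ, hv k (by omega)]
        congr 1
        omega

theorem Good.exists_segment (hS : Good G f S) (hi : S.At i p) (hj : S.At j q) (hij : i ≤ j) :
    ∃ W : G.Walk p q, W.IsPath ∧ W.length = j - i ∧ (∀ v ∈ W.support, v ∈ S.clSet) ∧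
      ∀ k ≤ j - i, S.At (i + k) (W.getVert k) := by
  obtain ⟨cl, hcl⟩ := exists_fun hi
  have hjl := at_le hj
  have hat : ∀ k ≤ S.len, S.At k (cl k) := fun k hk => (hcl _ _).2 ⟨hk, rfl⟩
  obtain ⟨W, hW, hl, hs, hv⟩ := PlanarOrder.exists_segment (G := G) cl (len := S.len)
    (fun k hk => hS.adj k _ _ (hat k hk.le) (hat _ hk))
    (fun k hk l hl h => hS.inj k l _ (hat k hk) (h ▸ hat l hl)) (j - i) i j (by omega) hjl
  obtain ⟨-, rfl⟩ := (hcl _ _).1 hi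
  obtain ⟨-, rfl⟩ := (hcl _ _).1 hj
  refine ⟨W, hW, hl, fun v hv' => ?_, fun k hk => ?_⟩
  · obtain ⟨k, h1, h2, rfl⟩ := hs v hv'
    exact ⟨k, hat k (by omega)⟩
  · rw [hv k hk]
    exact hat _ (by omega)

/-- Two contacts with a path through a set avoiding it close up to a cycle. -/
theorem Good.girth_le (hS : Good G f S) (hg : (g : ℕ∞) ≤ G.egirth) (hd : ∀ v ∈ S.clSet, v ∉ Y)
    (hi : S.At i p) (hj : S.At j q) (hij : i < j)
    (hp : Trek G Y p y a) (hq : Trek G Y q y b) : g ≤ a + b + (j - i) := by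
  classical
  obtain ⟨W₁, hl₁, he₁⟩ := hp.exists_walk
  obtain ⟨W₂, hl₂, he₂⟩ := hq.exists_walk
  obtain ⟨W, hW, hl, hs, -⟩ := hS.exists_segment hi hj hij.le
  set P := (W₁.append W₂.reverse).bypass with hP
  have hPl : P.length ≤ a + b := by
    refine (SimpleGraph.Walk.length_bypass_le_length _).trans ?_
    simp [hl₁, hl₂]
  have hPe : ∀ e ∈ P.edges, ∃ v ∈ Y, v ∈ e := by
    intro e he
    have := SimpleGraph.Walk.edges_bypass_subset_edges _ he
    rw [SimpleGraph.Walk.edges_append, List.mem_append, SimpleGraph.Walk.edges_reverse,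
      List.mem_reverse] at this
    rcases this with h | h
    · exact he₁ e h
    · exact he₂ e h
  have hne : P ≠ W := by
    intro h
    rw [h] at hPe
    cases W with
    | nil => simp at hl; omega
    | cons hadj W' =>
      obtain ⟨v, hv, hve⟩ := hPe _ (by rw [SimpleGraph.Walk.edges_cons]; exact List.mem_cons_self)
      rcases Sym2.mem_iff.1 hve with rfl | rfl
      · exact hd _ (hs _ (SimpleGraph.Walk.start_mem_support _)) hv
      · refine hd _ (hs _ ?_) hv
        rw [SimpleGraph.Walk.support_cons]
        exact List.mem_cons_of_mem _ (SimpleGraph.Walk.start_mem_support _)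
  have := le_length_add_length_of_ne hg (SimpleGraph.Walk.bypass_isPath _) hW hne
  rw [← hP] at this
  omega

end PlanarOrder

namespace PlanarOrder
open PNode

variable {V : Type} {G : SimpleGraph V} {n m S A h : PNode V} {i j k a b g d : ℕ}
  {u v w x y z p q : V} {f : Prop} {K Y C : Set V} {σ : V → ℕ} {P Q : PNode V → Prop}

theorem Trek.exists_adj (h : Trek G K z y a) (hz : z ∉ K) (hy : y ∈ K) : ∃ w ∈ K, G.Adj w z := by
  obtain ⟨f, h0, ha, hadj, hK⟩ := h.exists_fun
  have : 0 < a := by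
    rcases Nat.eq_zero_or_pos a with h | h
    · subst h
      exact absurd (h0 ▸ ha ▸ hy) hz
    · exact h
  exact ⟨f 1, hK 1 one_pos this, h0 ▸ (hadj 0 this).symm⟩

/-- The set of later vertices of the region. -/
def later (n : PNode V) (σ : V → ℕ) (y : V) : Set V := {w | w ∈ n.region ∧ σ y ≤ σ w}

/-- The three ways in which a vertex is reached from a vertex of the path of a node. -/
theorem subReach_cases (ho : OrdAt G σ n) (hσ : Function.Injective σ) (hy : y ∈ n.body)
    (hx : x ∈ SubReach G σ 4 y) :
    (x ∈ n.body ∧ σ x ≤ σ y ∧ ∃ P : G.Walk x y, P.IsPath ∧ P.length ≤ 4 ∧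
      (∀ k, 0 < k → k ≤ P.length → P.getVert k ∈ n.region) ∧
      ∀ k, 2 ≤ k → k ≤ P.length → σ y ≤ σ (P.getVert k)) ∨
    (x ∉ n.region ∧ ∃ a ≤ 4, Trek G n.region x y a) ∨
    (∃ z, z ∉ n.region ∧ G.Adj x z ∧ σ x < σ z ∧ ∃ a ≤ 3, Trek G (later n σ y) z y a) := by
  obtain ⟨P, hP, hl, hmin, hge⟩ := hx
  have hge : ∀ k, 2 ≤ k → k ≤ P.length → σ y ≤ σ (P.getVert k) := hge
  have hxy : σ x ≤ σ y := by simpa using hmin P.length le_rfl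
  have hadj : ∀ k < P.length, G.Adj (P.getVert k) (P.getVert (k + 1)) := fun k hk =>
    P.adj_getVert_succ hk
  have hK : ∀ d k, k + d = P.length → 2 ≤ k ∨ d = 0 → P.getVert k ∈ n.region := by
    intro d
    induction d with
    | zero =>
      intro k hk _
      rw [show k = P.length by omega, SimpleGraph.Walk.getVert_length]
      exact hy.2
    | succ d ih =>
      intro k hk hk2
      by_contra hc
      have h1 := ih (k + 1) (by omega) (by omega)
      have h2 := ho.bdry_lt _ _ y hc h1 hy.2 (hadj k (by omega)).symm
      have h3 := hge k (by omega) (by omega)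
      omega
  have hK' : ∀ k, 2 ≤ k → k ≤ P.length → P.getVert k ∈ n.region := fun k h1 h2 =>
    hK (P.length - k) k (by omega) (.inl h1)
  rcases Nat.eq_zero_or_pos P.length with h0 | h0
  · have hxy' : x = y := by
      rw [← P.getVert_length, h0, P.getVert_zero]
    subst hxy'
    exact .inl ⟨hy, le_rfl, P, hP, hl, fun k _ _ => by omega, hge⟩
  · by_cases h1 : P.getVert 1 ∈ n.region
    · have hall : ∀ k, 0 < k → k ≤ P.length → P.getVert k ∈ n.region := by
        intro k hk hk'
        rcases Nat.lt_or_ge k 2 with h | h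
        · obtain rfl : k = 1 := by omega
          exact h1
        · exact hK' k h hk'
      by_cases hx : x ∈ n.region
      · refine .inl ⟨?_, hxy, P, hP, hl, hall, hge⟩
        by_contra hxb
        have := ho.body_lt y x hy hx hxb
        omega
      · refine .inr (.inl ⟨hx, P.length, hl, ?_⟩)
        have := Trek.of_fun (G := G) P.getVert h0.le (fun k _ hk => hadj k hk) hall
        simpa using this
    · have h2 : 2 ≤ P.length := by
        by_contra hlt
        exact h1 (hK 0 1 (by omega) (.inr rfl))
      have hxz : G.Adj x (P.getVert 1) := by simpa using hadj 0 h0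
      refine .inr (.inr ⟨P.getVert 1, h1, hxz, ?_, P.length - 1, by omega, ?_⟩)
      · exact lt_of_le_of_ne (hmin 1 (by omega)) fun h => hxz.ne (hσ h)
      · have := Trek.of_fun (G := G) P.getVert (i := 1) (j := P.length) (K := later n σ y)
          (by omega) (fun k _ hk => hadj k hk)
          (fun k h1 h2 => ⟨hK' k (by omega) h2, hge k (by omega) h2⟩)
        simpa using this

theorem Good.mem_of_bdry (hn : Good G f n) (hL : n.L.All (Good G f)) (hw : w ∈ n.region)
    (hz : z ∉ n.region) (hwz : G.Adj w z) : z ∈ n.L.clSet ∨ z ∈ n.X := by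
  rcases hn.bdry w z hw hz hwz with h | h | h | h
  · exact .inl (hn.pole _ _ h hz)
  · exact .inl (hn.pole _ _ h hz)
  · exact .inl (mid_subset_body hL h).1
  · exact .inr h

theorem low_cases (ho : OrdAt G σ n) (hz : z ∈ n.body)
    (hlt : σ x < σ z) : x ∈ n.body ∨ x ∉ n.region := by
  by_cases h : x ∈ n.region
  · refine .inl ?_
    by_contra hb
    have := ho.body_lt z x hz h hb
    omega
  · exact .inr h

/-- Every path vertex lies in the body of an earlier node. -/
theorem exists_home (hP : ∀ m, P m → Good G f m) (hS : S.All P) (hu : u ∈ S.clSet) :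
    ∃ h : PNode V, h.All P ∧ u ∈ h.body := by
  induction S with
  | root =>
    obtain ⟨k, hk⟩ := hu
    exact hk.elim
  | mk K X len cl sw L O ihL ihO =>
    rcases mem_body_or_pole hu with hb | hb
    · exact ⟨_, hS, hb⟩
    · obtain ⟨k, hk⟩ := hu
      exact ihL hS.2.1 ((hP _ hS.1).pole k u hk hb)

theorem exists_home_parent (hP : ∀ m, P m → Good G f m) (hS : S.All P) (hu : u ∈ S.clSet)
    (hA : A = S.L ∨ A = S.O) (huA : u ∉ A.clSet) :
    ∃ h : PNode V, h.All P ∧ u ∈ h.body ∧ (A = h.L ∨ A = h.O) := by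
  induction S with
  | root =>
    obtain ⟨k, hk⟩ := hu
    exact hk.elim
  | mk K X len cl sw L O ihL ihO =>
    rcases mem_body_or_pole hu with hb | hb
    · exact ⟨_, hS, hb, hA⟩
    · obtain ⟨k, hk⟩ := hu
      have hg := hP _ hS.1
      have huL : u ∈ L.clSet := hg.pole k u hk hb
      rcases hA with rfl | rfl
      · exact absurd huL huA
      · rcases hg.kind with ⟨h1, -⟩ | ⟨h1, -⟩
        · exact ihL hS.2.1 huL (.inr h1)
        · exact ihL hS.2.1 huL (.inl h1)

/-- A set of path vertices whose indices differ by at least `s` and at most `D`. -/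
theorem ncard_window [Finite V] {s D : ℕ} (hs : 0 < s) (hC : C ⊆ S.clSet)
    (hw : ∀ i j p q, p ∈ C → q ∈ C → S.At i p → S.At j q → i < j → s ≤ j - i ∧ j - i ≤ D) :
    C.ncard ≤ D / s + 1 := by
  classical
  rcases C.eq_empty_or_nonempty with rfl | hne
  · simp
  have hex : ∀ p : V, ∃ k, p ∈ C → S.At k p := by
    intro p
    by_cases hp : p ∈ C
    · obtain ⟨k, hk⟩ := hC hp
      exact ⟨k, fun _ => hk⟩
    · exact ⟨0, fun h => absurd h hp⟩
  choose idx hidx using hex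
  obtain ⟨p₀, hp₀, hmin⟩ := Set.exists_min_image C idx (Set.toFinite C) hne
  have hmaps : ∀ p ∈ C, (idx p - idx p₀) / s ∈ (Finset.range (D / s + 1) : Set ℕ) := by
    intro p hp
    rw [Finset.mem_coe, Finset.mem_range, Nat.lt_succ_iff]
    refine Nat.div_le_div_right ?_
    rcases (hmin p hp).eq_or_lt with h | h
    · omega
    · exact (hw _ _ _ _ hp₀ hp (hidx _ hp₀) (hidx _ hp) h).2
  have key : ∀ p ∈ C, ∀ q ∈ C, idx p < idx q →
      (idx p - idx p₀) / s ≠ (idx q - idx p₀) / s := by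
    intro p hp q hq hlt he
    have h1 := (hw _ _ _ _ hp hq (hidx _ hp) (hidx _ hq) hlt).1
    have h2 := hmin p hp
    have h3 : (idx p - idx p₀) + s ≤ idx q - idx p₀ := by omega
    have h4 := Nat.div_le_div_right (c := s) h3
    rw [Nat.add_div_right _ hs] at h4
    omega
  have hinj : Set.InjOn (fun p => (idx p - idx p₀) / s) C := by
    intro p hp q hq he
    rcases lt_trichotomy (idx p) (idx q) with h | h | h
    · exact absurd he (key p hp q hq h)
    · have h1 := hidx p hp
      have h2 := hidx q hq
      rw [h] at h1
      exact at_fun h1 h2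
    · exact absurd he.symm (key q hq p hp h)
  have := Set.ncard_le_ncard_of_injOn _ hmaps hinj (Finset.finite_toSet _)
  simpa [Set.ncard_coe_finset] using this

/-- The vertices of the path of `S` from which `y` is reached within `Y` by at most `d` steps. -/
def contacts (G : SimpleGraph V) (S : PNode V) (Y : Set V) (y : V) (d : ℕ) : Set V :=
  {p | p ∈ S.clSet ∧ ∃ a ≤ d, Trek G Y p y a}

theorem contacts_mono {Y' : Set V} {d' : ℕ} (hY : Y ⊆ Y') (hd : d ≤ d') :
    contacts G S Y y d ⊆ contacts G S Y' y d' := by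
  rintro p ⟨hp, a, ha, h⟩
  exact ⟨hp, a, by omega, h.mono hY⟩

theorem Good.index_le (hS : Good G f S) (hY : Y ⊆ S.region) (hy : y ∈ S.region)
    (hp : p ∈ contacts G S Y y d) (hq : q ∈ contacts G S Y y d) (hi : S.At i p) (hj : S.At j q) :
    j ≤ i + 2 * d := by
  obtain ⟨-, a, ha, h1⟩ := hp
  obtain ⟨-, b, hb, h2⟩ := hq
  have := hS.iso i j p q y a b hy hi hj (h1.mono hY) (h2.mono hY)
  omega

theorem ncard_contacts_le [Finite V] (hS : Good G f S) (hY : Y ⊆ S.region) (hy : y ∈ S.region) :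
    (contacts G S Y y d).ncard ≤ 2 * d + 1 := by
  refine (ncard_window (s := 1) (D := 2 * d) one_pos (fun p hp => hp.1) ?_).trans (by simp)
  intro i j p q hp hq hi hj hij
  have := hS.index_le hY hy hp hq hi hj
  omega

theorem ncard_contacts_le_of_girth [Finite V] (hS : Good G f S) (hg : (g : ℕ∞) ≤ G.egirth)
    (hY : Y ⊆ S.region) (hd : ∀ v ∈ S.clSet, v ∉ Y) (hy : y ∈ S.region) (hlt : 2 * d < g) :
    (contacts G S Y y d).ncard ≤ 2 * d / (g - 2 * d) + 1 := by
  refine ncard_window (by omega) (fun p hp => hp.1) ?_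
  intro i j p q hp hq hi hj hij
  have := hS.index_le hY hy hp hq hi hj
  obtain ⟨-, a, ha, h1⟩ := hp
  obtain ⟨-, b, hb, h2⟩ := hq
  have := hS.girth_le hg hd hi hj hij h1 h2
  omega

theorem adj_mem_contacts (hp : p ∈ S.clSet) (hpz : G.Adj p z) (hz : z ∈ Y) :
    p ∈ contacts G S Y z 1 :=
  ⟨hp, 1, le_rfl, Trek.step .refl hpz hz⟩

end PlanarOrder

namespace PlanarOrder
open PNode

variable {V : Type} {G : SimpleGraph V} {n m S A h : PNode V} {i j k a b g d : ℕ}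
  {u v w x y z p q : V} {f : Prop} {K Y C : Set V} {σ : V → ℕ}

/-- The neighbours of `z` that precede it. -/
def low (G : SimpleGraph V) (σ : V → ℕ) (z : V) : Set V := {x | G.Adj x z ∧ σ x < σ z}

theorem rk_of_not_sw (h : ¬ n.sw) (k : ℕ) : n.rk k = k := by simp [rk, h]

theorem OrdAt.rk_le (ho : OrdAt G σ n) (hi : n.At i x) (hj : n.At j y) (hx : x ∈ n.region)
    (hy : y ∈ n.region) (h : σ x ≤ σ y) : n.rk i ≤ n.rk j := by
  by_contra hc
  have := ho.rk_lt j i y x hj hi hy hx (by omega)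
  omega

theorem trek_one (h : G.Adj x z) (hz : z ∈ K) : Trek G K x z 1 := .step .refl h hz

theorem Good.adj_index (hn : Good G f n) (hi : n.At i x) (hj : n.At j z) (hz : z ∈ n.region)
    (h : G.Adj x z) : j ≤ i + 1 ∧ i ≤ j + 1 := by
  have h1 := hn.iso i j x z z 1 0 hz hi hj (trek_one h hz) .refl
  have h2 := hn.iso j i z x z 0 1 hz hj hi .refl (trek_one h hz)
  omega

theorem ncard_le_one_of_forall_eq {s : Set V} (h : ∀ x ∈ s, ∀ y ∈ s, x = y) : s.ncard ≤ 1 := by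
  have : s.Subsingleton := fun x hx y hy => h x hx y hy
  rcases this.eq_empty_or_singleton with rfl | ⟨x, rfl⟩ <;> simp

theorem ncard_low_body (hn : Good G f n) (ho : OrdAt G σ n) (hsw : ¬ n.sw) (hz : z ∈ n.body) :
    (low G σ z ∩ n.body).ncard ≤ 1 := by
  obtain ⟨⟨j, hj⟩, hzr⟩ := hz
  have key : ∀ x ∈ low G σ z ∩ n.body, n.At (j - 1) x := by
    rintro x ⟨⟨hxz, hlt⟩, ⟨i, hi⟩, hxr⟩
    have h1 := ho.rk_le hi hj hxr hzr hlt.le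
    rw [rk_of_not_sw hsw, rk_of_not_sw hsw] at h1
    have h2 := hn.adj_index hi hj hzr hxz
    have h3 : i ≠ j := by
      rintro rfl
      exact hxz.ne (at_fun hi hj)
    obtain rfl : i = j - 1 := by omega
    exact hi
  exact ncard_le_one_of_forall_eq fun x hx x' hx' => at_fun (key x hx) (key x' hx')

theorem low_subset (hn : n.All (Good G f)) (hg : Good G f n) (ho : OrdAt G σ n) (hz : z ∈ n.body) :
    low G σ z ⊆ (low G σ z ∩ n.body) ∪ (contacts G n.L n.region z 1 ∪ contacts G n.O n.region z 1) := by
  rintro x ⟨hxz, hlt⟩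
  rcases low_cases ho hz hlt with hb | hb
  · exact .inl ⟨⟨hxz, hlt⟩, hb⟩
  · rcases hg.mem_of_bdry hn.left hz.2 hb hxz.symm with h | h
    · exact .inr (.inl (adj_mem_contacts h hxz hz.2))
    · exact .inr (.inr (adj_mem_contacts (hg.X_sub h).1 hxz hz.2))

theorem ncard_contacts_le' [Finite V] (hS : S.All (Good G f)) (hY : Y ⊆ S.region)
    (hy : y ∈ S.region) : (contacts G S Y y d).ncard ≤ 2 * d + 1 := by
  rcases (contacts G S Y y d).eq_empty_or_nonempty with h | ⟨p, hp⟩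
  · simp [h]
  · exact ncard_contacts_le (hS.self_of_mem hp.1) hY hy

theorem ncard_le_add_of_subset [Finite V] {s t r : Set V} (h : s ⊆ t ∪ r) {a b : ℕ}
    (ht : t.ncard ≤ a) (hr : r.ncard ≤ b) : s.ncard ≤ a + b :=
  (Set.ncard_le_ncard h (Set.toFinite _)).trans ((Set.ncard_union_le _ _).trans (by omega))

theorem ncard_low_le [Finite V] (hn : n.All (fun m => Good G f m ∧ OrdAt G σ m)) (hf : ¬ f)
    (hz : z ∈ n.body) : (low G σ z).ncard ≤ 7 := by
  have hn' := hn.mono (Q := Good G f) fun _ h => h.1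
  have hs := hn.self_of_mem hz.1
  refine ncard_le_add_of_subset (a := 1) (b := 6) (low_subset hn' hs.1 hs.2 hz)
    (ncard_low_body hs.1 hs.2 (fun h => hf (hs.1.swap.1 h).1) hz) ?_
  exact ncard_le_add_of_subset (a := 3) (b := 3) subset_rfl
    (ncard_contacts_le' hn'.left (region_subset_L hn') (region_subset_L hn' hz.2))
    (ncard_contacts_le' hn'.right (region_subset_O hn') (region_subset_O hn' hz.2))

theorem ncard_low_diff_self_le [Finite V] (hn : n.All (fun m => Good G f m ∧ OrdAt G σ m))
    (hz : z ∈ n.body) : (low G σ z \ n.clSet).ncard ≤ 6 := by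
  have hn' := hn.mono (Q := Good G f) fun _ h => h.1
  have hs := hn.self_of_mem hz.1
  refine ncard_le_add_of_subset (a := 3) (b := 3) ?_
    (ncard_contacts_le' (d := 1) hn'.left (region_subset_L hn') (region_subset_L hn' hz.2))
    (ncard_contacts_le' (d := 1) hn'.right (region_subset_O hn') (region_subset_O hn' hz.2))
  rintro x ⟨hx, hx'⟩
  rcases low_subset hn' hs.1 hs.2 hz hx with h | h
  · exact absurd h.2.1 hx'
  · exact h

theorem ncard_low_diff_parent_le [Finite V] (hn : n.All (fun m => Good G f m ∧ OrdAt G σ m))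
    (hf : ¬ f) (hz : z ∈ n.body) (hA : A = n.L ∨ A = n.O) :
    (low G σ z \ A.clSet).ncard ≤ 4 ∧ (low G σ z \ (n.clSet ∪ A.clSet)).ncard ≤ 3 := by
  have hn' := hn.mono (Q := Good G f) fun _ h => h.1
  have hs := hn.self_of_mem hz.1
  have hb := ncard_low_body hs.1 hs.2 (fun h => hf (hs.1.swap.1 h).1) hz
  have key : ∃ c : Set V, c.ncard ≤ 3 ∧ low G σ z \ A.clSet ⊆ (low G σ z ∩ n.body) ∪ c := by
    rcases hA with rfl | rfl
    · refine ⟨_, ncard_contacts_le' (d := 1) hn'.right (region_subset_O hn')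
        (region_subset_O hn' hz.2), ?_⟩
      rintro x ⟨hx, hx'⟩
      rcases low_subset hn' hs.1 hs.2 hz hx with h | h | h
      · exact .inl h
      · exact absurd h.1 hx'
      · exact .inr h
    · refine ⟨_, ncard_contacts_le' (d := 1) hn'.left (region_subset_L hn')
        (region_subset_L hn' hz.2), ?_⟩
      rintro x ⟨hx, hx'⟩
      rcases low_subset hn' hs.1 hs.2 hz hx with h | h | h
      · exact .inl h
      · exact .inr h
      · exact absurd h.1 hx'
  obtain ⟨c, hc, hsub⟩ := key
  refine ⟨ncard_le_add_of_subset (a := 1) (b := 3) hsub hb hc,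
    (Set.ncard_le_ncard ?_ (Set.toFinite _)).trans hc⟩
  rintro x ⟨hx, hx'⟩
  rcases hsub ⟨hx, fun h => hx' (.inr h)⟩ with h | h
  · exact absurd (.inl h.2.1) hx'
  · exact h

/-- A path whose vertices have indices in an interval. -/
theorem ncard_le_of_index [Finite V] (hC : C ⊆ S.clSet) {a b : ℕ}
    (h : ∀ k p, p ∈ C → S.At k p → a ≤ k ∧ k < b) : C.ncard ≤ b - a := by
  classical
  have hex : ∀ p : V, ∃ k, p ∈ C → S.At k p := by
    intro p
    by_cases hp : p ∈ C
    · obtain ⟨k, hk⟩ := hC hp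
      exact ⟨k, fun _ => hk⟩
    · exact ⟨0, fun h => absurd h hp⟩
  choose idx hidx using hex
  have := Set.ncard_le_ncard_of_injOn (t := (Finset.Ico a b : Set ℕ)) idx
    (fun p hp => by simpa using h _ p hp (hidx p hp))
    (fun p hp q hq he => at_fun (hidx p hp) (by rw [he]; exact hidx q hq)) (Finset.finite_toSet _)
  simpa [Set.ncard_coe_finset] using this

/-- The own vertices of the path. -/
def own (G : SimpleGraph V) (σ : V → ℕ) (n : PNode V) (y : V) : Set V :=
  {x | x ∈ n.body ∧ σ x ≤ σ y ∧ ∃ P : G.Walk x y, P.IsPath ∧ P.length ≤ 4 ∧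
      (∀ k, 0 < k → k ≤ P.length → P.getVert k ∈ n.region) ∧
      ∀ k, 2 ≤ k → k ≤ P.length → σ y ≤ σ (P.getVert k)}

theorem trek_of_walk {P : G.Walk x y} (h : ∀ k, 0 < k → k ≤ P.length → P.getVert k ∈ K) :
    Trek G K x y P.length := by
  simpa using Trek.of_fun (G := G) P.getVert (Nat.zero_le _)
    (fun k _ hk => P.adj_getVert_succ hk) h

theorem own_index (hn : Good G f n) (ho : OrdAt G σ n) (hsw : ¬ n.sw) (hj : n.At j y)
    (hy : y ∈ n.region) (hx : x ∈ own G σ n y) (hi : n.At i x) : j ≤ i + 4 ∧ i ≤ j := by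
  obtain ⟨hb, hle, P, -, hl, hK, -⟩ := hx
  have h1 := ho.rk_le hi hj hb.2 hy hle
  rw [rk_of_not_sw hsw, rk_of_not_sw hsw] at h1
  have h2 := hn.iso i j x y y _ 0 hy hi hj (trek_of_walk hK) .refl
  omega

theorem ncard_own_le [Finite V] (hn : Good G f n) (ho : OrdAt G σ n) (hsw : ¬ n.sw)
    (hy : y ∈ n.body) : (own G σ n y).ncard ≤ 5 := by
  obtain ⟨⟨j, hj⟩, hy⟩ := hy
  refine (ncard_le_of_index (S := n) (a := j - 4) (b := j + 1) (fun x hx => hx.1.1) ?_).trans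
    (by omega)
  intro k p hp hk
  have := own_index hn ho hsw hj hy hp hk
  omega

theorem ncard_own_le_of_start [Finite V] (hn : Good G f n) (ho : OrdAt G σ n) (hsw : ¬ n.sw)
    (hy : y ∈ n.body) (hu : n.At 0 u) (hur : u ∉ n.region) (ha : a ≤ 3)
    (ht : Trek G n.region u y a) : (own G σ n y).ncard ≤ 3 := by
  obtain ⟨⟨j, hj⟩, hy⟩ := hy
  have h3 := hn.iso 0 j u y y a 0 hy hu hj ht .refl
  refine (ncard_le_of_index (S := n) (a := 1) (b := 4) (fun x hx => hx.1.1) ?_)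
  intro k p hp hk
  have := own_index hn ho hsw hj hy hp hk
  have : k ≠ 0 := by
    rintro rfl
    exact hur (at_fun hu hk ▸ hp.1.2)
  omega

end PlanarOrder

namespace PlanarOrder
open PNode

variable {V : Type} {G : SimpleGraph V} {n m S A h : PNode V} {i j k a b g d : ℕ}
  {u v w x y z p q : V} {f : Prop} {K Y C : Set V} {σ : V → ℕ}

open Classical in
/-- One for every inner vertex of the path of `S`, and two for its ends outside the region. -/
noncomputable def weight (S : PNode V) (u : V) : ℕ :=
  (if u ∈ S.clSet then 1 else 0) + (if u ∈ S.clSet ∧ u ∉ S.region then 1 else 0)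

/-- The path vertices within distance four. -/
def win (G : SimpleGraph V) (S : PNode V) (y : V) : Set V := contacts G S S.region y 4

theorem ncard_win_add_poles [Finite V] (hS : Good G f S) (hy : y ∈ S.region) (U : Finset V)
    (hU : ∀ u ∈ U, (u ∈ S.clSet ∧ u ∉ S.region) ∧ ∃ a ≤ 3, Trek G S.region u y a) :
    (win G S y).ncard + U.card ≤ 9 := by
  classical
  have hsub : win G S y ⊆ S.clSet := fun p hp => hp.1
  have idx : ∀ k l p u, p ∈ win G S y → u ∈ U → S.At k p → S.At l u → k ≤ l + 7 ∧ l ≤ k + 7 := by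
    rintro k l p u ⟨-, a, ha, hp⟩ hu hk hl
    obtain ⟨-, b, hb, hu⟩ := hU u hu
    have h1 := hS.iso k l p u y a b hy hk hl hp hu
    have h2 := hS.iso l k u p y b a hy hl hk hu hp
    omega
  have hUidx : ∀ u ∈ U, S.At 0 u ∨ S.At S.len u := by
    intro u hu
    obtain ⟨⟨⟨k, hk⟩, hr⟩, -⟩ := hU u hu
    rcases hS.pole_index hk hr with rfl | rfl
    · exact .inl hk
    · exact .inr hk
  by_cases h0 : ∃ u ∈ U, S.At 0 u
  · obtain ⟨u, hu, hu0⟩ := h0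
    by_cases hl : ∃ v ∈ U, S.At S.len v
    · obtain ⟨v, hv, hvl⟩ := hl
      have hUle : U.card ≤ 2 := by
        refine (Finset.card_le_card (t := {u, v}) fun w hw => ?_).trans Finset.card_le_two
        rcases hUidx w hw with h | h
        · simp [at_fun h hu0]
        · simp [at_fun h hvl]
      have hlen : S.len ≤ 6 := by
        obtain ⟨-, a, ha, h1⟩ := hU u hu
        obtain ⟨-, b, hb, h2⟩ := hU v hv
        have := hS.iso 0 S.len u v y a b hy hu0 hvl h1 h2
        omega
      have := ncard_le_of_index (a := 0) (b := 7) hsub fun k p _ hk => by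
        have := at_le hk
        omega
      omega
    · have hUle : U.card ≤ 1 := by
        refine (Finset.card_le_card (t := {u}) fun w hw => ?_).trans (Finset.card_singleton u).le
        rcases hUidx w hw with h | h
        · simp [at_fun h hu0]
        · exact absurd ⟨w, hw, h⟩ hl
      have := ncard_le_of_index (a := 0) (b := 8) hsub fun k p hp hk => by
        have := idx k 0 p u hp hu hk hu0
        omega
      omega
  · by_cases hl : ∃ v ∈ U, S.At S.len v
    · obtain ⟨v, hv, hvl⟩ := hl
      have hUle : U.card ≤ 1 := by
        refine (Finset.card_le_card (t := {v}) fun w hw => ?_).trans (Finset.card_singleton v).le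
        rcases hUidx w hw with h | h
        · exact absurd ⟨w, hw, h⟩ h0
        · simp [at_fun h hvl]
      have := ncard_le_of_index (a := S.len - 7) (b := S.len + 1) hsub fun k p hp hk => by
        have := idx k S.len p v hp hv hk hvl
        have := at_le hk
        omega
      omega
    · have hUle : U.card = 0 := by
        rw [Finset.card_eq_zero, Finset.eq_empty_iff_forall_notMem]
        intro w hw
        rcases hUidx w hw with h | h
        · exact h0 ⟨w, hw, h⟩
        · exact hl ⟨w, hw, h⟩
      have : (win G S y).ncard ≤ 2 * 4 + 1 := ncard_contacts_le hS subset_rfl hy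
      omega

theorem ncard_win_diff_add_weight [Finite V] (hS : S.All (Good G f)) (hy : y ∈ S.region)
    (U : Finset V) (hU : ∀ u ∈ U, ∃ a ≤ 3, Trek G S.region u y a) :
    (win G S y \ U).ncard + ∑ u ∈ U, weight S u ≤ 9 := by
  classical
  have hw : ∑ u ∈ U, weight S u = (U.filter (· ∈ S.clSet)).card +
      (U.filter fun u => u ∈ S.clSet ∧ u ∉ S.region).card := by
    simp only [weight, Finset.sum_add_distrib, Finset.card_filter]
  have hsub : ((U.filter (· ∈ S.clSet) : Finset V) : Set V) ⊆ win G S y := by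
    intro u hu
    simp only [Finset.coe_filter, Set.mem_ofPred_eq] at hu
    obtain ⟨a, ha, h⟩ := hU u hu.1
    exact ⟨hu.2, a, by omega, h⟩
  have hdiff : win G S y \ U = win G S y \ (U.filter (· ∈ S.clSet) : Finset V) := by
    ext p
    simp only [Set.mem_sdiff, Finset.coe_filter, Set.mem_ofPred_eq, Finset.mem_coe]
    constructor
    · rintro ⟨h1, h2⟩
      exact ⟨h1, fun h => h2 h.1⟩
    · rintro ⟨h1, h2⟩
      exact ⟨h1, fun h => h2 ⟨h, h1.1⟩⟩
  have h1 := Set.ncard_sdiff_add_ncard_of_subset hsub (Set.toFinite _)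
  rw [← hdiff, Set.ncard_coe_finset] at h1
  rcases (S.clSet).eq_empty_or_nonempty with he | ⟨p, hp⟩
  · have : win G S y = ∅ := by
      ext p
      simp [win, contacts, he]
    simp [this, weight, he]
  · have := ncard_win_add_poles (hS.self_of_mem hp) hy
      (U.filter fun u => u ∈ S.clSet ∧ u ∉ S.region) fun u hu => by
        rw [Finset.mem_filter] at hu
        exact ⟨hu.2, hU u hu.1⟩
    omega

theorem mem_win_of_adj (hK : K ⊆ S.region) (hx : x ∈ S.clSet) (hxz : G.Adj x z)
    (hz : z ∈ S.region) (ha : a ≤ 3) (ht : Trek G K z y a) : x ∈ win G S y :=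
  ⟨hx, a + 1, by omega, (ht.mono hK).cons hxz hz⟩

end PlanarOrder

namespace PlanarOrder
open PNode

variable {V : Type} {G : SimpleGraph V} {n m S A h : PNode V} {i j k a b g d : ℕ}
  {u v w x y z p q : V} {f : Prop} {K Y C : Set V} {σ : V → ℕ}

/-- A set covered by `D`, four windows and the lower neighbourhoods of the vertices in `U`. -/
theorem ncard_le_of_windows [Finite V] {D T : Set V} (S : Fin 4 → PNode V)
    (hS : ∀ r, (S r).All (Good G f)) (hy : ∀ r, y ∈ (S r).region) (U : Finset V)
    (hU : ∀ u ∈ U, ∀ r, ∃ a ≤ 3, Trek G (S r).region u y a)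
    (hext : ∀ u ∈ U, (low G σ u \ ⋃ r, win G (S r) y).ncard ≤ 1 + ∑ r, weight (S r) u)
    (hT : T ⊆ D ∪ (⋃ r, win G (S r) y) ∪ ⋃ u ∈ U, low G σ u)
    (hD : D.ncard + 2 * U.card ≤ 7) : T.ncard ≤ 43 := by
  classical
  have hcover : T ⊆ (D ∪ (⋃ r, win G (S r) y \ U)) ∪
      (U ∪ ⋃ u ∈ U, (low G σ u \ ⋃ r, win G (S r) y)) := by
    intro x hx
    by_cases hxU : x ∈ U
    · exact .inr (.inl hxU)
    by_cases hxw : x ∈ ⋃ r, win G (S r) y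
    · obtain ⟨r, hr⟩ := Set.mem_iUnion.1 hxw
      exact .inl (.inr (Set.mem_iUnion.2 ⟨r, hr, hxU⟩))
    · rcases hT hx with (h | h) | h
      · exact .inl (.inl h)
      · exact absurd h hxw
      · simp only [Set.mem_iUnion] at h
        obtain ⟨u, hu, h⟩ := h
        refine .inr (.inr ?_)
        simp only [Set.mem_iUnion]
        exact ⟨u, hu, h, by simpa using hxw⟩
  have h1 : (⋃ r, win G (S r) y \ U).ncard ≤ ∑ r, (win G (S r) y \ U).ncard := by
    have := Set.ncard_iUnion_le_of_fintype fun r => win G (S r) y \ U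
    simpa using this
  have h2 : (⋃ u ∈ U, (low G σ u \ ⋃ r, win G (S r) y)).ncard ≤
      ∑ u ∈ U, (1 + ∑ r, weight (S r) u) :=
    (Finset.set_ncard_biUnion_le U _).trans (Finset.sum_le_sum hext)
  have h3 : ∑ r, ((win G (S r) y \ U).ncard + ∑ u ∈ U, weight (S r) u) ≤ ∑ _r : Fin 4, 9 :=
    Finset.sum_le_sum fun r _ => ncard_win_diff_add_weight (hS r) (hy r) U fun u hu => hU u hu r
  rw [Finset.sum_add_distrib] at h2 h3
  rw [Finset.sum_comm (s := U)] at h2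
  have h4 := Set.ncard_le_ncard hcover (Set.toFinite _)
  have h5 := Set.ncard_union_le (D ∪ (⋃ r, win G (S r) y \ U))
    (U ∪ ⋃ u ∈ U, (low G σ u \ ⋃ r, win G (S r) y))
  have h6 := Set.ncard_union_le D (⋃ r, win G (S r) y \ U)
  have h7 := Set.ncard_union_le (U : Set V) (⋃ u ∈ U, (low G σ u \ ⋃ r, win G (S r) y))
  rw [Set.ncard_coe_finset] at h7
  simp only [Finset.sum_const, Finset.card_univ, Fintype.card_fin, smul_eq_mul, mul_one] at h2 h3
  omega


theorem low_mem_win (hn : n.All (Good G f)) (hg : Good G f n) (ho : OrdAt G σ n) (hz : z ∈ n.body)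
    (hK : K ⊆ n.region) (ha : a ≤ 3) (ht : Trek G K z y a) (hx : x ∈ low G σ z) :
    x ∈ win G n y ∨ x ∈ win G n.L y ∨ x ∈ win G n.O y := by
  rcases low_subset hn hg ho hz hx with h | h | h
  · exact .inl (mem_win_of_adj hK h.2.1 hx.1 hz.2 ha ht)
  · exact .inr (.inl (mem_win_of_adj (hK.trans (region_subset_L hn)) h.1 hx.1
      (region_subset_L hn hz.2) ha ht))
  · exact .inr (.inr (mem_win_of_adj (hK.trans (region_subset_O hn)) h.1 hx.1
      (region_subset_O hn hz.2) ha ht))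

theorem low_mem_win_of_X (hn : n.All (fun m => Good G f m ∧ OrdAt G σ m)) (hg : Good G f n) :
    ∃ F, (F = n.O.L ∨ F = n.O.O) ∧ ∀ z ∈ n.X, ∀ y a, a ≤ 3 → Trek G n.region z y a →
      ∀ x ∈ low G σ z, x ∈ win G n.O y ∨ x ∈ win G F y := by
  have hn' := hn.mono (Q := Good G f) fun _ h => h.1
  have hK := region_subset_O hn'
  have base : ∀ z ∈ n.X, ∀ y a, a ≤ 3 → Trek G n.region z y a → ∀ x ∈ low G σ z,
      x ∈ win G n.O y ∨ (x ∈ n.O.mid ∧ x ∈ win G n.O.L y) ∨ (x ∈ n.O.X ∧ x ∈ win G n.O.O y) := by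
    intro z hz y a ha ht x hx
    have hzb := hg.X_sub hz
    have hA := hn.right.self_of_mem hzb.1
    have hsub := region_subset_L hn'.right
    have hsub' := region_subset_O hn'.right
    rcases low_cases hA.2 hzb hx.2 with h | h
    · exact .inl (mem_win_of_adj hK h.1 hx.1 hzb.2 ha ht)
    · rcases hA.1.bdry z x hzb.2 h hx.1.symm with h | h | h | h
      · exact .inl (mem_win_of_adj hK ⟨_, h⟩ hx.1 hzb.2 ha ht)
      · exact .inl (mem_win_of_adj hK ⟨_, h⟩ hx.1 hzb.2 ha ht)
      · exact .inr (.inl ⟨h, mem_win_of_adj (hK.trans hsub)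
          (mid_subset_body hn'.right.left h).1 hx.1 (hsub hzb.2) ha ht⟩)
      · exact .inr (.inr ⟨h, mem_win_of_adj (hK.trans hsub')
          (hA.1.X_sub h).1 hx.1 (hsub' hzb.2) ha ht⟩)
  rcases hg.oneSided with h | h
  · refine ⟨_, .inr rfl, fun z hz y a ha ht x hx => ?_⟩
    rcases base z hz y a ha ht x hx with h1 | ⟨h1, -⟩ | ⟨-, h1⟩
    · exact .inl h1
    · exact absurd hx.1.symm (h z hz x h1)
    · exact .inr h1
  · refine ⟨_, .inl rfl, fun z hz y a ha ht x hx => ?_⟩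
    rcases base z hz y a ha ht x hx with h1 | ⟨-, h1⟩ | ⟨h1, -⟩
    · exact .inl h1
    · exact .inr h1
    · exact absurd hx.1.symm (h z hz x h1)

theorem weight_pole (h : u ∈ S.clSet) (h' : u ∉ S.region) : weight S u = 2 := by
  simp [weight, h, h']

theorem weight_body (h : u ∈ S.body) : weight S u = 1 := by
  simp [weight, h.1, h.2]

/-- The ends of the path of `n.L` outside its region that are close to `y`. -/
def nearPoles (G : SimpleGraph V) (n : PNode V) (y : V) : Set V :=
  {u | u ∈ n.L.clSet ∧ u ∉ n.L.region ∧ ∃ a ≤ 3, Trek G n.region u y a}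

theorem nearPoles_ends (hn : n.All (Good G f)) (hy : y ∈ n.body) (hu : u ∈ nearPoles G n y) :
    (n.At 0 u ∨ n.At n.len u) ∧ u ∉ n.region := by
  have hg := hn.self_of_mem hy.1
  obtain ⟨h1, h2, a, ha, ht⟩ := hu
  have hur := hg.disj_L h1
  obtain ⟨w, hw, hwu⟩ := ht.exists_adj hur hy.2
  rcases hg.bdry w u hw hur hwu with h | h | h | h
  · exact ⟨.inl h, hur⟩
  · exact ⟨.inr h, hur⟩
  · exact absurd (mid_subset_body hn.left h).2 h2
  · exact absurd h1 (hg.disj_X _ h)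

theorem ncard_own_add_nearPoles [Finite V] (hn : n.All (fun m => Good G f m ∧ OrdAt G σ m))
    (hf : ¬ f) (hy : y ∈ n.body) : (own G σ n y).ncard + 2 * (nearPoles G n y).ncard ≤ 7 := by
  have hn' := hn.mono (Q := Good G f) fun _ h => h.1
  have hs := hn.self_of_mem hy.1
  have hsw : ¬ n.sw := fun h => hf (hs.1.swap.1 h).1
  by_cases h0 : ∃ u ∈ nearPoles G n y, n.At 0 u
  · obtain ⟨u, hu, hu0⟩ := h0
    have hur := (nearPoles_ends hn' hy hu).2
    obtain ⟨-, -, a, ha, ht⟩ := hu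
    have h1 := ncard_own_le_of_start hs.1 hs.2 hsw hy hu0 hur ha ht
    have h2 : (nearPoles G n y).ncard ≤ 2 := by
      obtain ⟨v, hv⟩ := at_total hu0 (le_refl n.len)
      refine (Set.ncard_le_ncard (t := {u, v}) (fun w hw => ?_) (Set.toFinite _)).trans
        ((Set.ncard_insert_le u {v}).trans (by simp))
      rcases (nearPoles_ends hn' hy hw).1 with h | h
      · exact .inl (at_fun h hu0)
      · exact .inr (at_fun h hv)
    omega
  · have h1 := ncard_own_le hs.1 hs.2 hsw hy
    have h2 : (nearPoles G n y).ncard ≤ 1 := by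
      refine ncard_le_one_of_forall_eq fun u hu v hv => ?_
      rcases (nearPoles_ends hn' hy hu).1 with h | h
      · exact absurd ⟨u, hu, h⟩ h0
      · rcases (nearPoles_ends hn' hy hv).1 with h' | h'
        · exact absurd ⟨v, hv, h'⟩ h0
        · exact at_fun h h'
    omega

theorem ncard_subReach_le_aux [Finite V] (hn : n.All (fun m => Good G f m ∧ OrdAt G σ m))
    (hf : ¬ f) (hσ : Function.Injective σ) (hy : y ∈ n.body) (S : Fin 4 → PNode V)
    (hS : ∀ r, (S r).All (Good G f)) (hK : ∀ r, n.region ⊆ (S r).region)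
    (hL : ∃ r, S r = n.L) (hO : ∃ r, S r = n.O)
    (hbody : ∀ z ∈ n.L.body, ∀ a ≤ 3, Trek G n.region z y a →
      ∀ x ∈ low G σ z, x ∈ ⋃ r, win G (S r) y)
    (hX : ∀ z ∈ n.X, ∀ a ≤ 3, Trek G n.region z y a →
      ∀ x ∈ low G σ z, x ∈ ⋃ r, win G (S r) y)
    (hext : ∀ u ∈ nearPoles G n y,
      (low G σ u \ ⋃ r, win G (S r) y).ncard ≤ 1 + ∑ r, weight (S r) u) :
    (SubReach G σ 4 y).ncard ≤ 43 := by
  classical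
  have hn' := hn.mono (Q := Good G f) fun _ h => h.1
  have hs := hn.self_of_mem hy.1
  have hfin : (nearPoles G n y).Finite := Set.toFinite _
  refine ncard_le_of_windows (D := own G σ n y) (σ := σ) S hS (fun r => hK r hy.2) hfin.toFinset
    ?_ ?_ ?_ ?_
  · intro u hu r
    rw [Set.Finite.mem_toFinset] at hu
    obtain ⟨-, -, a, ha, ht⟩ := hu
    exact ⟨a, ha, ht.mono (hK r)⟩
  · intro u hu
    rw [Set.Finite.mem_toFinset] at hu
    exact hext u hu
  · intro x hx
    rcases subReach_cases hs.2 hσ hy hx with h | ⟨h, a, ha, ht⟩ | ⟨z, hz, hxz, hlt, a, ha, ht⟩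
    · exact .inl (.inl h)
    · refine .inl (.inr ?_)
      obtain ⟨w, hw, hwx⟩ := ht.exists_adj h hy.2
      rcases hs.1.mem_of_bdry hn'.left hw h hwx with h1 | h1
      · obtain ⟨r, hr⟩ := hL
        exact Set.mem_iUnion.2 ⟨r, hr ▸ h1, a, ha, ht.mono (hK r)⟩
      · obtain ⟨r, hr⟩ := hO
        exact Set.mem_iUnion.2 ⟨r, hr ▸ (hs.1.X_sub h1).1, a, ha, ht.mono (hK r)⟩
    · have ht := ht.mono (K' := n.region) fun _ h => h.1
      obtain ⟨w, hw, hwz⟩ := ht.exists_adj hz hy.2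
      rcases hs.1.mem_of_bdry hn'.left hw hz hwz with h1 | h1
      · rcases mem_body_or_pole h1 with h2 | h2
        · exact .inl (.inr (hbody z h2 a ha ht x ⟨hxz, hlt⟩))
        · refine .inr ?_
          simp only [Set.mem_iUnion, Set.Finite.mem_toFinset]
          exact ⟨z, ⟨h1, h2, a, ha, ht⟩, hxz, hlt⟩
      · exact .inl (.inr (hX z h1 a ha ht x ⟨hxz, hlt⟩))
  · rw [← Set.ncard_eq_toFinset_card _ hfin]
    exact ncard_own_add_nearPoles hn hf hy

theorem ncard_subReach_le_forty_three [Finite V]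
    (hn : n.All (fun m => Good G f m ∧ OrdAt G σ m))
    (hf : ¬ f) (hσ : Function.Injective σ) (hy : y ∈ n.body) :
    (SubReach G σ 4 y).ncard ≤ 43 := by
  have hn' := hn.mono (Q := Good G f) fun _ h => h.1
  have hs := hn.self_of_mem hy.1
  have hP : ∀ m, (Good G f m ∧ OrdAt G σ m) → Good G f m := fun _ h => h.1
  have hKL := region_subset_L hn'
  have hKO := region_subset_O hn'
  have hle : ∀ u, (low G σ u).ncard ≤ 7 ∨ ∀ S : PNode V,
      S.All (fun m => Good G f m ∧ OrdAt G σ m) → u ∉ S.clSet := by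
    intro u
    by_cases h : ∃ S : PNode V, S.All (fun m => Good G f m ∧ OrdAt G σ m) ∧ u ∈ S.clSet
    · obtain ⟨S, hS, hu⟩ := h
      obtain ⟨h, hh, hub⟩ := exists_home hP hS hu
      exact .inl (ncard_low_le hh hf hub)
    · push Not at h
      exact .inr h
  have mono : ∀ {s t : Set V} {c : ℕ}, t.ncard ≤ c → s ⊆ t → s.ncard ≤ c := fun h1 h2 =>
    (Set.ncard_le_ncard h2 (Set.toFinite _)).trans h1
  rcases hs.1.kind with ⟨hk, -⟩ | ⟨hk, -⟩
  · obtain ⟨F, hF, hFw⟩ := low_mem_win_of_X hn hs.1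
    refine ncard_subReach_le_aux hn hf hσ hy ![n.L, n.L.L, n.O, F] ?_ ?_ ⟨0, rfl⟩ ⟨2, rfl⟩
      ?_ ?_ ?_
    · intro r
      fin_cases r
      · exact hn'.left
      · exact hn'.left.left
      · exact hn'.right
      · rcases hF with rfl | rfl
        · exact hn'.right.left
        · exact hn'.right.right
    · intro r
      fin_cases r
      · exact hKL
      · exact hKL.trans (region_subset_L hn'.left)
      · exact hKO
      · rcases hF with rfl | rfl
        · exact hKO.trans (region_subset_L hn'.right)
        · exact hKO.trans (region_subset_O hn'.right)
    · intro z hz a ha ht x hx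
      have hB := hn.left.self_of_mem hz.1
      rcases low_mem_win hn'.left hB.1 hB.2 hz hKL ha ht hx with h | h | h
      · exact Set.mem_iUnion.2 ⟨0, h⟩
      · exact Set.mem_iUnion.2 ⟨1, h⟩
      · exact Set.mem_iUnion.2 ⟨2, hk ▸ h⟩
    · intro z hz a ha ht x hx
      rcases hFw z hz y a ha ht x hx with h | h
      · exact Set.mem_iUnion.2 ⟨2, h⟩
      · exact Set.mem_iUnion.2 ⟨3, h⟩
    · rintro u ⟨huB, huB', a, ha, ht⟩
      have hB := hn.left.self_of_mem huB
      have huC : u ∈ n.L.L.clSet := by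
        obtain ⟨k, hk⟩ := huB
        exact hB.1.pole k u hk huB'
      have hC := hn.left.left.self_of_mem huC
      have hsum : ∑ r, weight (![n.L, n.L.L, n.O, F] r) u =
          2 + weight n.L.L u + weight n.O u + weight F u := by
        rw [Fin.sum_univ_four, ← weight_pole huB huB']
        rfl
      have hmemO : ∀ x ∈ low G σ u, u ∈ n.O.region → x ∈ n.O.clSet →
          x ∈ ⋃ r, win G ((![n.L, n.L.L, n.O, F] : Fin 4 → PNode V) r) y := fun x hx hu hxO =>
        Set.mem_iUnion.2 ⟨2, mem_win_of_adj hKO hxO hx.1 hu ha ht⟩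
      have hA : n.O = n.L.L.L ∨ n.O = n.L.L.O := by
        rcases hB.1.kind with ⟨h, -⟩ | ⟨h, -⟩
        · exact .inr (hk.trans h)
        · exact .inl (hk.trans h)
      rw [hsum]
      have h7 := (hle u).resolve_right fun h => h _ hn.left huB
      by_cases huC' : u ∈ n.L.L.region
      · rw [weight_body ⟨huC, huC'⟩]
        have h3 := (ncard_low_diff_parent_le hn.left.left hf ⟨huC, huC'⟩ hA).2
        refine (mono h3 ?_).trans (by omega)
        rintro x ⟨hx, hx'⟩
        refine ⟨hx, fun h => hx' ?_⟩
        rcases h with h | h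
        · exact Set.mem_iUnion.2 ⟨1, mem_win_of_adj
            (hKL.trans (region_subset_L hn'.left)) h hx.1 huC' ha ht⟩
        · refine hmemO x hx ?_ h
          rcases hA with h | h
          · rw [h]
            exact region_subset_L hn'.left.left huC'
          · rw [h]
            exact region_subset_O hn'.left.left huC'
      · rw [weight_pole huC huC']
        by_cases huA : u ∈ n.O.clSet
        · by_cases huA' : u ∈ n.O.region
          · rw [weight_body ⟨huA, huA'⟩]
            have h6 := ncard_low_diff_self_le hn.right ⟨huA, huA'⟩
            refine (mono h6 ?_).trans (by omega)
            rintro x ⟨hx, hx'⟩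
            exact ⟨hx, fun h => hx' (hmemO x hx huA' h)⟩
          · rw [weight_pole huA huA']
            exact (mono h7 Set.sdiff_subset).trans (by omega)
        · obtain ⟨h, hh, hub, hhA⟩ := exists_home_parent hP hn.left.left huC hA huA
          have hh' := hh.mono hP
          have h4 := (ncard_low_diff_parent_le hh hf hub hhA).1
          refine (mono h4 ?_).trans (by omega)
          rintro x ⟨hx, hx'⟩
          refine ⟨hx, fun h => hx' (hmemO x hx ?_ h)⟩
          rcases hhA with h | h
          · rw [h]
            exact region_subset_L hh' hub.2
          · rw [h]
            exact region_subset_O hh' hub.2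
  · have hKOL := hKO.trans (region_subset_L hn'.right)
    refine ncard_subReach_le_aux hn hf hσ hy ![n.L, n.O, n.O.L, n.O.O] ?_ ?_ ⟨0, rfl⟩ ⟨1, rfl⟩
      ?_ ?_ ?_
    · intro r
      fin_cases r
      · exact hn'.left
      · exact hn'.right
      · exact hn'.right.left
      · exact hn'.right.right
    · intro r
      fin_cases r
      · exact hKL
      · exact hKO
      · exact hKOL
      · exact hKO.trans (region_subset_O hn'.right)
    · intro z hz a ha ht x hx
      have hB := hn.left.self_of_mem hz.1
      rcases low_mem_win hn'.left hB.1 hB.2 hz hKL ha ht hx with h | h | h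
      · exact Set.mem_iUnion.2 ⟨0, h⟩
      · exact Set.mem_iUnion.2 ⟨1, hk ▸ h⟩
      · rcases hB.1.kind with ⟨h', -⟩ | ⟨h', -⟩
        · rw [h', ← hk] at h
          exact Set.mem_iUnion.2 ⟨3, h⟩
        · rw [h', ← hk] at h
          exact Set.mem_iUnion.2 ⟨2, h⟩
    · intro z hz a ha ht x hx
      have hzb := hs.1.X_sub hz
      have hA := hn.right.self_of_mem hzb.1
      rcases low_mem_win hn'.right hA.1 hA.2 hzb hKO ha ht hx with h | h | h
      · exact Set.mem_iUnion.2 ⟨1, h⟩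
      · exact Set.mem_iUnion.2 ⟨2, h⟩
      · exact Set.mem_iUnion.2 ⟨3, h⟩
    · rintro u ⟨huB, huB', a, ha, ht⟩
      have hB := hn.left.self_of_mem huB
      have huA : u ∈ n.O.clSet := by
        obtain ⟨k, hk'⟩ := huB
        rw [hk]
        exact hB.1.pole k u hk' huB'
      have hA := hn.right.self_of_mem huA
      have hsum : ∑ r, weight (![n.L, n.O, n.O.L, n.O.O] r) u =
          2 + weight n.O u + weight n.O.L u + weight n.O.O u := by
        rw [Fin.sum_univ_four, ← weight_pole huB huB']
        rfl
      rw [hsum]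
      have h7 := (hle u).resolve_right fun h => h _ hn.left huB
      by_cases huA' : u ∈ n.O.region
      · have h0 : low G σ u \ (⋃ r, win G ((![n.L, n.O, n.O.L, n.O.O] : Fin 4 → PNode V) r) y)
            = ∅ := by
          rw [Set.sdiff_eq_empty]
          intro x hx
          rcases low_mem_win hn'.right hA.1 hA.2 ⟨huA, huA'⟩ hKO ha ht hx with h | h | h
          · exact Set.mem_iUnion.2 ⟨1, h⟩
          · exact Set.mem_iUnion.2 ⟨2, h⟩
          · exact Set.mem_iUnion.2 ⟨3, h⟩
        rw [h0, Set.ncard_empty]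
        omega
      · rw [weight_pole huA huA']
        have huD : u ∈ n.O.L.clSet := by
          obtain ⟨k, hk'⟩ := huA
          exact hA.1.pole k u hk' huA'
        by_cases huD' : u ∈ n.O.L.region
        · rw [weight_body ⟨huD, huD'⟩]
          have h6 := ncard_low_diff_self_le hn.right.left ⟨huD, huD'⟩
          refine (mono h6 ?_).trans (by omega)
          rintro x ⟨hx, hx'⟩
          exact ⟨hx, fun h => hx' (Set.mem_iUnion.2 ⟨2, mem_win_of_adj hKOL h hx.1 huD' ha ht⟩)⟩
        · rw [weight_pole huD huD']
          exact (mono h7 Set.sdiff_subset).trans (by omega)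

end PlanarOrder

namespace PlanarOrder
open PNode

variable {V : Type} {G : SimpleGraph V} {n m S A h : PNode V} {i j k a b g d : ℕ}
  {u v w x y z p q : V} {f : Prop} {K Y C : Set V} {σ : V → ℕ}

theorem rk_of_sw (h : n.sw) (k : ℕ) :
    n.rk k = if k + 1 = n.len then k - 1 else if k + 2 = n.len then k + 1 else k := by
  simp [rk, h]

/-- The indices of the inner vertices of a swapped path. -/
theorem Good.index_of_sw (hn : Good G f n) (hsw : n.sw) (hi : n.At i x) (hx : x ∈ n.region) :
    0 < i ∧ i < n.len := by
  obtain ⟨-, -, v, hv, hvr⟩ := hn.swap.1 hsw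
  obtain ⟨u, hu⟩ := at_total hi (Nat.zero_le n.len)
  have hur := (hn.start u v hu hv hvr).1
  have h1 := at_le hi
  refine ⟨Nat.pos_of_ne_zero ?_, lt_of_le_of_ne h1 ?_⟩
  · rintro rfl
    exact hur (at_fun hu hi ▸ hx)
  · rintro rfl
    exact hvr (at_fun hv hi ▸ hx)

theorem own_index_of_girth (hn : Good G f n) (ho : OrdAt G σ n) (hg : (9 : ℕ∞) ≤ G.egirth)
    (hj : n.At j y) (hy : y ∈ n.region) (hx : x ∈ own G σ n y) (hi : n.At i x) :
    n.rk i ≤ n.rk j ∧ (i + 2 ≤ j → n.rk j ≤ n.rk (i + 2)) := by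
  obtain ⟨hb, hle, P, hP, hl, hK, hge⟩ := hx
  refine ⟨ho.rk_le hi hj hb.2 hy hle, fun hij => ?_⟩
  have h2 := hn.iso i j x y y _ 0 hy hi hj (trek_of_walk hK) .refl
  obtain ⟨W, hW, hWl, -, hWat⟩ := hn.exists_segment hi hj (by omega)
  have hPW : P = W := by
    by_contra hne
    have := le_length_add_length_of_ne (g := 9) hg hP hW hne
    omega
  subst hPW
  exact ho.rk_le hj (hWat 2 (by omega)) hy (hK 2 (by omega) (by omega))
    (hge 2 le_rfl (by omega))

theorem ncard_own_le_three_of_not_sw [Finite V] (hn : Good G f n) (ho : OrdAt G σ n)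
    (hg : (9 : ℕ∞) ≤ G.egirth) (hy : y ∈ n.body) (hsw : ¬ n.sw) : (own G σ n y).ncard ≤ 3 := by
  obtain ⟨⟨j, hj⟩, hy⟩ := hy
  refine (ncard_le_of_index (S := n) (a := j - 2) (b := j + 1) (fun x hx => hx.1.1) ?_).trans
    (by omega)
  intro k p hp hk
  have h1 := own_index_of_girth hn ho hg hj hy hp hk
  simp only [rk_of_not_sw hsw] at h1
  omega

theorem ncard_own_le_four [Finite V] (hn : Good G f n) (ho : OrdAt G σ n)
    (hg : (9 : ℕ∞) ≤ G.egirth) (hj : n.At j y) (hy : y ∈ n.region) :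
    (own G σ n y).ncard ≤ 4 ∧ (¬ (n.sw ∧ j + 2 = n.len) → (own G σ n y).ncard ≤ 3) := by
  by_cases hsw : n.sw
  swap
  · have := ncard_own_le_three_of_not_sw hn ho hg ⟨⟨j, hj⟩, hy⟩ hsw
    exact ⟨by omega, fun _ => this⟩
  have hjl := hn.index_of_sw hsw hj hy
  have key : ∀ k p, p ∈ own G σ n y → n.At k p →
      (j + 2 = n.len → n.len ≤ k + 4 ∧ k < n.len) ∧
      (j + 1 = n.len → k = j ∨ n.len ≤ k + 4 ∧ k + 2 < n.len) ∧
      (j + 2 < n.len → j ≤ k + 2 ∧ k ≤ j) := by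
    intro k p hp hk
    have h1 := own_index_of_girth hn ho hg hj hy hp hk
    have h2 := hn.index_of_sw hsw hk hp.1.2
    simp only [rk_of_sw hsw] at h1
    refine ⟨fun h => ?_, fun h => ?_, fun h => ?_⟩
    all_goals
      split_ifs at h1 <;> omega
  rcases (show j + 2 = n.len ∨ j + 1 = n.len ∨ j + 2 < n.len by omega) with h | h | h
  · refine ⟨(ncard_le_of_index (S := n) (a := n.len - 4) (b := n.len) (fun x hx => hx.1.1)
      fun k p hp hk => ?_).trans (by omega), fun h' => absurd ⟨hsw, h⟩ h'⟩
    have := (key k p hp hk).1 h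
    omega
  · have : (own G σ n y).ncard ≤ 1 + 2 := by
      refine ncard_le_add_of_subset (t := {y}) (r := own G σ n y \ {y}) ?_ (by simp) ?_
      · intro x hx
        by_cases hxy : x = y
        · exact .inl hxy
        · exact .inr ⟨hx, hxy⟩
      · refine (ncard_le_of_index (S := n) (a := n.len - 4) (b := n.len - 2)
          (fun x hx => hx.1.1.1) fun k p hp hk => ?_).trans (by omega)
        have h1 := (key k p hp.1 hk).2.1 h
        have : k ≠ j := by
          rintro rfl
          exact hp.2 (at_fun hk hj)
        omega
    exact ⟨by omega, fun _ => this⟩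
  · have : (own G σ n y).ncard ≤ 3 := by
      refine (ncard_le_of_index (S := n) (a := j - 2) (b := j + 1) (fun x hx => hx.1.1)
        fun k p hp hk => ?_).trans (by omega)
      have := (key k p hp hk).2.2 h
      omega
    exact ⟨by omega, fun _ => this⟩

theorem ncard_contacts_parent_le [Finite V] (hn : n.All (Good G f)) (hg : (g : ℕ∞) ≤ G.egirth)
    (hA : A = n.L ∨ A = n.O) (hy : y ∈ n.region) (hd : 2 * d < g) :
    (contacts G A n.region y d).ncard ≤ 2 * d / (g - 2 * d) + 1 := by
  rcases (contacts G A n.region y d).eq_empty_or_nonempty with h | ⟨p, hp⟩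
  · simp [h]
  rcases hA with rfl | rfl
  · exact ncard_contacts_le_of_girth (hn.left.self_of_mem hp.1) hg (region_subset_L hn)
      (fun v hv hv' => (disj_of_all hn hv').1 hv) (region_subset_L hn hy) hd
  · exact ncard_contacts_le_of_girth (hn.right.self_of_mem hp.1) hg (region_subset_O hn)
      (fun v hv hv' => (disj_of_all hn hv').2 hv) (region_subset_O hn hy) hd

theorem low_cover (hn : n.All (Good G f)) (hg : Good G f n) (ho : OrdAt G σ n) (hz : z ∈ n.body)
    (hx : x ∈ low G σ z) : x ∈ n.body ∨ x ∉ n.region ∧ x ∈ n.L.clSet ∨ x ∈ n.X := by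
  rcases low_cases ho hz hx.2 with hb | hb
  · exact .inl hb
  · rcases hg.mem_of_bdry hn.left hz.2 hb hx.1.symm with h | h
    · exact .inr (.inl ⟨hb, h⟩)
    · exact .inr (.inr h)

/-- The vertices outside the region from which a vertex is reached. -/
theorem subReach_cover (hn : n.All (Good G f)) (hg : Good G f n) (ho : OrdAt G σ n)
    (hσ : Function.Injective σ) (hy : y ∈ n.body) (hx : x ∈ SubReach G σ 4 y) :
    x ∈ own G σ n y ∨ x ∈ contacts G n.L n.region y 4 ∨ x ∈ contacts G n.O n.region y 4 ∨
    (∃ z ∈ n.L.clSet, (∃ a ≤ 3, Trek G (later n σ y) z y a) ∧ x ∈ low G σ z) ∨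
    (∃ z ∈ n.X, z ∈ contacts G n.O n.region y 3 ∧ x ∈ low G σ z) := by
  rcases subReach_cases ho hσ hy hx with h | ⟨h, a, ha, ht⟩ | ⟨z, hz, hxz, hlt, a, ha, ht⟩
  · exact .inl h
  · obtain ⟨w, hw, hwx⟩ := ht.exists_adj h hy.2
    rcases hg.mem_of_bdry hn.left hw h hwx with h1 | h1
    · exact .inr (.inl ⟨h1, a, ha, ht⟩)
    · exact .inr (.inr (.inl ⟨(hg.X_sub h1).1, a, ha, ht⟩))
  · have ht' := ht.mono (K' := n.region) fun _ h => h.1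
    obtain ⟨w, hw, hwz⟩ := ht'.exists_adj hz hy.2
    rcases hg.mem_of_bdry hn.left hw hz hwz with h1 | h1
    · exact .inr (.inr (.inr (.inl ⟨z, h1, ⟨a, ha, ht⟩, hxz, hlt⟩)))
    · exact .inr (.inr (.inr (.inr ⟨z, h1, ⟨(hg.X_sub h1).1, a, ha, ht'⟩, hxz, hlt⟩)))

theorem ncard_biUnion_le_mul [Finite V] (s : Set V) (F : V → Set V) {c t : ℕ} (hs : s.ncard ≤ t)
    (hF : ∀ v ∈ s, (F v).ncard ≤ c) : (⋃ v ∈ s, F v).ncard ≤ t * c := by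
  classical
  have hfin : s.Finite := Set.toFinite s
  have := Finset.set_ncard_biUnion_le hfin.toFinset F
  simp only [Set.Finite.mem_toFinset] at this
  refine this.trans ((Finset.sum_le_card_nsmul _ _ c fun v hv => hF v ?_).trans ?_)
  · simpa using hv
  · rw [← Set.ncard_eq_toFinset_card s hfin, smul_eq_mul]
    exact Nat.mul_le_mul_right c hs

theorem ncard_low_le_three [Finite V] (hn : n.All (fun m => Good G f m ∧ OrdAt G σ m)) (hf : ¬ f)
    (hg : (5 : ℕ∞) ≤ G.egirth) (hz : z ∈ n.body) : (low G σ z).ncard ≤ 3 := by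
  have hn' := hn.mono (Q := Good G f) fun _ h => h.1
  have hs := hn.self_of_mem hz.1
  refine ncard_le_add_of_subset (a := 1) (b := 2) (low_subset hn' hs.1 hs.2 hz)
    (ncard_low_body hs.1 hs.2 (fun h => hf (hs.1.swap.1 h).1) hz) ?_
  exact ncard_le_add_of_subset (a := 1) (b := 1) subset_rfl
    (ncard_contacts_parent_le (g := 5) (d := 1) hn' hg (.inl rfl) hz.2 (by norm_num))
    (ncard_contacts_parent_le (g := 5) (d := 1) hn' hg (.inr rfl) hz.2 (by norm_num))

theorem ncard_subReach_le_of_girth [Finite V] (hn : n.All (fun m => Good G f m ∧ OrdAt G σ m))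
    (hf : ¬ f) (hσ : Function.Injective σ) (h9 : 9 ≤ g) (hg : (g : ℕ∞) ≤ G.egirth)
    (hy : y ∈ n.body) :
    (SubReach G σ 4 y).ncard ≤ 3 + 2 * (8 / (g - 8) + 1) + 6 * (6 / (g - 6) + 1) := by
  have hn' := hn.mono (Q := Good G f) fun _ h => h.1
  have hs := hn.self_of_mem hy.1
  have hsw : ¬ n.sw := fun h => hf (hs.1.swap.1 h).1
  have h9' : (9 : ℕ∞) ≤ G.egirth := le_trans (by exact_mod_cast h9) hg
  have h5 : (5 : ℕ∞) ≤ G.egirth := le_trans (by norm_num) h9'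
  have hP : ∀ m, (Good G f m ∧ OrdAt G σ m) → Good G f m := fun _ h => h.1
  have hlow : ∀ S : PNode V, S.All (fun m => Good G f m ∧ OrdAt G σ m) →
      ∀ z ∈ contacts G S n.region y 3, (low G σ z).ncard ≤ 3 := by
    intro S hS z hz
    obtain ⟨h, hh, hzh⟩ := exists_home hP hS hz.1
    exact ncard_low_le_three hh hf h5 hzh
  have hown := ncard_own_le_three_of_not_sw hs.1 hs.2 h9' hy hsw
  have hT := fun A hA => ncard_contacts_parent_le (A := A) (d := 4) hn' hg hA hy.2 (by omega)
  have ht := fun A hA => ncard_contacts_parent_le (A := A) (d := 3) hn' hg hA hy.2 (by omega)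
  have hB := ncard_biUnion_le_mul _ (low G σ) (ht n.L (.inl rfl)) (hlow n.L hn.left)
  have hA := ncard_biUnion_le_mul _ (low G σ) (ht n.O (.inr rfl)) (hlow n.O hn.right)
  have := ncard_le_add_of_subset (s := SubReach G σ 4 y) (fun x hx => ?_) hown
    (ncard_le_add_of_subset subset_rfl (ncard_le_add_of_subset subset_rfl
      (hT n.L (.inl rfl)) (hT n.O (.inr rfl))) (ncard_le_add_of_subset subset_rfl hB hA))
  · norm_num at this ⊢
    omega
  · rcases subReach_cover hn' hs.1 hs.2 hσ hy hx with h | h | h | ⟨z, hz, ⟨a, ha, h⟩, hx⟩ |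
      ⟨z, hz, h, hx⟩
    · exact .inl h
    · exact .inr (.inl (.inl h))
    · exact .inr (.inl (.inr h))
    · refine .inr (.inr (.inl ?_))
      simp only [Set.mem_iUnion]
      exact ⟨z, ⟨hz, a, ha, h.mono fun _ h => h.1⟩, hx⟩
    · refine .inr (.inr (.inr ?_))
      simp only [Set.mem_iUnion]
      exact ⟨z, h, hx⟩

end PlanarOrder

namespace PlanarOrder
open PNode

variable {V : Type} {G : SimpleGraph V} {n m S A h : PNode V} {i j k a b g d : ℕ}
  {u v w x y z p q : V} {f : Prop} {K Y C : Set V} {σ : V → ℕ}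

theorem not_triangle (hg : (4 : ℕ∞) ≤ G.egirth) (h1 : G.Adj x y) (h2 : G.Adj y z)
    (h3 : G.Adj x z) : False := by
  have hP : (SimpleGraph.Walk.cons h3 .nil).IsPath := by simp [h3.ne]
  have hQ : (SimpleGraph.Walk.cons h1 (.cons h2 .nil)).IsPath := by
    simp [h1.ne, h2.ne, h3.ne]
  have := le_length_add_length_of_ne (g := 4) hg hP hQ (by
    intro h
    have := congrArg SimpleGraph.Walk.length h
    simp at this)
  simp at this

theorem low_body_index (hn : Good G f n) (ho : OrdAt G σ n) (hz : z ∈ n.region)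
    (hj : n.At j z) (hx : x ∈ low G σ z) (hxr : x ∈ n.region) (hi : n.At i x) :
    (i + 1 = j ∧ ¬ (n.sw ∧ j + 1 = n.len)) ∨ (n.sw ∧ j + 2 = n.len ∧ i + 1 = n.len) := by
  have h1 := hn.adj_index hi hj hz hx.1
  have h2 : i ≠ j := by
    rintro rfl
    exact hx.1.ne (at_fun hi hj)
  have h3 := ho.rk_le hi hj hxr hz hx.2.le
  by_cases hsw : n.sw
  · have h4 := hn.index_of_sw hsw hi hxr
    have h5 := hn.index_of_sw hsw hj hz
    simp only [rk_of_sw hsw] at h3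
    simp only [hsw, true_and]
    split_ifs at h3 <;> omega
  · simp only [rk_of_not_sw hsw] at h3
    simp only [hsw, false_and, not_false_eq_true, and_true, or_false]
    omega

/-- The last but one inner vertex of a swapped path has no lower neighbours off the path. -/
theorem low_eq_of_sw [Finite V] (hn : n.All (Good G f)) (hgn : Good G f n) (ho : OrdAt G σ n)
    (hg : (17 : ℕ∞) ≤ G.egirth) (hsw : n.sw) (hj : n.At j z) (hjl : j + 2 = n.len)
    (hz : z ∈ n.region) : low G σ z ⊆ n.body := by
  intro x hx
  obtain ⟨-, ⟨k, l, hk, hl, x', hx', hlx⟩, v, hv, hvr⟩ := hgn.swap.1 hsw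
  have hk' : k = j + 1 := by omega
  subst hk'
  have hlr : l ∈ n.region := hgn.inner _ l hl (by omega) (by omega)
  have hzl := hgn.adj _ _ _ hj hl
  have hlv := hgn.adj _ _ v hl (by rw [hk]; exact hv)
  have htrek : ∀ {p}, G.Adj p l → Trek G n.region p z 2 := fun h =>
    Trek.step (trek_one h hlr) hzl.symm hz
  have hone : ∀ A, A = n.L ∨ A = n.O → (contacts G A n.region z 2).Subsingleton := fun A hA => by
    have := ncard_contacts_parent_le (g := 17) (d := 2) hn hg hA hz (by norm_num)
    exact Set.ncard_le_one_iff_subsingleton.1 this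
  have hxc : ∀ {A : PNode V}, x ∈ A.clSet → x ∈ contacts G A n.region z 2 := fun h =>
    ⟨h, 1, by omega, trek_one hx.1 hz⟩
  rcases low_cover hn hgn ho ⟨⟨j, hj⟩, hz⟩ hx with h | ⟨-, h⟩ | h
  · exact h
  · have hvx : v = x := hone _ (.inl rfl)
      ⟨hgn.pole _ _ hv hvr, 2, le_rfl, htrek hlv.symm⟩ (hxc h)
    subst hvx
    have := hgn.adj_index hv hj hz hx.1
    omega
  · have hxx : x' = x := hone _ (.inr rfl)
      ⟨(hgn.X_sub hx').1, 2, le_rfl, htrek hlx.symm⟩ (hxc (hgn.X_sub h).1)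
    subst hxx
    exact (not_triangle (le_trans (by norm_num) hg) hlx.symm hzl.symm hx.1).elim

theorem ncard_low_body_le [Finite V] (hn : Good G f n) (ho : OrdAt G σ n) (hj : n.At j z)
    (hz : z ∈ n.region) : (low G σ z ∩ n.body).ncard ≤ 2 ∧
      (¬ (n.sw ∧ j + 2 = n.len) → (low G σ z ∩ n.body).ncard ≤ 1) := by
  have h1 : ¬ (n.sw ∧ j + 2 = n.len) → (low G σ z ∩ n.body).ncard ≤ 1 := by
    intro h
    refine ncard_le_one_of_forall_eq fun x hx x' hx' => ?_
    obtain ⟨hx, ⟨i, hi⟩, hxr⟩ := hx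
    obtain ⟨hx', ⟨i', hi'⟩, hxr'⟩ := hx'
    rcases low_body_index hn ho hz hj hx hxr hi with ⟨h1, -⟩ | h1
    · rcases low_body_index hn ho hz hj hx' hxr' hi' with ⟨h2, -⟩ | h2
      · obtain rfl : i = i' := by omega
        exact at_fun hi hi'
      · exact absurd ⟨h2.1, h2.2.1⟩ h
    · exact absurd ⟨h1.1, h1.2.1⟩ h
  refine ⟨?_, h1⟩
  by_cases h : n.sw ∧ j + 2 = n.len
  · obtain ⟨l, hl⟩ := at_total hj (show j + 1 ≤ n.len by omega)
    refine ncard_le_add_of_subset (t := {l}) (r := (low G σ z ∩ n.body) \ {l}) (a := 1) (b := 1)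
      ?_ (by simp) ?_
    · intro x hx
      by_cases hxl : x = l
      · exact .inl hxl
      · exact .inr ⟨hx, hxl⟩
    · have key : ∀ x ∈ (low G σ z ∩ n.body) \ {l}, n.At (j - 1) x := by
        rintro x ⟨⟨hx, ⟨i, hi⟩, hxr⟩, hxl⟩
        rcases low_body_index hn ho hz hj hx hxr hi with ⟨h1, -⟩ | h1
        · obtain rfl : i = j - 1 := by omega
          exact hi
        · obtain rfl : i = j + 1 := by omega
          exact absurd (at_fun hi hl) hxl
      exact ncard_le_one_of_forall_eq fun x hx x' hx' => at_fun (key x hx) (key x' hx')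
  · exact (h1 h).trans (by norm_num)

theorem ncard_low_inter_parent [Finite V] (hn : n.All (Good G f))
    (hg : (17 : ℕ∞) ≤ G.egirth) (hA : A = n.L ∨ A = n.O) (hz : z ∈ n.region) :
    (low G σ z ∩ A.clSet).ncard ≤ 1 := by
  refine (Set.ncard_le_ncard (fun x hx => ?_) (Set.toFinite _)).trans
    (ncard_contacts_parent_le (g := 17) (d := 1) hn hg hA hz (by norm_num))
  exact adj_mem_contacts hx.2 hx.1.1 hz

theorem ncard_low_le_swapped [Finite V] (hn : n.All (fun m => Good G f m ∧ OrdAt G σ m))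
    (hg : (17 : ℕ∞) ≤ G.egirth) (hz : z ∈ n.body) :
    (low G σ z).ncard ≤ 3 ∧
      ∀ A, A = n.L ∨ A = n.O → (low G σ z \ A.clSet).ncard ≤ 2 := by
  have hn' := hn.mono (Q := Good G f) fun _ h => h.1
  have hs := hn.self_of_mem hz.1
  obtain ⟨⟨j, hj⟩, hzr⟩ := id hz
  have hb := ncard_low_body_le hs.1 hs.2 hj hzr
  have hL := ncard_low_inter_parent (σ := σ) hn' hg (.inl rfl) hzr
  have hO := ncard_low_inter_parent (σ := σ) hn' hg (.inr rfl) hzr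
  by_cases h : n.sw ∧ j + 2 = n.len
  · have hsub := low_eq_of_sw hn' hs.1 hs.2 hg h.1 hj h.2 hzr
    rw [Set.inter_eq_left.2 hsub] at hb
    refine ⟨by omega, fun A _ => (Set.ncard_le_ncard Set.sdiff_subset (Set.toFinite _)).trans hb.1⟩
  · have hb := hb.2 h
    have hcov : low G σ z ⊆ (low G σ z ∩ n.body) ∪
        ((low G σ z ∩ n.L.clSet) ∪ (low G σ z ∩ n.O.clSet)) := by
      intro x hx
      rcases low_cover hn' hs.1 hs.2 hz hx with h | ⟨-, h⟩ | h
      · exact .inl ⟨hx, h⟩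
      · exact .inr (.inl ⟨hx, h⟩)
      · exact .inr (.inr ⟨hx, (hs.1.X_sub h).1⟩)
    refine ⟨ncard_le_add_of_subset hcov hb (ncard_le_add_of_subset subset_rfl hL hO), ?_⟩
    rintro A (rfl | rfl)
    · refine ncard_le_add_of_subset ?_ hb hO
      rintro x ⟨hx, hx'⟩
      rcases hcov hx with h | h | h
      · exact .inl h
      · exact absurd h.2 hx'
      · exact .inr h
    · refine ncard_le_add_of_subset ?_ hb hL
      rintro x ⟨hx, hx'⟩
      rcases hcov hx with h | h | h
      · exact .inl h
      · exact .inr h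
      · exact absurd h.2 hx'

theorem ncard_low_le_two_of_X [Finite V] (hn : n.All (fun m => Good G f m ∧ OrdAt G σ m))
    (hgn : Good G f n) (hf : f) (hg : (17 : ℕ∞) ≤ G.egirth) (hz : z ∈ n.X) :
    (low G σ z).ncard ≤ 2 := by
  have hn' := hn.mono (Q := Good G f) fun _ h => h.1
  have hzb := hgn.X_sub hz
  have hs := hn.right.self_of_mem hzb.1
  obtain ⟨⟨j, hj⟩, hzr⟩ := id hzb
  have hb := ncard_low_body_le hs.1 hs.2 hj hzr
  have hL := ncard_low_inter_parent (σ := σ) hn'.right hg (.inl rfl) hzr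
  have hO := ncard_low_inter_parent (σ := σ) hn'.right hg (.inr rfl) hzr
  have hcov := fun x => low_cover (x := x) hn'.right hs.1 hs.2 hzb
  by_cases h : n.O.sw ∧ j + 2 = n.O.len
  · have hsub := low_eq_of_sw hn'.right hs.1 hs.2 hg h.1 hj h.2 hzr
    rw [Set.inter_eq_left.2 hsub] at hb
    exact hb.1
  have hb := hb.2 h
  by_cases hXe : ∃ x ∈ low G σ z, x ∈ n.O.X
  swap
  · refine ncard_le_add_of_subset (fun x hx => ?_) hb hL
    rcases hcov x hx with h | ⟨-, h⟩ | h
    · exact .inl ⟨hx, h⟩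
    · exact .inr ⟨hx, h⟩
    · exact absurd ⟨x, hx, h⟩ hXe
  obtain ⟨x₀, hx₀, hx₀X⟩ := hXe
  have hmid := hgn.oneSided.resolve_right fun h => h z hz x₀ hx₀X hx₀.1.symm
  by_cases hLe : ∃ l ∈ low G σ z, l ∉ n.O.region ∧ l ∈ n.O.L.clSet
  swap
  · refine ncard_le_add_of_subset (fun x hx => ?_) hb hO
    rcases hcov x hx with h | h | h
    · exact .inl ⟨hx, h⟩
    · exact absurd ⟨x, hx, h⟩ hLe
    · exact .inr ⟨hx, (hs.1.X_sub h).1⟩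
  obtain ⟨l, hl, hlr, hlL⟩ := hLe
  have hnobody : ∀ x ∈ low G σ z, x ∉ n.O.body := by
    rintro x hx ⟨⟨i, hi⟩, hxr⟩
    have hidx := (low_body_index hs.1 hs.2 hzr hj hx hxr hi).resolve_right
      fun h' => h ⟨h'.1, h'.2.1⟩
    rcases hs.1.bdry z l hzr hlr hl.1.symm with h' | h' | h' | h'
    · have := hs.1.adj_index h' hj hzr hl.1
      obtain rfl : i = 0 := by omega
      exact hlr (at_fun hi h' ▸ hxr)
    · have h1 := hs.1.adj_index h' hj hzr hl.1
      have h2 := at_le hj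
      have h3 : j ≠ n.O.len := by
        rintro rfl
        exact hl.1.ne (at_fun h' hj)
      have h4 : j + 1 = n.O.len := by omega
      exact hidx.2 ⟨hs.1.swap.2 ⟨hf, ⟨j, z, h4, hj, x₀, hx₀X, hx₀.1.symm⟩, l, h', hlr⟩, h4⟩
    · exact hmid z hz l h' hl.1.symm
    · exact hs.1.disj_X l h' hlL
  refine ncard_le_add_of_subset (fun x hx => ?_) hL hO
  rcases hcov x hx with h | ⟨-, h⟩ | h
  · exact absurd h (hnobody x hx)
  · exact .inl ⟨hx, h⟩
  · exact .inr ⟨hx, (hs.1.X_sub h).1⟩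

/-- If `y` is reached from the path of `n.L` through later vertices, then it is not the last but
one inner vertex of a swapped path. -/
theorem not_swapped_of_trek [Finite V] (hn : n.All (Good G f)) (hgn : Good G f n)
    (ho : OrdAt G σ n) (hg : (17 : ℕ∞) ≤ G.egirth) (hj : n.At j y) (hy : y ∈ n.region)
    (hb : u ∈ n.L.clSet) (ha : a ≤ 3) (ht : Trek G (later n σ y) u y a) :
    ¬ (n.sw ∧ j + 2 = n.len) := by
  classical
  rintro ⟨hsw, hjl⟩
  obtain ⟨-, -, v, hv, hvr⟩ := hgn.swap.1 hsw
  obtain ⟨l, hl⟩ := at_total hj (show j + 1 ≤ n.len by omega)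
  have hlr : l ∈ n.region := hgn.inner _ l hl (by omega) (by omega)
  have hyl := hgn.adj _ _ _ hj hl
  have hlv := hgn.adj _ _ v hl (by rw [show j + 1 + 1 = n.len by omega]; exact hv)
  have hone := ncard_contacts_parent_le (g := 17) (d := 4) hn hg (.inl rfl) hy (by norm_num)
  have huv : u = v := Set.ncard_le_one_iff_subsingleton.1 hone
    ⟨hb, a, by omega, ht.mono fun _ h => h.1⟩
    ⟨hgn.pole _ _ hv hvr, 2, by omega, Trek.step (trek_one hlv.symm hlr) hyl.symm hy⟩
  subst huv
  have hlow : σ l < σ y := by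
    refine ho.rk_lt (j + 1) j l y hl hj hlr hy ?_
    rw [rk_of_sw hsw, rk_of_sw hsw, if_pos (by omega), if_neg (by omega), if_pos hjl]
    omega
  obtain ⟨W, hWl, hWe⟩ := ht.exists_walk
  have huy : u ≠ y := fun h => hvr (h ▸ hy)
  have hQ : (SimpleGraph.Walk.cons hlv.symm (.cons hyl.symm .nil)).IsPath := by
    simp [hlv.ne', hyl.ne', huy]
  have h1 := le_length_add_length_of_ne (g := 17) hg (SimpleGraph.Walk.bypass_isPath W) hQ (by
    intro h
    have he : s(u, l) ∈ W.bypass.edges := by simp [h]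
    obtain ⟨w, hw, hwe⟩ := hWe _ (SimpleGraph.Walk.edges_bypass_subset_edges _ he)
    rcases Sym2.mem_iff.1 hwe with rfl | rfl
    · exact hvr hw.1
    · exact absurd hw.2 (by omega))
  have h2 := SimpleGraph.Walk.length_bypass_le_length W
  simp at h1
  omega

theorem ncard_subReach_le_nine [Finite V] (hn : n.All (fun m => Good G f m ∧ OrdAt G σ m))
    (hf : f) (hσ : Function.Injective σ) (hg : (17 : ℕ∞) ≤ G.egirth) (hy : y ∈ n.body) :
    (SubReach G σ 4 y).ncard ≤ 9 := by
  have hn' := hn.mono (Q := Good G f) fun _ h => h.1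
  have hs := hn.self_of_mem hy.1
  have h9 : (9 : ℕ∞) ≤ G.egirth := le_trans (by norm_num) hg
  have hP : ∀ m, (Good G f m ∧ OrdAt G σ m) → Good G f m := fun _ h => h.1
  obtain ⟨⟨j, hj⟩, hyr⟩ := id hy
  have hown := ncard_own_le_four hs.1 hs.2 h9 hj hyr
  have hTB : (contacts G n.L n.region y 4).ncard ≤ 1 :=
    ncard_contacts_parent_le (g := 17) (d := 4) hn' hg (.inl rfl) hyr (by norm_num)
  have hTA : (contacts G n.O n.region y 4).ncard ≤ 1 :=
    ncard_contacts_parent_le (g := 17) (d := 4) hn' hg (.inr rfl) hyr (by norm_num)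
  have hTB' := Set.ncard_le_one_iff_subsingleton.1 hTB
  have hTA' := Set.ncard_le_one_iff_subsingleton.1 hTA
  have hXset : (⋃ z ∈ n.X ∩ contacts G n.O n.region y 3, low G σ z).ncard ≤ 1 * 2 := by
    refine ncard_biUnion_le_mul _ _ ?_ fun z hz => ncard_low_le_two_of_X hn hs.1 hf hg hz.1
    refine (Set.ncard_le_ncard (fun z hz => ?_) (Set.toFinite _)).trans hTA
    exact contacts_mono subset_rfl (by norm_num) hz.2
  have hcov := fun x => subReach_cover (x := x) hn' hs.1 hs.2 hσ hy
  by_cases hbex : ∃ b ∈ n.L.clSet, ∃ a ≤ 3, Trek G (later n σ y) b y a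
  swap
  · have := ncard_le_add_of_subset (s := SubReach G σ 4 y) (fun x hx => ?_) hown.1
      (ncard_le_add_of_subset subset_rfl hTB (ncard_le_add_of_subset subset_rfl hTA hXset))
    · omega
    · rcases hcov x hx with h | h | h | ⟨z, hz, h, -⟩ | ⟨z, hz, h, hx⟩
      · exact .inl h
      · exact .inr (.inl h)
      · exact .inr (.inr (.inl h))
      · exact absurd ⟨z, hz, h⟩ hbex
      · refine .inr (.inr (.inr ?_))
        simp only [Set.mem_iUnion]
        exact ⟨z, ⟨hz, h⟩, hx⟩
  obtain ⟨b, hbB, a, ha, ht⟩ := hbex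
  have hown := hown.2 (not_swapped_of_trek hn' hs.1 hs.2 hg hj hyr hbB ha ht)
  have ht' : Trek G n.region b y a := ht.mono fun _ h => h.1
  have hbT : b ∈ contacts G n.L n.region y 4 := ⟨hbB, a, by omega, ht'⟩
  have hz_eq : ∀ z ∈ n.L.clSet, (∃ a ≤ 3, Trek G (later n σ y) z y a) → z = b := by
    rintro z hz ⟨a', ha', hta⟩
    exact hTB' ⟨hz, a', by omega, hta.mono fun _ h => h.1⟩ hbT
  by_cases hbA : b ∈ n.O.clSet
  · have hbTA : b ∈ contacts G n.O n.region y 4 := ⟨hbA, a, by omega, ht'⟩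
    obtain ⟨h, hh, hbh⟩ := exists_home hP hn.left hbB
    have := ncard_le_add_of_subset (s := SubReach G σ 4 y) (fun x hx => ?_) hown
      (ncard_le_add_of_subset subset_rfl (Set.ncard_singleton b).le
        (ncard_low_le_swapped hh hg hbh).1)
    · omega
    · rcases hcov x hx with h | h | h | ⟨z, hz, h, hx⟩ | ⟨z, hz, h, -⟩
      · exact .inl h
      · exact .inr (.inl (hTB' h hbT))
      · exact .inr (.inl (hTA' h hbTA))
      · exact .inr (.inr (hz_eq z hz h ▸ hx))
      · have hzb : z = b := hTA' (contacts_mono subset_rfl (by norm_num) h) hbTA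
        exact absurd hbB (hs.1.disj_X b (hzb ▸ hz))
  · have hA : n.O = n.L.L ∨ n.O = n.L.O := by
      rcases hs.1.kind with ⟨h, -⟩ | ⟨h, -⟩
      · exact .inr h
      · exact .inl h
    obtain ⟨h, hh, hbh, hAh⟩ := exists_home_parent hP hn.left hbB hA hbA
    have hh' := hh.mono hP
    have hbr : b ∈ n.O.region := by
      rcases hAh with h1 | h1
      · rw [h1]
        exact region_subset_L hh' hbh.2
      · rw [h1]
        exact region_subset_O hh' hbh.2
    have hT : (contacts G n.O (n.region ∪ {b}) y 4).ncard ≤ 1 := by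
      rcases (contacts G n.O (n.region ∪ {b}) y 4).eq_empty_or_nonempty with h | ⟨p, hp⟩
      · rw [h, Set.ncard_empty]
        exact Nat.zero_le 1
      · refine ncard_contacts_le_of_girth (g := 17) (d := 4) (hn'.right.self_of_mem hp.1) hg
          (Set.union_subset (region_subset_O hn') (by simpa using hbr)) ?_
          (region_subset_O hn' hyr) (by norm_num)
        rintro v hv (hv' | rfl)
        · exact (disj_of_all hn' hv').2 hv
        · exact hbA hv
    have := ncard_le_add_of_subset (s := SubReach G σ 4 y) (fun x hx => ?_) hown
      (ncard_le_add_of_subset subset_rfl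
        (ncard_le_add_of_subset subset_rfl (Set.ncard_singleton b).le hT)
        (ncard_le_add_of_subset subset_rfl ((ncard_low_le_swapped hh hg hbh).2 _ hAh) hXset))
    · omega
    · rcases hcov x hx with h | h | h | ⟨z, hz, h, hx⟩ | ⟨z, hz, h, hx⟩
      · exact .inl h
      · exact .inr (.inl (.inl (hTB' h hbT)))
      · exact .inr (.inl (.inr (contacts_mono Set.subset_union_left le_rfl h)))
      · obtain rfl := hz_eq z hz h
        by_cases hxA : x ∈ n.O.clSet
        · exact .inr (.inl (.inr ⟨hxA, a + 1, by omega,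
            (ht'.mono Set.subset_union_left).cons hx.1 (.inr rfl)⟩))
        · exact .inr (.inr (.inl ⟨hx, hxA⟩))
      · refine .inr (.inr (.inr ?_))
        simp only [Set.mem_iUnion]
        exact ⟨z, ⟨hz, h⟩, hx⟩

end PlanarOrder

namespace PlanarOrder
open PNode

variable {V : Type} {G : SimpleGraph V}

theorem semiweak_le_of_noK33 [Fintype V] (hG : NoK33 G) (f : Prop) {c : ℕ}
    (h : ∀ (σ : V → ℕ) (n : PNode V) (y : V), n.All (fun m => Good G f m ∧ OrdAt G σ m) →
      Function.Injective σ → y ∈ n.body → (SubReach G σ 4 y).ncard ≤ c) :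
    semiweak G 4 ≤ c := by
  obtain ⟨σ, hσ, hn⟩ := exists_order hG f
  have hmem : semiweakOrd G σ 4 ∈ {n : ℕ | ∃ σ : V → ℕ, Function.Injective σ ∧
      semiweakOrd G σ 4 = n} := ⟨σ, hσ, rfl⟩
  refine (Nat.sInf_le hmem).trans (Finset.sup_le fun y _ => ?_)
  obtain ⟨n, h1, h2, hy⟩ := hn y
  exact h σ n y (h1.and h2) hσ hy

theorem semiweak_of_noK33 [Fintype V] (hG : NoK33 G) :
    semiweak G 4 ≤ 43 ∧
    ((10 : ℕ∞) ≤ G.egirth → semiweak G 4 ≤ 33) ∧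
    ((11 : ℕ∞) ≤ G.egirth → semiweak G 4 ≤ 23) ∧
    ((13 : ℕ∞) ≤ G.egirth → semiweak G 4 ≤ 18) ∧
    ((17 : ℕ∞) ≤ G.egirth → semiweak G 4 ≤ 9) := by
  refine ⟨?_, fun hg => ?_, fun hg => ?_, fun hg => ?_, fun hg => ?_⟩
  · exact semiweak_le_of_noK33 hG False fun σ n y hn hσ hy =>
      ncard_subReach_le_forty_three hn id hσ hy
  · exact semiweak_le_of_noK33 hG False fun σ n y hn hσ hy =>
      (ncard_subReach_le_of_girth (g := 10) hn id hσ (by norm_num) hg hy).trans (by norm_num)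
  · exact semiweak_le_of_noK33 hG False fun σ n y hn hσ hy =>
      (ncard_subReach_le_of_girth (g := 11) hn id hσ (by norm_num) hg hy).trans (by norm_num)
  · exact semiweak_le_of_noK33 hG False fun σ n y hn hσ hy =>
      (ncard_subReach_le_of_girth (g := 13) hn id hσ (by norm_num) hg hy).trans (by norm_num)
  · exact semiweak_le_of_noK33 hG True fun σ n y hn hσ hy =>
      ncard_subReach_le_nine hn trivial hσ hg hy

end PlanarOrder

namespace PlanarOrder

/-- The six directions of the triangular lattice. -/
def dir : Fin 6 → ℤ × ℤ := ![(1, 0), (0, 1), (-1, 1), (-1, 0), (0, -1), (1, -1)]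

/-- The six triangles around a lattice point; the `k`-th one lies between the directions `k` and
`k + 1`. -/
def tri (x : ℤ × ℤ) : Fin 6 → ℤ × ℤ × Bool :=
  ![(x.1, x.2, true), (x.1 - 1, x.2, false), (x.1 - 1, x.2, true), (x.1 - 1, x.2 - 1, false),
    (x.1, x.2 - 1, true), (x.1, x.2 - 1, false)]

/-- The triangular lattice. -/
def lattice : SimpleGraph (ℤ × ℤ) where
  Adj x y := ∃ k, y = x + dir k
  symm := ⟨by
    rintro x _ ⟨k, rfl⟩
    refine ⟨k + 3, ?_⟩
    fin_cases k <;> simp [dir, Prod.ext_iff]⟩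
  loopless := ⟨by
    rintro x ⟨k, hk⟩
    revert hk
    fin_cases k <;> simp [dir, Prod.ext_iff]⟩

theorem dir_rev (x : ℤ × ℤ) (k : Fin 6) : x + dir k + dir (k + 3) = x := by
  fin_cases k <;> simp [dir, Prod.ext_iff]

theorem rev_rev (k : Fin 6) : k + 3 + 3 = k := by
  fin_cases k <;> rfl

/-- The difference of `ψ` across the edge leaving `x` in direction `k`. -/
def jump (ψ : ℤ × ℤ × Bool → ZMod 2) (x : ℤ × ℤ) (k : Fin 6) : ZMod 2 :=
  ψ (tri x k) + ψ (tri x (k + 5))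

theorem jump_rev (ψ : ℤ × ℤ × Bool → ZMod 2) (x : ℤ × ℤ) (k : Fin 6) :
    jump ψ (x + dir k) (k + 3) = jump ψ x k := by
  rw [jump, jump, add_comm]
  congr 2
  all_goals fin_cases k <;> simp [dir, tri, sub_eq_add_neg]

theorem sum_jump (ψ : ℤ × ℤ × Bool → ZMod 2) (x : ℤ × ℤ) : ∑ k, jump ψ x k = 0 := by
  simp only [jump, Finset.sum_add_distrib]
  rw [Fintype.sum_equiv (Equiv.addRight (5 : Fin 6)) (fun k => ψ (tri x (k + 5)))
    (fun k => ψ (tri x k)) fun k => rfl]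
  exact CharTwo.add_self_eq_zero _

/-- The indicator function of the edges of the horizontal ray to the left of `p`. -/
def ray (p x : ℤ × ℤ) (k : Fin 6) : ZMod 2 :=
  if x.2 = p.2 ∧ ((k = 0 ∧ x.1 < p.1) ∨ (k = 3 ∧ x.1 ≤ p.1)) then 1 else 0

/-- The edge leaving `p` in direction `k` is the edge leaving `x` in direction `l`. -/
def IsEdge (p : ℤ × ℤ) (k : Fin 6) (x : ℤ × ℤ) (l : Fin 6) : Prop :=
  (x = p ∧ l = k) ∨ (x = p + dir k ∧ l = k + 3)

instance (p : ℤ × ℤ) (k : Fin 6) (x : ℤ × ℤ) (l : Fin 6) : Decidable (IsEdge p k x l) :=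
  inferInstanceAs (Decidable (_ ∨ _))

theorem exists_edge_potential (p : ℤ × ℤ) (k : Fin 6) : ∃ φ, ∀ x l,
    jump φ x l = (if IsEdge p k x l then 1 else 0) + ray p x l + ray (p + dir k) x l := by
  have key : ∀ (p : ℤ × ℤ) (k : Fin 6), k < 3 → ∃ φ, ∀ x l,
      jump φ x l = (if IsEdge p k x l then 1 else 0) + ray p x l + ray (p + dir k) x l := by
    intro p k hk
    obtain ⟨i, j⟩ := p
    obtain rfl | rfl | rfl : k = 0 ∨ k = 1 ∨ k = 2 := by
      revert hk
      fin_cases k <;> simp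
    · refine ⟨fun _ => 0, fun x l => ?_⟩
      obtain ⟨a, b⟩ := x
      fin_cases l <;> simp [jump, ray, IsEdge, dir] <;>
        (split_ifs <;> first | rfl | (exfalso; omega))
    · refine ⟨fun t => if t.2.1 = j ∧ t.1 < i then 1 else 0, fun x l => ?_⟩
      obtain ⟨a, b⟩ := x
      fin_cases l <;> simp [jump, ray, IsEdge, dir, tri] <;>
        (split_ifs <;> first | rfl | (exfalso; omega) | grind)
    · refine ⟨fun t => if t.2.1 = j ∧ (t.1 < i - 1 ∨ (t.1 = i - 1 ∧ t.2.2 = true)) then 1 else 0,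
        fun x l => ?_⟩
      obtain ⟨a, b⟩ := x
      fin_cases l <;> simp [jump, ray, IsEdge, dir, tri] <;>
        (split_ifs <;> first | rfl | (exfalso; omega))
  by_cases hk : k < 3
  · exact key p k hk
  · obtain ⟨φ, hφ⟩ := key (p + dir k) (k + 3) (by revert hk; fin_cases k <;> decide)
    refine ⟨φ, fun x l => ?_⟩
    rw [hφ, dir_rev, add_right_comm]
    congr 3
    simp only [IsEdge, dir_rev, rev_rev]
    exact propext Or.comm

end PlanarOrder

namespace PlanarOrder

/-- All row sums and all column sums of `c` vanish. -/
def IsEven (c : Fin 3 → Fin 3 → ZMod 2) : Prop :=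
  (∀ i, ∑ j, c i j = 0) ∧ ∀ j, ∑ i, c i j = 0

theorem exists_isEven (q : ZMod 2 × ZMod 2 × ZMod 2 × ZMod 2) :
    ∃ c, IsEven c ∧ (c 0 0, c 0 1, c 1 0, c 1 1) = q := by
  obtain ⟨x, y, z, w⟩ := q
  refine ⟨![![x, y, x + y], ![z, w, z + w], ![x + z, y + w, x + y + z + w]], ⟨?_, ?_⟩, rfl⟩ <;>
    · intro i
      fin_cases i <;> revert x y z w <;> decide

theorem IsEven.four_le {c : Fin 3 → Fin 3 → ZMod 2} (hc : IsEven c) (h0 : ∃ i j, c i j ≠ 0) :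
    4 ≤ ∑ i, ∑ j, if c i j ≠ 0 then 1 else 0 := by
  obtain ⟨hr, hs⟩ := hc
  have key : ∀ x y z : ZMod 2, x + y + z = 0 → z = x + y := by decide
  have e02 := key _ _ _ (by simpa [Fin.sum_univ_three] using hr 0)
  have e12 := key _ _ _ (by simpa [Fin.sum_univ_three] using hr 1)
  have e20 := key _ _ _ (by simpa [Fin.sum_univ_three] using hs 0)
  have e21 := key _ _ _ (by simpa [Fin.sum_univ_three] using hs 1)
  have e22 := key _ _ _ (by simpa [Fin.sum_univ_three] using hs 2)
  have h1 : ¬ (c 0 0 = 0 ∧ c 0 1 = 0 ∧ c 1 0 = 0 ∧ c 1 1 = 0) := by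
    rintro ⟨h00, h01, h10, h11⟩
    obtain ⟨i, j, hij⟩ := h0
    apply hij
    fin_cases i <;> fin_cases j <;> simp [*]
  simp only [Fin.sum_univ_three, e22, e02, e12, e20, e21]
  generalize c 0 0 = x at *
  generalize c 0 1 = y at *
  generalize c 1 0 = z at *
  generalize c 1 1 = w at *
  clear e02 e12 e20 e21 e22 hr hs h0
  revert x y z w
  decide

/-- `K₃,₃` has no algebraic dual: the even subgraphs of `K₃,₃` are not the cuts of a graph whose
edges correspond to the edges of `K₃,₃`. -/
theorem no_dual {F : Type*} (s₁ s₂ : Fin 3 → Fin 3 → F)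
    (h₁ : ∀ g : F → ZMod 2, IsEven fun i j => g (s₁ i j) + g (s₂ i j))
    (h₂ : ∀ c, IsEven c → ∃ g : F → ZMod 2, ∀ i j, g (s₁ i j) + g (s₂ i j) = c i j) : False := by
  classical
  let b : F → Fin 3 → Fin 3 → ZMod 2 := fun f i j =>
    (if s₁ i j = f then 1 else 0) + (if s₂ i j = f then 1 else 0)
  let U : Finset F := Finset.univ.image (fun p : Fin 3 × Fin 3 => s₁ p.1 p.2) ∪
    Finset.univ.image (fun p : Fin 3 × Fin 3 => s₂ p.1 p.2)
  have hU₁ : ∀ i j, s₁ i j ∈ U := fun i j =>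
    Finset.mem_union_left _ (Finset.mem_image.2 ⟨(i, j), Finset.mem_univ _, rfl⟩)
  have hU₂ : ∀ i j, s₂ i j ∈ U := fun i j =>
    Finset.mem_union_right _ (Finset.mem_image.2 ⟨(i, j), Finset.mem_univ _, rfl⟩)
  let N : Finset F := U.filter fun f => ∃ i j, b f i j ≠ 0
  have hsum : ∀ (g : F → ZMod 2) i j, g (s₁ i j) + g (s₂ i j) = ∑ f ∈ U, g f * b f i j := by
    intro g i j
    simp [b, mul_add, Finset.sum_add_distrib, hU₁, hU₂]
  have hN : ∀ g g' : F → ZMod 2, (∀ f ∈ N, g f = g' f) →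
      ∀ i j, g (s₁ i j) + g (s₂ i j) = g' (s₁ i j) + g' (s₂ i j) := by
    intro g g' hg i j
    rw [hsum, hsum]
    refine Finset.sum_congr rfl fun f hf => ?_
    by_cases hb : f ∈ N
    · rw [hg f hb]
    · have : b f i j = 0 := by
        by_contra h
        exact hb (Finset.mem_filter.2 ⟨hf, i, j, h⟩)
      rw [this, mul_zero, mul_zero]
  have hcard : 4 * N.card ≤ 18 := by
    have hbeven : ∀ f, IsEven (b f) := by
      intro f
      simpa [b, Pi.single_apply] using h₁ (Pi.single f 1)
    calc 4 * N.card = ∑ f ∈ N, 4 := by simp [mul_comm]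
      _ ≤ ∑ f ∈ N, ∑ i, ∑ j, if b f i j ≠ 0 then 1 else 0 :=
        Finset.sum_le_sum fun f hf => (hbeven f).four_le (Finset.mem_filter.1 hf).2
      _ = ∑ i, ∑ j, ∑ f ∈ N, if b f i j ≠ 0 then 1 else 0 := by
        rw [Finset.sum_comm]
        exact Finset.sum_congr rfl fun i _ => Finset.sum_comm
      _ ≤ ∑ i : Fin 3, ∑ j : Fin 3, 2 := by
        refine Finset.sum_le_sum fun i _ => Finset.sum_le_sum fun j _ => ?_
        rw [← Finset.card_filter]
        refine le_trans (Finset.card_le_card (t := {s₁ i j, s₂ i j}) fun f hf => ?_)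
          Finset.card_le_two
        have := (Finset.mem_filter.1 hf).2
        by_contra hne
        simp only [Finset.mem_insert, Finset.mem_singleton, not_or] at hne
        apply this
        simp [b, Ne.symm hne.1, Ne.symm hne.2]
      _ = 18 := by simp
  let ext : (N → ZMod 2) → F → ZMod 2 := fun u f => if h : f ∈ N then u ⟨f, h⟩ else 0
  let D : (N → ZMod 2) → ZMod 2 × ZMod 2 × ZMod 2 × ZMod 2 := fun u =>
    let β := fun i j => ext u (s₁ i j) + ext u (s₂ i j)
    (β 0 0, β 0 1, β 1 0, β 1 1)
  have hD : Function.Surjective D := by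
    intro q
    obtain ⟨c, hc, rfl⟩ := exists_isEven q
    obtain ⟨g, hg⟩ := h₂ c hc
    refine ⟨fun f => g f, ?_⟩
    have := hN (ext fun f => g f) g fun f hf => by simp [ext, hf]
    simp only [D, this, hg]
  have hD01 : D 0 = D 1 := by
    have := hN (ext 1) (fun _ => 1) fun f hf => by simp [ext, hf]
    have h2 : (1 : ZMod 2) + 1 = 0 := rfl
    simp only [D, this, h2]
    simp [ext]
  have hle := Fintype.card_le_of_surjective D hD
  have e1 : Fintype.card (ZMod 2 × ZMod 2 × ZMod 2 × ZMod 2) = 2 ^ 4 := rfl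
  have e2 : Fintype.card (N → ZMod 2) = 2 ^ N.card := by simp
  rw [e1, e2] at hle
  have h4 : 4 ≤ N.card := (Nat.pow_le_pow_iff_right (by norm_num)).1 hle
  have h4' : N.card = 4 := by omega
  have hbij : Function.Bijective D :=
    (Fintype.bijective_iff_surjective_and_card D).2 ⟨hD, by rw [e1, e2, h4']⟩
  have h01 : (0 : N → ZMod 2) = 1 := hbij.1 hD01
  obtain ⟨f, hf⟩ : N.Nonempty := Finset.card_pos.1 (by omega)
  exact absurd (congrFun h01 ⟨f, hf⟩) (by simp)

end PlanarOrder

namespace PlanarOrder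

theorem jump_add (φ ψ : ℤ × ℤ × Bool → ZMod 2) (x : ℤ × ℤ) (l : Fin 6) :
    jump (φ + ψ) x l = jump φ x l + jump ψ x l := by
  simp only [jump, Pi.add_apply]
  ring

theorem jump_sum_mul {ι : Type*} (s : Finset ι) (c : ι → ZMod 2) (φ : ι → ℤ × ℤ × Bool → ZMod 2)
    (x : ℤ × ℤ) (l : Fin 6) :
    jump (fun t => ∑ i ∈ s, c i * φ i t) x l = ∑ i ∈ s, c i * jump (φ i) x l := by
  simp only [jump, mul_add, Finset.sum_add_distrib]

theorem Trek.exists_potential {K : Set (ℤ × ℤ)} {p y : ℤ × ℤ} {n : ℕ} (h : Trek lattice K p y n)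
    (hp : p ∈ K) : ∃ φ, ∀ x l, ¬ (x ∈ K ∧ x + dir l ∈ K) →
      jump φ x l = ray p x l + ray y x l := by
  induction h with
  | refl => exact ⟨0, fun x l _ => by simp [jump, CharTwo.add_self_eq_zero]⟩
  | @step y z n h' hadj hz ih =>
    obtain ⟨φ, hφ⟩ := ih
    obtain ⟨k, rfl⟩ := hadj
    obtain ⟨ψ, hψ⟩ := exists_edge_potential y k
    refine ⟨φ + ψ, fun x l hxl => ?_⟩
    have hy : y ∈ K := h'.mem_of_mem hp
    have hne : ¬ IsEdge y k x l := by
      rintro (⟨rfl, rfl⟩ | ⟨rfl, rfl⟩)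
      · exact hxl ⟨hy, hz⟩
      · exact hxl ⟨hz, by rwa [dir_rev]⟩
    rw [jump_add, hφ x l hxl, hψ, if_neg hne, zero_add, add_assoc, ← add_assoc (ray y x l),
      CharTwo.add_self_eq_zero, zero_add]

/-- The dart leaving `x` in direction `l` stays inside one of the sets `X v`. -/
def IsInside {ι : Type*} (X : ι → Set (ℤ × ℤ)) (x : ℤ × ℤ) (l : Fin 6) : Prop :=
  ∃ v, x ∈ X v ∧ x + dir l ∈ X v

/-- A potential whose value changes exactly across a given edge and across the rays to the hubs of
the two sets joined by that edge. -/
theorem exists_link_potential {ι : Type*} {X : ι → Set (ℤ × ℤ)} (hlink : ∀ v, Linked lattice (X v))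
    {h : ι → ℤ × ℤ} (hh : ∀ v, h v ∈ X v) {u v : ι} {p : ℤ × ℤ} {k : Fin 6} (hp : p ∈ X u)
    (hq : p + dir k ∈ X v) : ∃ φ, ∀ x l, ¬ IsInside X x l →
      jump φ x l = (if IsEdge p k x l then 1 else 0) + (ray (h u) x l + ray (h v) x l) := by
  obtain ⟨_, t₁⟩ := hlink u _ (hh u) _ hp
  obtain ⟨_, t₂⟩ := hlink v _ hq _ (hh v)
  obtain ⟨φ₁, h₁⟩ := t₁.exists_potential (hh u)
  obtain ⟨φ₂, h₂⟩ := t₂.exists_potential hq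
  obtain ⟨φ, hφ⟩ := exists_edge_potential p k
  refine ⟨φ₁ + φ + φ₂, fun x l hxl => ?_⟩
  rw [jump_add, jump_add, h₁ x l fun h => hxl ⟨u, h⟩, h₂ x l fun h => hxl ⟨v, h⟩, hφ]
  have e₁ := CharTwo.add_self_eq_zero (ray p x l)
  have e₂ := CharTwo.add_self_eq_zero (ray (p + dir k) x l)
  linear_combination e₁ + e₂

/-- The jumps across the darts leaving a finite set sum to zero. -/
theorem sum_jump_boundary {X : Set (ℤ × ℤ)} (hX : X.Finite) (ψ : ℤ × ℤ × Bool → ZMod 2)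
    {n : ℕ} (d : Fin n → (ℤ × ℤ) × Fin 6) (hd : Function.Injective d)
    (hdX : ∀ i, (d i).1 ∈ X ∧ (d i).1 + dir (d i).2 ∉ X)
    (h0 : ∀ x l, x ∈ X → x + dir l ∉ X → (x, l) ∉ Set.range d → jump ψ x l = 0) :
    ∑ i, jump ψ (d i).1 (d i).2 = 0 := by
  classical
  have htot : ∑ e ∈ hX.toFinset ×ˢ (Finset.univ : Finset (Fin 6)), jump ψ e.1 e.2 = 0 := by
    rw [Finset.sum_product]
    exact Finset.sum_eq_zero fun x _ => sum_jump ψ x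
  rw [← Finset.sum_filter_add_sum_filter_not _ (fun e => e.1 + dir e.2 ∈ X)] at htot
  have hin : ∑ e ∈ (hX.toFinset ×ˢ (Finset.univ : Finset (Fin 6))).filter
      (fun e => e.1 + dir e.2 ∈ X), jump ψ e.1 e.2 = 0 := by
    refine Finset.sum_involution (fun e _ => (e.1 + dir e.2, e.2 + 3)) ?_ ?_ ?_ ?_
    · intro e _
      rw [jump_rev]
      exact CharTwo.add_self_eq_zero _
    · rintro ⟨x, l⟩ _ _ h
      have := congrArg Prod.snd h
      revert this
      fin_cases l <;> simp
    · rintro ⟨x, l⟩ h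
      simp only [Finset.mem_filter, Finset.mem_product, Set.Finite.mem_toFinset,
        Finset.mem_univ, and_true] at h ⊢
      exact ⟨h.2, by rw [dir_rev]; exact h.1⟩
    · rintro ⟨x, l⟩ _
      simp [dir_rev, rev_rev]
  rw [hin, zero_add] at htot
  rw [← htot, ← Finset.sum_image (s := Finset.univ) (g := d) (f := fun e => jump ψ e.1 e.2)
    fun i _ j _ hij => hd hij]
  refine Finset.sum_subset ?_ ?_
  · rintro e he
    obtain ⟨i, -, rfl⟩ := Finset.mem_image.1 he
    simpa using hdX i
  · rintro ⟨x, l⟩ he hne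
    simp only [Finset.mem_filter, Finset.mem_product, Set.Finite.mem_toFinset,
      Finset.mem_univ, and_true] at he
    exact h0 x l he.1 he.2 fun ⟨i, hi⟩ => hne (Finset.mem_image.2 ⟨i, Finset.mem_univ _, hi⟩)

theorem noK33_lattice_finite {X : Fin 3 ⊕ Fin 3 → Set (ℤ × ℤ)} (hfin : ∀ v, (X v).Finite)
    (hlink : ∀ v, Linked lattice (X v)) (hdisj : Pairwise fun u v => Disjoint (X u) (X v))
    (htouch : ∀ i j : Fin 3, Touch lattice (X (.inl i)) (X (.inr j))) : False := by
  classical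
  have huniq : ∀ {u v x}, x ∈ X u → x ∈ X v → u = v := by
    intro u v x hu hv
    by_contra h
    exact Set.disjoint_left.1 (hdisj h) hu hv
  have hex : ∀ i j : Fin 3, ∃ p : ℤ × ℤ, ∃ k, p ∈ X (.inl i) ∧ p + dir k ∈ X (.inr j) := by
    intro i j
    obtain ⟨x, hx, _, hy, k, rfl⟩ := htouch i j
    exact ⟨x, k, hx, hy⟩
  choose a k ha hb using hex
  have hne : ∀ v, ∃ x, x ∈ X v := by
    rintro (i | j)
    · exact ⟨_, ha i 0⟩
    · exact ⟨_, hb 0 j⟩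
  choose h hh using hne
  have hnotin : ∀ i j, ¬ IsInside X (a i j) (k i j) := by
    rintro i j ⟨v, h1, h2⟩
    exact Sum.inl_ne_inr ((huniq (ha i j) h1).trans (huniq h2 (hb i j)))
  have hedge : ∀ i j i' j', IsEdge (a i j) (k i j) (a i' j') (k i' j') → i = i' ∧ j = j' := by
    rintro i j i' j' (⟨h1, h2⟩ | ⟨h1, -⟩)
    · have e1 := huniq (ha i j) (h1 ▸ ha i' j')
      have e2 := huniq (hb i j) (by rw [← h1, ← h2]; exact hb i' j')
      exact ⟨Sum.inl_injective e1, Sum.inr_injective e2⟩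
    · exact absurd (huniq (ha i' j') (h1 ▸ hb i j)) Sum.inl_ne_inr
  have hlinkpot : ∀ i j, ∃ φ, ∀ x l, ¬ IsInside X x l →
      jump φ x l = (if IsEdge (a i j) (k i j) x l then 1 else 0) +
        (ray (h (.inl i)) x l + ray (h (.inr j)) x l) :=
    fun i j => exists_link_potential hlink hh (ha i j) (hb i j)
  choose φ hφ using hlinkpot
  let r : ℤ × ℤ × Bool → ℤ × ℤ × Bool → Prop := fun t t' => ∃ x l, ¬ IsInside X x l ∧
    (∀ i j, ¬ IsEdge (a i j) (k i j) x l) ∧ t = tri x l ∧ t' = tri x (l + 5)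
  refine no_dual (F := Quot r) (fun i j => Quot.mk r (tri (a i j) (k i j)))
    (fun i j => Quot.mk r (tri (a i j) (k i j + 5))) ?_ ?_
  · intro g
    have hfree : ∀ x l, ¬ IsInside X x l → (∀ i j, ¬ IsEdge (a i j) (k i j) x l) →
        jump (fun t => g (Quot.mk r t)) x l = 0 := by
      intro x l h1 h2
      have : Quot.mk r (tri x l) = Quot.mk r (tri x (l + 5)) :=
        Quot.sound ⟨x, l, h1, h2, rfl, rfl⟩
      simp only [jump, this]
      exact CharTwo.add_self_eq_zero _
    have hout : ∀ {v x l}, x ∈ X v → x + dir l ∉ X v → ¬ IsInside X x l := by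
      rintro v x l h1 h2 ⟨u, h3, h4⟩
      exact h2 (huniq h1 h3 ▸ h4)
    constructor
    · intro i
      refine sum_jump_boundary (hfin (.inl i)) (fun t => g (Quot.mk r t))
        (fun j => (a i j, k i j)) ?_ ?_ ?_
      · intro j j' hjj
        simp only [Prod.mk.injEq] at hjj
        exact (hedge i j i j' (.inl ⟨hjj.1.symm, hjj.2.symm⟩)).2
      · exact fun j => ⟨ha i j, fun hc => Sum.inl_ne_inr (huniq hc (hb i j))⟩
      · intro x l h1 h2 h3
        refine hfree x l (hout h1 h2) ?_
        rintro i' j' (⟨rfl, rfl⟩ | ⟨rfl, rfl⟩)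
        · obtain rfl := Sum.inl_injective (huniq h1 (ha i' j'))
          exact h3 ⟨j', rfl⟩
        · exact Sum.inl_ne_inr (huniq h1 (hb i' j'))
    · intro j
      have := sum_jump_boundary (hfin (.inr j)) (fun t => g (Quot.mk r t))
        (fun i => (a i j + dir (k i j), k i j + 3)) ?_ ?_ ?_
      · simp only [jump_rev] at this
        exact this
      · intro i i' hii
        simp only [Prod.mk.injEq, add_left_inj] at hii
        refine (hedge i j i' j (.inl ⟨?_, hii.2.symm⟩)).1
        have h1 := hii.1
        rw [hii.2] at h1
        exact (add_right_cancel h1).symm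
      · refine fun i => ⟨hb i j, fun hc => ?_⟩
        simp only [dir_rev] at hc
        exact Sum.inl_ne_inr (huniq (ha i j) hc)
      · intro x l h1 h2 h3
        refine hfree x l (hout h1 h2) ?_
        rintro i' j' (⟨rfl, rfl⟩ | ⟨rfl, rfl⟩)
        · exact Sum.inl_ne_inr (huniq (ha i' j') h1)
        · obtain rfl := Sum.inr_injective (huniq h1 (hb i' j'))
          exact h3 ⟨i', rfl⟩
  · intro c hc
    let ψ : ℤ × ℤ × Bool → ZMod 2 := fun t =>
      ∑ e : Fin 3 × Fin 3, c e.1 e.2 * φ e.1 e.2 t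
    have hψ : ∀ x l, ¬ IsInside X x l → jump ψ x l =
        ∑ i, ∑ j, c i j * (if IsEdge (a i j) (k i j) x l then 1 else 0) := by
      intro x l hxl
      rw [jump_sum_mul, Fintype.sum_prod_type]
      simp only [fun i j => hφ i j x l hxl, mul_add, Finset.sum_add_distrib]
      have e1 : ∑ i, ∑ j, c i j * ray (h (.inl i)) x l = 0 := by
        refine Finset.sum_eq_zero fun i _ => ?_
        rw [← Finset.sum_mul, hc.1 i, zero_mul]
      have e2 : ∑ i, ∑ j, c i j * ray (h (.inr j)) x l = 0 := by
        rw [Finset.sum_comm]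
        refine Finset.sum_eq_zero fun j _ => ?_
        rw [← Finset.sum_mul, hc.2 j, zero_mul]
      rw [e1, e2, add_zero, add_zero]
    refine ⟨Quot.lift ψ ?_, fun i j => ?_⟩
    · rintro _ _ ⟨x, l, h1, h2, rfl, rfl⟩
      have := hψ x l h1
      simp only [h2, if_false, mul_zero, Finset.sum_const_zero] at this
      exact CharTwo.add_eq_zero.1 this
    · have := hψ _ _ (hnotin i j)
      rw [Finset.sum_eq_single i, Finset.sum_eq_single j, if_pos (.inl ⟨rfl, rfl⟩), mul_one] at this
      · exact this
      · intro j' _ hj'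
        rw [if_neg fun he => hj' (hedge _ _ _ _ he).2, mul_zero]
      · simp
      · intro i' _ hi'
        refine Finset.sum_eq_zero fun j' _ => ?_
        rw [if_neg fun he => hi' (hedge _ _ _ _ he).1, mul_zero]
      · simp

end PlanarOrder

namespace PlanarOrder

/-- The bricks of a brick wall tiling of the plane by squares of side length `1 / N`. -/
def brick (N : ℕ) (b : ℤ × ℤ) : Set (ℝ × ℝ) :=
  {p | b.2 ≤ N * p.2 ∧ N * p.2 ≤ b.2 + 1 ∧ 2 * b.1 + b.2 ≤ 2 * (N * p.1) ∧
    2 * (N * p.1) ≤ 2 * b.1 + b.2 + 2}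

theorem isClosed_brick (N : ℕ) (b : ℤ × ℤ) : IsClosed (brick N b) := by
  simp only [brick, Set.ofPred_and]
  refine IsClosed.inter ?_ (IsClosed.inter ?_ (IsClosed.inter ?_ ?_)) <;>
    exact isClosed_le (by fun_prop) (by fun_prop)

theorem exists_mem_brick (N : ℕ) (p : ℝ × ℝ) : ∃ b, p ∈ brick N b := by
  refine ⟨(⌊N * p.1 - ⌊N * p.2⌋ / 2⌋, ⌊N * p.2⌋), ?_⟩
  have h1 := Int.floor_le (N * p.1 - ⌊N * p.2⌋ / 2)
  have h2 := Int.lt_floor_add_one (N * p.1 - ⌊N * p.2⌋ / 2)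
  have h3 := Int.floor_le (N * p.2)
  have h4 := Int.lt_floor_add_one (N * p.2)
  refine ⟨h3, h4.le, ?_, ?_⟩ <;> simp only <;> linarith

theorem adj_of_mem_brick {N : ℕ} {b c : ℤ × ℤ} {p : ℝ × ℝ} (hb : p ∈ brick N b)
    (hc : p ∈ brick N c) : b = c ∨ lattice.Adj b c := by
  obtain ⟨b1, b2, b3, b4⟩ := hb
  obtain ⟨c1, c2, c3, c4⟩ := hc
  have h1 : b.2 ≤ c.2 + 1 := by exact_mod_cast b1.trans c2
  have h2 : c.2 ≤ b.2 + 1 := by exact_mod_cast c1.trans b2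
  have h3 : 2 * b.1 + b.2 ≤ 2 * c.1 + c.2 + 2 := by exact_mod_cast b3.trans c4
  have h4 : 2 * c.1 + c.2 ≤ 2 * b.1 + b.2 + 2 := by exact_mod_cast c3.trans b4
  obtain ⟨i, j⟩ := b
  obtain ⟨i', j'⟩ := c
  simp only at h1 h2 h3 h4
  rcases (by omega : (i' = i ∧ j' = j) ∨ (i' = i + 1 ∧ j' = j) ∨ (i' = i ∧ j' = j + 1) ∨
    (i' = i - 1 ∧ j' = j + 1) ∨ (i' = i - 1 ∧ j' = j) ∨ (i' = i ∧ j' = j - 1) ∨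
    (i' = i + 1 ∧ j' = j - 1)) with
    ⟨rfl, rfl⟩ | ⟨rfl, rfl⟩ | ⟨rfl, rfl⟩ | ⟨rfl, rfl⟩ | ⟨rfl, rfl⟩ | ⟨rfl, rfl⟩ | ⟨rfl, rfl⟩
  · exact .inl rfl
  · exact .inr ⟨0, by simp [dir]⟩
  · exact .inr ⟨1, by simp [dir]⟩
  · exact .inr ⟨2, by simp [dir, sub_eq_add_neg]⟩
  · exact .inr ⟨3, by simp [dir, sub_eq_add_neg]⟩
  · exact .inr ⟨4, by simp [dir, sub_eq_add_neg]⟩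
  · exact .inr ⟨5, by simp [dir, sub_eq_add_neg]⟩

theorem mul_dist_le_of_mem_brick {N : ℕ} {b : ℤ × ℤ} {p q : ℝ × ℝ} (hp : p ∈ brick N b)
    (hq : q ∈ brick N b) : N * dist p q ≤ 1 := by
  obtain ⟨p1, p2, p3, p4⟩ := hp
  obtain ⟨q1, q2, q3, q4⟩ := hq
  rw [Prod.dist_eq, mul_max_of_nonneg _ _ N.cast_nonneg, Real.dist_eq, Real.dist_eq]
  have hN : |(N : ℝ)| = N := abs_of_nonneg N.cast_nonneg
  refine max_le ?_ ?_
  · rw [← hN, ← abs_mul, abs_le, mul_sub]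
    constructor <;> linarith
  · rw [← hN, ← abs_mul, abs_le, mul_sub]
    constructor <;> linarith

/-- The bricks meeting `Y`. -/
def cells (N : ℕ) (Y : Set (ℝ × ℝ)) : Set (ℤ × ℤ) :=
  {b | (brick N b ∩ Y).Nonempty}

theorem cells_nonempty_inter {Y Y' : Set (ℝ × ℝ)} (N : ℕ) (h : (Y ∩ Y').Nonempty) :
    (cells N Y ∩ cells N Y').Nonempty := by
  obtain ⟨p, hp, hp'⟩ := h
  obtain ⟨b, hb⟩ := exists_mem_brick N p
  exact ⟨b, ⟨p, hb, hp⟩, p, hb, hp'⟩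

theorem finite_cells (N : ℕ) {Y : Set (ℝ × ℝ)} (hY : IsCompact Y) : (cells N Y).Finite := by
  obtain ⟨R, hR⟩ := hY.isBounded.exists_norm_le
  obtain ⟨M, hM⟩ := exists_int_gt (N * R)
  refine ((Set.finite_Icc (-2 * M - 2) (2 * M + 2)).prod (Set.finite_Icc (-M - 1) M)).subset ?_
  rintro ⟨i, j⟩ ⟨p, ⟨p1, p2, p3, p4⟩, hp⟩
  have h1 := abs_le.1 ((norm_fst_le p).trans (hR p hp))
  have h2 := abs_le.1 ((norm_snd_le p).trans (hR p hp))
  have hN : (0 : ℝ) ≤ N := N.cast_nonneg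
  have a1 := mul_le_mul_of_nonneg_left h1.1 hN
  have a2 := mul_le_mul_of_nonneg_left h1.2 hN
  have a3 := mul_le_mul_of_nonneg_left h2.1 hN
  have a4 := mul_le_mul_of_nonneg_left h2.2 hN
  simp only at p1 p2 p3 p4
  have c1 : j ≤ M := by exact_mod_cast (by linarith : (j : ℝ) ≤ M)
  have c2 : -M ≤ j + 1 := by exact_mod_cast (by linarith : -(M : ℝ) ≤ j + 1)
  have c3 : 2 * i + j ≤ 2 * M := by exact_mod_cast (by linarith : 2 * (i : ℝ) + j ≤ 2 * M)
  have c4 : -(2 * M) ≤ 2 * i + j + 2 := by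
    exact_mod_cast (by linarith : -(2 * (M : ℝ)) ≤ 2 * i + j + 2)
  simp only [Set.mem_prod, Set.mem_Icc]
  omega

theorem linked_cells (N : ℕ) {Y : Set (ℝ × ℝ)} (hY : IsCompact Y) (hc : IsPreconnected Y) :
    Linked lattice (cells N Y) := by
  intro b hb c hcY
  by_contra hno
  let A : Set (ℤ × ℤ) := {d ∈ cells N Y | ∃ n, Trek lattice (cells N Y) b d n}
  have hfin := finite_cells N hY
  have hclosed : ∀ B ⊆ cells N Y, IsClosed (⋃ d ∈ B, brick N d) := fun B hB =>
    (hfin.subset hB).isClosed_biUnion fun d _ => isClosed_brick N d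
  obtain ⟨p, hp, hpA, hpB⟩ := isPreconnected_closed_iff.1 hc _ _ (hclosed A fun d hd => hd.1)
    (hclosed (cells N Y \ A) Set.sdiff_subset)
    (by
      intro p hp
      obtain ⟨d, hd⟩ := exists_mem_brick N p
      have hdY : d ∈ cells N Y := ⟨p, hd, hp⟩
      by_cases hdA : d ∈ A
      · exact .inl (Set.mem_biUnion hdA hd)
      · exact .inr (Set.mem_biUnion (⟨hdY, hdA⟩ : d ∈ cells N Y \ A) hd))
    (by
      obtain ⟨p, hpb, hp⟩ := hb
      exact ⟨p, hp, Set.mem_biUnion (⟨⟨p, hpb, hp⟩, 0, .refl⟩ : b ∈ A) hpb⟩)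
    (by
      obtain ⟨p, hpb, hp⟩ := hcY
      exact ⟨p, hp, Set.mem_biUnion
        (⟨⟨p, hpb, hp⟩, fun h => hno h.2⟩ : c ∈ cells N Y \ A) hpb⟩)
  simp only [Set.mem_iUnion] at hpA hpB
  obtain ⟨d, ⟨hd, n, hn⟩, hpd⟩ := hpA
  obtain ⟨e, ⟨he, heA⟩, hpe⟩ := hpB
  apply heA
  rcases adj_of_mem_brick hpd hpe with rfl | hadj
  · exact ⟨hd, n, hn⟩
  · exact ⟨he, n + 1, hn.step hadj he⟩

theorem eventually_disjoint_cells {Y Y' : Set (ℝ × ℝ)} (hY : IsCompact Y) (hY' : IsCompact Y')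
    (hd : Disjoint Y Y') : ∀ᶠ N in Filter.atTop, Disjoint (cells N Y) (cells N Y') := by
  obtain ⟨r, hr, hlt⟩ := Metric.exists_pos_forall_lt_edist hY hY'.isClosed hd
  obtain ⟨n, hn⟩ := exists_nat_gt (1 / (r : ℝ))
  filter_upwards [Filter.eventually_ge_atTop n] with N hN
  refine Set.disjoint_left.2 ?_
  rintro b ⟨p, hpb, hp⟩ ⟨q, hqb, hq⟩
  have h1 := mul_dist_le_of_mem_brick hpb hqb
  have h2 := hlt p hp q hq
  rw [edist_nndist, ENNReal.coe_lt_coe, ← NNReal.coe_lt_coe, coe_nndist] at h2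
  have hr' : (0 : ℝ) < r := hr
  have h3 : 1 < (n : ℝ) * r := by rwa [div_lt_iff₀ hr'] at hn
  have h4 : (n : ℝ) ≤ N := by exact_mod_cast hN
  nlinarith [mul_le_mul_of_nonneg_right h4 hr'.le, mul_le_mul_of_nonneg_left h2.le
    (N.cast_nonneg : (0 : ℝ) ≤ N)]

/-- The part of a walk through `M` before it first enters `Z`. -/
theorem exists_chain {V : Type} {G : SimpleGraph V} {M Z : Set V} (hM : Linked G M) {p q : V}
    (hp : p ∈ M) (hpZ : p ∉ Z) (hq : q ∈ M) (hqZ : q ∈ Z) :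
    ∃ C, Linked G C ∧ C ⊆ M ∧ p ∈ C ∧ Disjoint Z C ∧ Touch G Z C := by
  classical
  obtain ⟨n, hn⟩ := hM p hp q hq
  obtain ⟨f, h0, hfn, hadj, hfM⟩ := hn.exists_fun
  have hex : ∃ k, f k ∈ Z := ⟨n, hfn ▸ hqZ⟩
  have hm : f (Nat.find hex) ∈ Z := Nat.find_spec hex
  have hmin : ∀ k < Nat.find hex, f k ∉ Z := fun k hk => Nat.find_min hex hk
  have hmn : Nat.find hex ≤ n := Nat.find_min' hex (hfn ▸ hqZ)
  generalize Nat.find hex = m at *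
  have hm0 : m ≠ 0 := by
    rintro rfl
    exact hpZ (h0 ▸ hm)
  obtain ⟨m, rfl⟩ := Nat.exists_eq_succ_of_ne_zero hm0
  refine ⟨f '' Set.Iic m, ?_, ?_, ⟨0, Nat.zero_le _, h0⟩, ?_, ?_⟩
  · refine linked_image_interval f _ Set.ordConnected_Iic fun k _ hk => hadj k ?_
    have : k + 1 ≤ m := hk
    omega
  · rintro _ ⟨k, hk, rfl⟩
    have hk : k ≤ m := hk
    rcases Nat.eq_zero_or_pos k with rfl | hk0
    · exact h0 ▸ hp
    · exact hfM k hk0 (by omega)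
  · refine Set.disjoint_right.2 ?_
    rintro _ ⟨k, hk, rfl⟩
    exact hmin k (Nat.lt_succ_of_le hk)
  · exact ⟨f (m + 1), hm, f m, ⟨m, le_refl m, rfl⟩, (hadj m (by omega)).symm⟩

/-- The plane contains no continuous model of `K₃,₃`, with branch sets `Z i` and `R j` and
connecting sets `M i j`. -/
theorem noK33_plane {Z R : Fin 3 → Set (ℝ × ℝ)} {M : Fin 3 → Fin 3 → Set (ℝ × ℝ)}
    (cZ : ∀ i, IsCompact (Z i)) (cR : ∀ j, IsCompact (R j)) (cM : ∀ i j, IsCompact (M i j))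
    (pZ : ∀ i, IsPreconnected (Z i)) (pR : ∀ j, IsPreconnected (R j))
    (pM : ∀ i j, IsPreconnected (M i j))
    (hMZ : ∀ i j, (M i j ∩ Z i).Nonempty) (hMR : ∀ i j, (M i j ∩ R j).Nonempty)
    (dZ : ∀ i i', i ≠ i' → Disjoint (Z i) (Z i')) (dR : ∀ j j', j ≠ j' → Disjoint (R j) (R j'))
    (dZR : ∀ i j, Disjoint (Z i) (R j)) (dMZ : ∀ i i' j, i ≠ i' → Disjoint (M i j) (Z i'))
    (dMR : ∀ i j j', j ≠ j' → Disjoint (M i j) (R j'))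
    (dM : ∀ i i' j j', j ≠ j' → Disjoint (M i j) (M i' j')) : False := by
  obtain ⟨N, eZ, eR, eZR, eMZ, eMR, eM⟩ : ∃ N,
      (∀ i i', i ≠ i' → Disjoint (cells N (Z i)) (cells N (Z i'))) ∧
      (∀ j j', j ≠ j' → Disjoint (cells N (R j)) (cells N (R j'))) ∧
      (∀ i j, Disjoint (cells N (Z i)) (cells N (R j))) ∧
      (∀ i i' j, i ≠ i' → Disjoint (cells N (M i j)) (cells N (Z i'))) ∧
      (∀ i j j', j ≠ j' → Disjoint (cells N (M i j)) (cells N (R j'))) ∧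
      (∀ i i' j j', j ≠ j' → Disjoint (cells N (M i j)) (cells N (M i' j'))) := by
    refine Filter.Eventually.exists (f := Filter.atTop) ?_
    simp only [Filter.eventually_and, Filter.eventually_all]
    exact ⟨fun _ _ h => eventually_disjoint_cells (cZ _) (cZ _) (dZ _ _ h),
      fun _ _ h => eventually_disjoint_cells (cR _) (cR _) (dR _ _ h),
      fun _ _ => eventually_disjoint_cells (cZ _) (cR _) (dZR _ _),
      fun _ _ _ h => eventually_disjoint_cells (cM _ _) (cZ _) (dMZ _ _ _ h),
      fun _ _ _ h => eventually_disjoint_cells (cM _ _) (cR _) (dMR _ _ _ h),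
      fun _ _ _ _ h => eventually_disjoint_cells (cM _ _) (cM _ _) (dM _ _ _ _ h)⟩
  have hchain : ∀ i j, ∃ C, Linked lattice C ∧ C ⊆ cells N (M i j) ∧
      (C ∩ cells N (R j)).Nonempty ∧ Disjoint (cells N (Z i)) C ∧
      Touch lattice (cells N (Z i)) C := by
    intro i j
    obtain ⟨q, hqM, hqZ⟩ := cells_nonempty_inter N (hMZ i j)
    obtain ⟨p, hpM, hpR⟩ := cells_nonempty_inter N (hMR i j)
    obtain ⟨C, h1, h2, h3, h4, h5⟩ := exists_chain (linked_cells N (cM i j) (pM i j)) hpM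
      (fun h => Set.disjoint_left.1 (eZR i j) h hpR) hqM hqZ
    exact ⟨C, h1, h2, ⟨p, h3, hpR⟩, h4, h5⟩
  choose C hCl hCM hCR hCZ hCt using hchain
  have hRR : ∀ j j', j ≠ j' →
      Disjoint (cells N (R j) ∪ ⋃ i, C i j) (cells N (R j') ∪ ⋃ i, C i j') := by
    intro j j' hj
    simp only [Set.disjoint_union_left, Set.disjoint_union_right, Set.disjoint_iUnion_left,
      Set.disjoint_iUnion_right]
    exact ⟨⟨eR _ _ hj, fun i => (eMR i j j' hj).mono_left (hCM i j)⟩,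
      fun i => ⟨((eMR i j' j hj.symm).mono_left (hCM i j')).symm,
        fun i' => (eM _ _ _ _ hj).mono (hCM _ _) (hCM _ _)⟩⟩
  have hZR : ∀ i j, Disjoint (cells N (Z i)) (cells N (R j) ∪ ⋃ i, C i j) := by
    intro i j
    simp only [Set.disjoint_union_right, Set.disjoint_iUnion_right]
    refine ⟨eZR i j, fun i' => ?_⟩
    by_cases h : i' = i
    · subst h
      exact hCZ _ _
    · exact ((eMZ i' i j h).mono_left (hCM i' j)).symm
  refine noK33_lattice_finite
    (X := Sum.elim (fun i => cells N (Z i)) (fun j => cells N (R j) ∪ ⋃ i, C i j)) ?_ ?_ ?_ ?_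
  · rintro (i | j)
    · exact finite_cells N (cZ i)
    · exact (finite_cells N (cR j)).union
        (Set.finite_iUnion fun i => (finite_cells N (cM i j)).subset (hCM i j))
  · rintro (i | j)
    · exact linked_cells N (cZ i) (pZ i)
    · obtain ⟨c, -, hc⟩ := hCR 0 j
      have hRl := linked_cells N (cR j) (pR j)
      refine linked_of_hub c (.inl hc) ?_
      rintro x (hx | hx)
      · obtain ⟨n, hn⟩ := hRl c hc x hx
        exact ⟨n, hn.mono Set.subset_union_left⟩
      · obtain ⟨i, hi⟩ := Set.mem_iUnion.1 hx
        obtain ⟨p, hpC, hpR⟩ := hCR i j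
        obtain ⟨n, hn⟩ := hRl c hc p hpR
        obtain ⟨m, hm⟩ := hCl i j p hpC x hi
        exact ⟨_, (hn.mono Set.subset_union_left).trans
          (hm.mono ((Set.subset_iUnion (fun i => C i j) i).trans Set.subset_union_right))⟩
  · rintro (i | j) (i' | j') h
    · exact eZ i i' fun e => h (congrArg _ e)
    · exact hZR i j'
    · exact (hZR i' j).symm
    · exact hRR j j' fun e => h (congrArg _ e)
  · intro i j
    obtain ⟨x, hx, y, hy, hxy⟩ := hCt i j
    exact ⟨x, hx, y, .inr (Set.mem_iUnion.2 ⟨i, hy⟩), hxy⟩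

end PlanarOrder

namespace PlanarOrder

variable {V : Type} {G : SimpleGraph V} {f : V → ℝ × ℝ} {γ : G.edgeSet → Set.Icc (0:ℝ) 1 → ℝ × ℝ}

theorem exists_oriented_arc (h : IsPlaneEmbedding G f γ) {u v : V} (huv : G.Adj u v) :
    ∃ α : ℝ → ℝ × ℝ, Continuous α ∧ Set.InjOn α (Set.Icc 0 1) ∧ α 0 = f u ∧ α 1 = f v ∧
      Set.range α ⊆ Set.range (γ ⟨s(u, v), huv⟩) := by
  obtain ⟨-, hc, hends, -⟩ := h
  obtain ⟨u', v', he, h0, h1⟩ := hends ⟨s(u, v), huv⟩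
  obtain ⟨hcont, hinj⟩ := hc ⟨s(u, v), huv⟩
  have hproj : ∀ t (ht : t ∈ Set.Icc (0 : ℝ) 1), Set.projIcc 0 1 zero_le_one t = ⟨t, ht⟩ :=
    fun t ht => Set.projIcc_of_mem _ ht
  have hinj' : Set.InjOn (fun t : ℝ => γ ⟨s(u, v), huv⟩ (Set.projIcc 0 1 zero_le_one t))
      (Set.Icc 0 1) := by
    intro s hs t ht hst
    simp only [hproj s hs, hproj t ht] at hst
    exact congrArg Subtype.val (hinj hst)
  rcases Sym2.eq_iff.1 he with ⟨rfl, rfl⟩ | ⟨rfl, rfl⟩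
  · refine ⟨fun t => γ ⟨s(u, v), huv⟩ (Set.projIcc 0 1 zero_le_one t),
      hcont.comp continuous_projIcc, hinj', ?_, ?_, ?_⟩
    · simpa only [hproj 0 (by norm_num)] using h0
    · simpa only [hproj 1 (by norm_num)] using h1
    · rintro _ ⟨t, rfl⟩
      exact ⟨_, rfl⟩
  · refine ⟨fun t => γ ⟨s(u, v), huv⟩ (Set.projIcc 0 1 zero_le_one (1 - t)),
      hcont.comp (continuous_projIcc.comp (by fun_prop)), ?_, ?_, ?_, ?_⟩
    · intro s hs t ht hst
      have := hinj' (x₁ := 1 - s) ⟨by linarith [hs.2], by linarith [hs.1]⟩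
        (x₂ := 1 - t) ⟨by linarith [ht.2], by linarith [ht.1]⟩ hst
      linarith
    · simpa only [sub_zero, hproj 1 (by norm_num)] using h1
    · simpa only [sub_self, hproj 0 (by norm_num)] using h0
    · rintro _ ⟨t, rfl⟩
      exact ⟨_, rfl⟩

/-- The points owned by the vertices in `A` and by the interiors of the edges in `E`. -/
def owned (f : V → ℝ × ℝ) (γ : G.edgeSet → Set.Icc (0:ℝ) 1 → ℝ × ℝ) (A : Set V)
    (E : Set G.edgeSet) : Set (ℝ × ℝ) :=
  {p | (∃ x ∈ A, p = f x) ∨ ∃ e ∈ E, p ∈ Set.range (γ e) ∧ p ∉ Set.range f}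

theorem disjoint_owned (h : IsPlaneEmbedding G f γ) {A A' : Set V} {E E' : Set G.edgeSet}
    (hA : Disjoint A A') (hE : Disjoint E E') : Disjoint (owned f γ A E) (owned f γ A' E') := by
  obtain ⟨hf, -, -, -, hcross⟩ := h
  refine Set.disjoint_left.2 ?_
  rintro p (⟨x, hx, rfl⟩ | ⟨e, he, ⟨t, rfl⟩, hp⟩) (⟨x', hx', hp'⟩ | ⟨e', he', ⟨t', ht'⟩, hp'⟩)
  · exact Set.disjoint_left.1 hA hx (hf hp' ▸ hx')
  · exact hp' ⟨x, rfl⟩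
  · exact hp ⟨x', hp'.symm⟩
  · obtain ⟨x, -, -, hx⟩ := hcross e e'
      (fun hee => Set.disjoint_left.1 hE he (hee ▸ he')) t t' ht'.symm
    exact hp ⟨x, hx.symm⟩

theorem subset_owned (h : IsPlaneEmbedding G f γ) {A : Set V} {E : Set G.edgeSet} {e : G.edgeSet}
    (he : e ∈ E) {T : Set (ℝ × ℝ)} (hT : T ⊆ Set.range (γ e))
    (hA : ∀ x ∈ (e : Sym2 V), f x ∈ T → x ∈ A) : T ⊆ owned f γ A E := by
  intro p hp
  by_cases hpf : p ∈ Set.range f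
  · obtain ⟨x, rfl⟩ := hpf
    obtain ⟨t, ht⟩ := hT hp
    exact .inl ⟨x, hA x (h.2.2.2.1 e x t ht) hp, rfl⟩
  · exact .inr ⟨e, he, hT hp, hpf⟩

theorem owned_mono {A A' : Set V} {E E' : Set G.edgeSet} (hA : A ⊆ A') (hE : E ⊆ E') :
    owned f γ A E ⊆ owned f γ A' E' := by
  rintro p (⟨x, hx, rfl⟩ | ⟨e, he, hp⟩)
  · exact .inl ⟨x, hA hx, rfl⟩
  · exact .inr ⟨e, hE he, hp⟩

/-- The edges with both ends in `S`. -/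
def insideEdges (G : SimpleGraph V) (S : Set V) : Set G.edgeSet :=
  {e | ∀ x ∈ (e : Sym2 V), x ∈ S}

/-- The drawing of the subgraph induced by `S`. -/
def drawing (f : V → ℝ × ℝ) (γ : G.edgeSet → Set.Icc (0:ℝ) 1 → ℝ × ℝ) (S : Set V) :
    Set (ℝ × ℝ) :=
  f '' S ∪ ⋃ e ∈ insideEdges G S, Set.range (γ e)

theorem drawing_subset_owned (h : IsPlaneEmbedding G f γ) (S : Set V) :
    drawing f γ S ⊆ owned f γ S (insideEdges G S) := by
  rintro p (⟨x, hx, rfl⟩ | hp)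
  · exact .inl ⟨x, hx, rfl⟩
  · simp only [Set.mem_iUnion] at hp
    obtain ⟨e, he, hp⟩ := hp
    exact subset_owned h he subset_rfl (fun x hx _ => he x hx) hp

theorem isCompact_drawing [Finite V] (h : IsPlaneEmbedding G f γ) (S : Set V) :
    IsCompact (drawing f γ S) :=
  (S.toFinite.image f).isCompact.union
    ((Set.toFinite _).isCompact_biUnion fun e _ => isCompact_range (h.2.1 e).1)

theorem isPreconnected_drawing (h : IsPlaneEmbedding G f γ) {S : Set V} (hS : Linked G S) :
    IsPreconnected (drawing f γ S) := by
  rcases S.eq_empty_or_nonempty with rfl | ⟨x₀, hx₀⟩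
  · have : drawing f γ (∅ : Set V) = ∅ := by
      refine Set.eq_empty_of_forall_notMem ?_
      rintro p (⟨x, hx, -⟩ | hp)
      · exact hx
      · simp only [Set.mem_iUnion] at hp
        obtain ⟨⟨e, he⟩, hin, -⟩ := hp
        induction e with
        | _ u v => exact hin u (by simp)
    rw [this]
    exact isPreconnected_empty
  have hpre : ∀ e, IsPreconnected (Set.range (γ e)) := by
    intro e
    have : PreconnectedSpace (Set.Icc (0 : ℝ) 1) :=
      Subtype.preconnectedSpace isPreconnected_Icc
    exact isPreconnected_range (h.2.1 e).1
  have hends : ∀ e : G.edgeSet, ∀ x ∈ (e : Sym2 V), f x ∈ Set.range (γ e) := by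
    intro e x hx
    obtain ⟨u, v, he, h0, h1⟩ := h.2.2.1 e
    rw [he, Sym2.mem_iff] at hx
    rcases hx with rfl | rfl
    · exact ⟨_, h0⟩
    · exact ⟨_, h1⟩
  have hrange : ∀ e ∈ insideEdges G S, Set.range (γ e) ⊆ drawing f γ S := fun e he =>
    (Set.subset_biUnion_of_mem (u := fun e => Set.range (γ e)) he).trans Set.subset_union_right
  have htrek : ∀ {y n}, Trek G S x₀ y n → ∃ t ⊆ drawing f γ S,
      f x₀ ∈ t ∧ f y ∈ t ∧ IsPreconnected t := by
    intro y n hn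
    induction hn with
    | refl => exact ⟨{f x₀}, by
        rintro _ rfl
        exact .inl ⟨x₀, hx₀, rfl⟩, rfl, rfl, isPreconnected_singleton⟩
    | @step y z n hy hadj hz ih =>
      obtain ⟨t, ht, h1, h2, h3⟩ := ih
      have hy' := hends ⟨s(y, z), hadj⟩ y (by simp)
      refine ⟨t ∪ Set.range (γ ⟨s(y, z), hadj⟩), Set.union_subset ht (hrange _ ?_), .inl h1,
        .inr (hends _ z (by simp)), h3.union (f y) h2 hy' (hpre _)⟩
      intro x hx
      rcases Sym2.mem_iff.1 hx with rfl | rfl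
      · exact hy.mem_of_mem hx₀
      · exact hz
  refine isPreconnected_of_forall (f x₀) ?_
  rintro p (⟨y, hy, rfl⟩ | hp)
  · obtain ⟨n, hn⟩ := hS x₀ hx₀ y hy
    exact htrek hn
  · simp only [Set.mem_iUnion] at hp
    obtain ⟨e, he, hp⟩ := hp
    obtain ⟨u, v, huv, -⟩ := h.2.2.1 e
    have hu : u ∈ (e : Sym2 V) := by simp [huv]
    obtain ⟨n, hn⟩ := hS x₀ hx₀ u (he u hu)
    obtain ⟨t, ht, h1, h2, h3⟩ := htrek hn
    exact ⟨t ∪ Set.range (γ e), Set.union_subset ht (hrange e he), .inl h1, .inr hp,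
      h3.union (f u) h2 (hends e u hu) (hpre e)⟩

theorem noK33_of_isPlanar [Finite V] (hG : IsPlanar G) : NoK33 G := by
  obtain ⟨f, γ, h⟩ := hG
  rintro ⟨S, hlink, hdisj, htouch⟩
  have huniq : ∀ {u v x}, x ∈ S u → x ∈ S v → u = v := by
    intro u v x hu hv
    by_contra huv
    exact Set.disjoint_left.1 (hdisj huv) hu hv
  choose a ha b hb hab using htouch
  choose α hα hαinj hα0 hα1 hαr using fun i j => exists_oriented_arc h (hab i j)
  let m : Fin 3 → Fin 3 → G.edgeSet := fun i j => ⟨s(a i j, b i j), hab i j⟩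
  have hm : ∀ {i j i' j'}, m i j = m i' j' → i = i' ∧ j = j' := by
    intro i j i' j' hmm
    have hmm : s(a i j, b i j) = s(a i' j', b i' j') := congrArg Subtype.val hmm
    rcases Sym2.eq_iff.1 hmm with ⟨h1, h2⟩ | ⟨h1, -⟩
    · exact ⟨Sum.inl_injective (huniq (ha i j) (h1 ▸ ha i' j')),
        Sum.inr_injective (huniq (hb i j) (h2 ▸ hb i' j'))⟩
    · exact absurd (huniq (ha i j) (h1 ▸ hb i' j')) Sum.inl_ne_inr
  have hin : ∀ {u v}, u ≠ v → Disjoint (insideEdges G (S u)) (insideEdges G (S v)) := by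
    intro u v huv
    refine Set.disjoint_left.2 ?_
    intro e hu hv
    obtain ⟨x, _, hxy, -⟩ := h.2.2.1 e
    have hx : x ∈ (e : Sym2 V) := by simp [hxy]
    exact huv (huniq (hu x hx) (hv x hx))
  have hmin : ∀ {i j v}, m i j ∉ insideEdges G (S v) := by
    intro i j v hv
    exact Sum.inl_ne_inr ((huniq (ha i j) (hv _ (by simp [m]))).trans
      (huniq (hv _ (by simp [m])) (hb i j)))
  have h01 : (0 : ℝ) ∈ Set.Icc (0 : ℝ) 1 := by norm_num
  have h11 : (1 : ℝ) ∈ Set.Icc (0 : ℝ) 1 := by norm_num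
  let H : Fin 3 → Fin 3 → Set (ℝ × ℝ) := fun i j => α i j '' Set.Icc 0 (1 / 2)
  let M : Fin 3 → Fin 3 → Set (ℝ × ℝ) := fun i j => α i j '' Set.Icc (1 / 2) 1
  let L : Fin 3 ⊕ Fin 3 → Set (ℝ × ℝ) := fun v => drawing f γ (S v)
  have hHL : ∀ i j, f (a i j) ∈ L (.inl i) := fun i j => .inl ⟨_, ha i j, rfl⟩
  have hHa : ∀ i j, f (a i j) ∈ H i j := fun i j => ⟨0, by norm_num, hα0 i j⟩
  have hMb : ∀ i j, f (b i j) ∈ M i j := fun i j => ⟨1, by norm_num, hα1 i j⟩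
  have hHown : ∀ i j, H i j ⊆ owned f γ (S (.inl i)) {m i j} := by
    intro i j
    refine subset_owned h (Set.mem_singleton (m i j)) ((Set.image_subset_range _ _).trans (hαr i j)) ?_
    intro x hx hxH
    rcases Sym2.mem_iff.1 hx with rfl | rfl
    · exact ha i j
    · obtain ⟨t, ht, htx⟩ := hxH
      have := hαinj i j ⟨ht.1, by linarith [ht.2]⟩ h11 (htx.trans (hα1 i j).symm)
      linarith [ht.2]
  have hMown : ∀ i j, M i j ⊆ owned f γ (S (.inr j)) {m i j} := by
    intro i j
    refine subset_owned h (Set.mem_singleton (m i j)) ((Set.image_subset_range _ _).trans (hαr i j)) ?_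
    intro x hx hxM
    rcases Sym2.mem_iff.1 hx with rfl | rfl
    · obtain ⟨t, ht, htx⟩ := hxM
      have := hαinj i j ⟨by linarith [ht.1], ht.2⟩ h01 (htx.trans (hα0 i j).symm)
      linarith [ht.1]
    · exact hb i j
  let Z : Fin 3 → Set (ℝ × ℝ) := fun i => ⋃ j, (L (.inl i) ∪ H i j)
  have hZown : ∀ i, Z i ⊆ owned f γ (S (.inl i))
      (insideEdges G (S (.inl i)) ∪ Set.range (m i)) := by
    intro i
    refine Set.iUnion_subset fun j => Set.union_subset ?_ ?_
    · exact (drawing_subset_owned h _).trans (owned_mono subset_rfl Set.subset_union_left)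
    · refine (hHown i j).trans (owned_mono subset_rfl ?_)
      rintro _ rfl
      exact .inr ⟨j, rfl⟩
  have hLown : ∀ v, L v ⊆ owned f γ (S v) (insideEdges G (S v)) :=
    fun v => drawing_subset_owned h _
  refine noK33_plane (Z := Z) (R := fun j => L (.inr j)) (M := M) ?_ ?_ ?_ ?_ ?_ ?_ ?_ ?_ ?_ ?_
    ?_ ?_ ?_ ?_
  · exact fun i => isCompact_iUnion fun j =>
      (isCompact_drawing h _).union (isCompact_Icc.image (hα i j))
  · exact fun j => isCompact_drawing h _
  · exact fun i j => isCompact_Icc.image (hα i j)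
  · refine fun i => isPreconnected_iUnion ⟨f (a i 0), Set.mem_iInter.2 fun j => .inl (hHL i 0)⟩
      fun j => ?_
    exact (isPreconnected_drawing h (hlink _)).union (f (a i j)) (hHL i j) (hHa i j)
      (isPreconnected_Icc.image _ (hα i j).continuousOn)
  · exact fun j => isPreconnected_drawing h (hlink _)
  · exact fun i j => isPreconnected_Icc.image _ (hα i j).continuousOn
  · exact fun i j => ⟨α i j (1 / 2), ⟨_, by norm_num, rfl⟩,
      Set.mem_iUnion.2 ⟨j, .inr ⟨_, by norm_num, rfl⟩⟩⟩
  · exact fun i j => ⟨f (b i j), hMb i j, .inl ⟨_, hb i j, rfl⟩⟩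
  · intro i i' hi
    refine (disjoint_owned h (hdisj (Sum.inl_injective.ne hi)) ?_).mono (hZown i) (hZown i')
    refine Set.disjoint_left.2 ?_
    rintro e (he | ⟨j, rfl⟩) (he' | ⟨j', he'⟩)
    · exact Set.disjoint_left.1 (hin (Sum.inl_injective.ne hi)) he he'
    · exact hmin (he' ▸ he)
    · exact hmin he'
    · exact hi (hm he').1.symm
  · intro j j' hj
    exact (disjoint_owned h (hdisj (Sum.inr_injective.ne hj))
      (hin (Sum.inr_injective.ne hj))).mono (hLown _) (hLown _)
  · intro i j
    refine (disjoint_owned h (hdisj Sum.inl_ne_inr) ?_).mono (hZown i) (hLown _)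
    refine Set.disjoint_left.2 ?_
    rintro e (he | ⟨j, rfl⟩) he'
    · exact Set.disjoint_left.1 (hin Sum.inl_ne_inr) he he'
    · exact hmin he'
  · intro i i' j hi
    refine (disjoint_owned h (hdisj Sum.inr_ne_inl) ?_).mono (hMown i j) (hZown i')
    refine Set.disjoint_left.2 ?_
    rintro e rfl (he | ⟨j', he⟩)
    · exact hmin he
    · exact hi (hm he).1.symm
  · intro i j j' hj
    refine (disjoint_owned h (hdisj (Sum.inr_injective.ne hj)) ?_).mono (hMown i j) (hLown _)
    exact Set.disjoint_singleton_left.2 hmin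
  · intro i i' j j' hj
    refine (disjoint_owned h (hdisj (Sum.inr_injective.ne hj)) ?_).mono (hMown i j) (hMown i' j')
    exact Set.disjoint_singleton.2 fun e => hj (hm e).2

end PlanarOrder

/-- For every finite planar graph `G`, `semiweak_4(G) ≤ 43`; moreover, in terms of the
girth (`egirth`, with value `∞` for acyclic graphs): if the girth is at least `10` then
`semiweak_4(G) ≤ 33`, at least `11` gives `≤ 23`, at least `13` gives `≤ 18`, and at
least `17` gives `≤ 9`. -/
theorem semiweak_four_planar {V : Type} [Fintype V] (G : SimpleGraph V)
    (hplanar : IsPlanar G) :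
    semiweak G 4 ≤ 43 ∧
    ((10 : ℕ∞) ≤ G.egirth → semiweak G 4 ≤ 33) ∧
    ((11 : ℕ∞) ≤ G.egirth → semiweak G 4 ≤ 23) ∧
    ((13 : ℕ∞) ≤ G.egirth → semiweak G 4 ≤ 18) ∧
    ((17 : ℕ∞) ≤ G.egirth → semiweak G 4 ≤ 9) :=
  PlanarOrder.semiweak_of_noK33 (PlanarOrder.noK33_of_isPlanar hplanar)
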